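/- Let Q be a finite set of cubes which is dyadically complete and let f ∈ L^1(ℝ^d) with var_{∪Q} f < ∞. For λ ∈ ℝ set Q^λ = {Q ∈ Q : f_Q ≥ λ}. Then ∫_{−∞}^{∞} H^{d−1}( ∂(∪Q^λ) \ cl*{f ≥ λ} ) dλ ≤ C_d ∫_{−∞}^{∞} H^{d−1}( ∂*{f ≥ λ} ∩ ∪Q ) dλ, where C_d depends only on the dimension, ∂ denotes the topological boundary and ∂*, cl* the measure theoretic boundary and closure. -/

import Mathlib

open MeasureTheory Metric Set Filter
open scoped ENNReal NNReal Topology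

noncomputable section

/-- Euclidean space `ℝ^d`. -/
abbrev Euc (d : ℕ) := EuclideanSpace ℝ (Fin d)

/-- The divergence of a vector field `φ : ℝ^d → ℝ^d`. -/
def diverg (d : ℕ) (φ : Euc d → Euc d) (x : Euc d) : ℝ :=
  ∑ i : Fin d, fderiv ℝ φ x (EuclideanSpace.single i 1) i

/-- The variation of `f` on an open set `Ω`:
`var_Ω f = sup { ∫_Ω f div φ : φ ∈ C_c^1(Ω; ℝ^d), |φ| ≤ 1 }`. -/
def variation (d : ℕ) (Ω : Set (Euc d)) (f : Euc d → ℝ) : ℝ≥0∞ :=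
  ⨆ (φ : Euc d → Euc d) (_ : ContDiff ℝ 1 φ) (_ : HasCompactSupport φ)
    (_ : tsupport φ ⊆ Ω) (_ : ∀ x, ‖φ x‖ ≤ 1),
    ENNReal.ofReal (∫ x in Ω, f x * diverg d φ x)

/-- `Q` is a cube of side length `l`: the image of `(0,1)^d` scaled by `l`,
rotated and translated. -/
def IsCubeOfSide (d : ℕ) (l : ℝ) (Q : Set (Euc d)) : Prop :=
  0 < l ∧ ∃ (r : Euc d ≃ₗᵢ[ℝ] Euc d) (v : Euc d),
    Q = (fun x => l • r x + v) '' {x : Euc d | ∀ i, x i ∈ Set.Ioo (0:ℝ) 1}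

/-- `Q` is a cube (of some positive side length, arbitrary orientation). -/
def IsCube (d : ℕ) (Q : Set (Euc d)) : Prop := ∃ l, IsCubeOfSide d l Q

/-- The side length of a cube, recovered from its volume. -/
def sideLength (d : ℕ) (Q : Set (Euc d)) : ℝ := (volume Q).toReal ^ ((d:ℝ)⁻¹)

/-- The center of a cube, recovered as its barycenter. -/
def cubeCenter (d : ℕ) (Q : Set (Euc d)) : Euc d := (volume Q).toReal⁻¹ • ∫ x in Q, x

/-- The dilate `KQ = {c_Q + K r : c_Q + r ∈ Q}` of a cube `Q` about its center. -/
def dilate (d : ℕ) (K : ℝ) (Q : Set (Euc d)) : Set (Euc d) :=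
  {y | ∃ x ∈ Q, y = cubeCenter d Q + K • (x - cubeCenter d Q)}

/-- `Q ∈ Δ(Q0)`: `Q` is a dyadic subcube of the cube `Q0`, i.e. the image under the
affine bijection mapping `(0,1)^d` onto `Q0` of a dyadic subcube of `(0,1)^d`. -/
def IsDyadicOf (d : ℕ) (Q Q0 : Set (Euc d)) : Prop :=
  ∃ (l : ℝ) (r : Euc d ≃ₗᵢ[ℝ] Euc d) (v : Euc d), 0 < l ∧
    Q0 = (fun x => l • r x + v) '' {x : Euc d | ∀ i, x i ∈ Set.Ioo (0:ℝ) 1} ∧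
    ∃ (n : ℕ) (k : Fin d → ℕ), (∀ i, k i < 2 ^ n) ∧
      Q = (fun x => l • r x + v) ''
        {x : Euc d | ∀ i, x i ∈ Set.Ioo ((k i : ℝ) / 2 ^ n) (((k i : ℝ) + 1) / 2 ^ n)}

/-- A set of cubes is dyadically complete if for all `Q0, P` in it with `P ⊆ Q0`,
every dyadic cube `Q ∈ Δ(Q0)` with `P ⊆ Q` also belongs to it. -/
def DyadicComplete (d : ℕ) (𝒬 : Set (Set (Euc d))) : Prop :=
  ∀ Q0 ∈ 𝒬, ∀ P ∈ 𝒬, P ⊆ Q0 → ∀ Q, IsDyadicOf d Q Q0 → P ⊆ Q → Q ∈ 𝒬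

/-- The measure theoretic closure `cl* E = {x : limsup_{r→0} |B(x,r)∩E|/r^d > 0}`. -/
def mClosure (d : ℕ) (E : Set (Euc d)) : Set (Euc d) :=
  {x | 0 < Filter.limsup (fun r : ℝ => volume (Metric.ball x r ∩ E) / ENNReal.ofReal (r ^ d))
      (nhdsWithin 0 (Set.Ioi 0))}

/-- The measure theoretic boundary `∂* E = cl* E ∩ cl* (Eᶜ)`. -/
def mBoundary (d : ℕ) (E : Set (Euc d)) : Set (Euc d) := mClosure d E ∩ mClosure d Eᶜ

/-- `E` has locally finite perimeter: the variation of its indicator function is finite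
on every bounded open set. -/
def HasLocallyFinitePerimeter (d : ℕ) (E : Set (Euc d)) : Prop :=
  ∀ V : Set (Euc d), IsOpen V → Bornology.IsBounded V →
    variation d V (Set.indicator E fun _ => (1:ℝ)) < ⊤

/-- The integral average `f_Q = |Q|⁻¹ ∫_Q f`. -/
def avg (d : ℕ) (f : Euc d → ℝ) (Q : Set (Euc d)) : ℝ :=
  (volume Q).toReal⁻¹ * ∫ x in Q, f x

/-- Points at which `E` has density at most `c` at all scales below `δ`. -/
def lowDens (d : ℕ) (E : Set (Euc d)) (c : ℝ≥0∞) (δ : ℝ) : Set (Euc d) :=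
  {x | ∀ r, 0 < r → r < δ → volume (ball x r ∩ E) ≤ c * ENNReal.ofReal (r ^ d)}

theorem volume_ball_euc (d : ℕ) (x : Euc d) {r : ℝ} (hr : 0 < r) :
    volume (ball x r) = ENNReal.ofReal (r ^ d) * volume (ball (0 : Euc d) 1) := by
  simpa using Measure.addHaar_ball_of_pos (volume : Measure (Euc d)) x hr

theorem volume_closedBall_euc (d : ℕ) (x : Euc d) {r : ℝ} (hr : 0 ≤ r) :
    volume (closedBall x r) = ENNReal.ofReal (r ^ d) * volume (ball (0 : Euc d) 1) := by
  simpa using Measure.addHaar_closedBall (volume : Measure (Euc d)) x hr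

theorem lowDens_mono {d : ℕ} {E : Set (Euc d)} {c c' : ℝ≥0∞} {δ δ' : ℝ} (hc : c ≤ c')
    (hδ : δ' ≤ δ) : lowDens d E c δ ⊆ lowDens d E c' δ' :=
  fun _ hx r h0 hr => (hx r h0 (hr.trans_le hδ)).trans (by gcongr)

theorem isClosed_lowDens (d : ℕ) (E : Set (Euc d)) (c : ℝ≥0∞) (δ : ℝ) :
    IsClosed (lowDens d E c δ) := by
  refine isClosed_of_closure_subset fun x hx r h0 hr => ?_
  have key : ∀ s < r, volume (ball x s ∩ E) ≤ c * ENNReal.ofReal (r ^ d) := by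
    intro s hs
    obtain ⟨y, hy, hxy⟩ := Metric.mem_closure_iff.1 hx (r - s) (by linarith)
    refine (measure_mono (inter_subset_inter_left _ ?_)).trans (hy r h0 hr)
    exact ball_subset_ball' (by linarith)
  have hU : ball x r ∩ E = ⋃ n : ℕ, ball x (r - 1 / ((n : ℝ) + 1)) ∩ E := by
    rw [← iUnion_inter]
    congr 1
    ext y
    simp only [mem_ball, mem_iUnion]
    constructor
    · intro h
      obtain ⟨n, hn⟩ := exists_nat_one_div_lt (sub_pos.2 h)
      exact ⟨n, by linarith⟩
    · rintro ⟨n, hn⟩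
      have : (0 : ℝ) < 1 / ((n : ℝ) + 1) := by positivity
      linarith
  have hm : Monotone fun n : ℕ => ball x (r - 1 / ((n : ℝ) + 1)) ∩ E := by
    intro m n hmn
    refine inter_subset_inter_left _ (ball_subset_ball ?_)
    have : (1 : ℝ) / ((n : ℝ) + 1) ≤ 1 / ((m : ℝ) + 1) := by
      gcongr
    linarith
  rw [hU, hm.measure_iUnion]
  refine iSup_le fun n => key _ ?_
  have : (0 : ℝ) < 1 / ((n : ℝ) + 1) := by positivity
  linarith

theorem notMem_mClosure_iff {d : ℕ} {E : Set (Euc d)} {x : Euc d} :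
    x ∉ mClosure d E ↔ ∀ c : ℝ≥0∞, 0 < c → ∃ δ : ℝ, 0 < δ ∧ x ∈ lowDens d E c δ := by
  simp only [mClosure, mem_ofPred_eq, not_lt, nonpos_iff_eq_zero]
  constructor
  · intro h c hc
    have h1 := Filter.eventually_lt_of_limsup_lt (h.trans_lt hc)
    obtain ⟨δ, hδ, h2⟩ := mem_nhdsGT_iff_exists_Ioo_subset.1 h1
    refine ⟨δ, hδ, fun r h0 hr => ?_⟩
    have h3 : volume (ball x r ∩ E) / ENNReal.ofReal (r ^ d) < c := h2 ⟨h0, hr⟩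
    exact (ENNReal.div_le_iff_le_mul (Or.inl (by simpa using pow_pos h0 d))
      (Or.inl ENNReal.ofReal_ne_top)).1 h3.le
  · intro h
    refine le_antisymm (le_of_forall_gt_imp_ge_of_dense fun c hc => ?_) zero_le
    obtain ⟨δ, hδ, hx⟩ := h c hc
    refine limsup_le_of_le (by isBoundedDefault) ?_
    filter_upwards [Ioo_mem_nhdsGT hδ] with r hr
    exact ENNReal.div_le_of_le_mul (hx r hr.1 hr.2)

theorem mClosure_congr_ae {d : ℕ} {E F : Set (Euc d)} (h : E =ᵐ[volume] F) :
    mClosure d E = mClosure d F := by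
  have (x : Euc d) (r : ℝ) : volume (ball x r ∩ E) = volume (ball x r ∩ F) :=
    measure_congr ((ae_eq_refl _).inter h)
  simp [mClosure, this]

theorem mBoundary_congr_ae {d : ℕ} {E F : Set (Euc d)} (h : E =ᵐ[volume] F) :
    mBoundary d E = mBoundary d F := by
  rw [mBoundary, mBoundary, mClosure_congr_ae h, mClosure_congr_ae h.compl]

theorem compl_mClosure_eq (d : ℕ) (E : Set (Euc d)) :
    (mClosure d E)ᶜ = ⋂ n : ℕ, ⋃ m : ℕ, lowDens d E (1 / (n + 1)) (1 / ((m : ℝ) + 1)) := by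
  ext x
  simp only [mem_compl_iff, mem_iInter, mem_iUnion]
  rw [notMem_mClosure_iff]
  constructor
  · intro h n
    obtain ⟨δ, hδ, hx⟩ := h (1 / (n + 1)) (ENNReal.div_pos one_ne_zero (by simp))
    obtain ⟨m, hm⟩ := exists_nat_one_div_lt hδ
    exact ⟨m, lowDens_mono le_rfl hm.le hx⟩
  · intro h c hc
    obtain ⟨n, hn⟩ := ENNReal.exists_inv_nat_lt hc.ne'
    obtain ⟨m, hm⟩ := h n
    refine ⟨1 / ((m : ℝ) + 1), by positivity, lowDens_mono ?_ le_rfl hm⟩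
    refine le_trans ?_ hn.le
    rw [one_div]
    exact ENNReal.inv_le_inv.2 le_self_add

theorem measurableSet_mClosure (d : ℕ) (E : Set (Euc d)) : MeasurableSet (mClosure d E) := by
  rw [← MeasurableSet.compl_iff, compl_mClosure_eq]
  exact .iInter fun n => .iUnion fun m => (isClosed_lowDens _ _ _ _).measurableSet

theorem measurableSet_mBoundary (d : ℕ) (E : Set (Euc d)) : MeasurableSet (mBoundary d E) :=
  (measurableSet_mClosure d E).inter (measurableSet_mClosure d Eᶜ)

theorem lowDens_compl_subset_mClosure {d : ℕ} {E : Set (Euc d)} {c : ℝ≥0∞} {δ : ℝ} (hδ : 0 < δ)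
    (hc : c < volume (ball (0 : Euc d) 1)) : lowDens d Eᶜ c δ ⊆ mClosure d E := by
  intro x hx
  by_contra hxE
  obtain ⟨δ', hδ', hx'⟩ := notMem_mClosure_iff.1 hxE ((volume (ball (0 : Euc d) 1) - c) / 2)
    (ENNReal.div_pos (tsub_pos_of_lt hc).ne' (by simp))
  set r := min δ δ' / 2
  have hr : 0 < r := by positivity
  have h1 := hx r hr (by have := min_le_left δ δ'; have : 0 < min δ δ' := by positivity
                         simp only [r]; linarith)
  have h2 := hx' r hr (by have := min_le_right δ δ'; have : 0 < min δ δ' := by positivity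
                          simp only [r]; linarith)
  have h3 : volume (ball x r) ≤ volume (ball x r ∩ E) + volume (ball x r ∩ Eᶜ) := by
    refine (measure_mono ?_).trans (measure_union_le _ _)
    rw [← inter_union_distrib_left]; simp
  rw [volume_ball_euc d x hr, mul_comm] at h3
  have h4 := h3.trans (add_le_add h2 h1)
  rw [← add_mul] at h4
  have h5 : ENNReal.ofReal (r ^ d) ≠ 0 := by simpa using pow_pos hr d
  rw [ENNReal.mul_le_mul_iff_left h5 ENNReal.ofReal_ne_top] at h4
  have hfin : volume (ball (0 : Euc d) 1) ≠ ⊤ := measure_ball_lt_top.ne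
  have hne : volume (ball (0 : Euc d) 1) - c ≠ 0 := (tsub_pos_of_lt hc).ne'
  have h6 : (volume (ball (0 : Euc d) 1) - c) / 2 + c <
      (volume (ball (0 : Euc d) 1) - c) + c := by
    refine ENNReal.add_lt_add_right hc.ne_top (ENNReal.half_lt_self hne ?_)
    exact ENNReal.sub_ne_top hfin
  rw [tsub_add_cancel_of_le hc.le] at h6
  exact absurd h4 (not_le.2 h6)

theorem mClosure_union_compl (d : ℕ) (E : Set (Euc d)) :
    mClosure d E ∪ mClosure d Eᶜ = univ := by
  refine eq_univ_of_forall fun x => ?_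
  by_contra h
  rw [mem_union, not_or] at h
  have hv : 0 < volume (ball (0 : Euc d) 1) := measure_ball_pos _ _ one_pos
  obtain ⟨δ, hδ, hx⟩ := notMem_mClosure_iff.1 h.2 _
    (ENNReal.half_pos hv.ne')
  exact h.1 (lowDens_compl_subset_mClosure hδ
    (ENNReal.half_lt_self hv.ne' measure_ball_lt_top.ne) hx)

theorem volume_compl_inter_mClosure {d : ℕ} {E : Set (Euc d)} (hE : MeasurableSet E) :
    volume (Eᶜ ∩ mClosure d E) = 0 := by
  have h := Besicovitch.ae_tendsto_measure_inter_div_of_measurableSet (volume : Measure (Euc d)) hE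
  refine measure_mono_null ?_ h
  intro x hx hlim
  have hxE : x ∉ E := hx.1
  rw [mem_ofPred_eq, indicator_of_notMem hxE] at hlim
  refine notMem_mClosure_iff.2 (fun c hc => ?_) hx.2
  have hv : volume (ball (0 : Euc d) 1) ≠ 0 := (measure_ball_pos _ _ one_pos).ne'
  have hv' : volume (ball (0 : Euc d) 1) ≠ ⊤ := measure_ball_lt_top.ne
  obtain ⟨δ, hδ, h2⟩ := mem_nhdsGT_iff_exists_Ioo_subset.1
    (hlim.eventually_lt_const (ENNReal.div_pos hc.ne' hv'))
  refine ⟨δ, hδ, fun r h0 hr => ?_⟩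
  have h3 : volume (E ∩ closedBall x r) / volume (closedBall x r)
    < c / volume (ball (0 : Euc d) 1) := h2 ⟨h0, hr⟩
  have hb := volume_closedBall_euc d x h0.le
  have hb0 : volume (closedBall x r) ≠ 0 := (measure_closedBall_pos _ _ h0).ne'
  have hb1 : volume (closedBall x r) ≠ ⊤ := measure_closedBall_lt_top.ne
  have h4 := (ENNReal.div_le_iff_le_mul (Or.inl hb0) (Or.inl hb1)).1 h3.le
  calc volume (ball x r ∩ E) ≤ volume (E ∩ closedBall x r) :=
        measure_mono fun y hy => ⟨hy.2, ball_subset_closedBall hy.1⟩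
    _ ≤ _ := h4
    _ = c * ENNReal.ofReal (r ^ d) := by
        rw [hb, mul_comm (ENNReal.ofReal _), ← mul_assoc, ENNReal.div_mul_cancel hv hv']

theorem volume_inter_mClosure_compl {d : ℕ} {E : Set (Euc d)} (hE : MeasurableSet E) :
    volume (E ∩ mClosure d Eᶜ) = 0 := by
  simpa using volume_compl_inter_mClosure hE.compl

/-- The union of all lines in direction `w` that meet `G`. -/
def lineSat {d : ℕ} (w : Euc d) (G : Set (Euc d)) : Set (Euc d) := {y | ∃ t : ℝ, y + t • w ∈ G}

theorem lineSat_iUnion {d : ℕ} {ι : Sort*} (w : Euc d) (G : ι → Set (Euc d)) :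
    lineSat w (⋃ i, G i) = ⋃ i, lineSat w (G i) := by
  ext y
  simp only [lineSat, mem_iUnion, mem_ofPred_eq]
  exact exists_comm

theorem add_smul_mem_lineSat {d : ℕ} {w : Euc d} {G : Set (Euc d)} {y : Euc d} (s : ℝ) :
    y + s • w ∈ lineSat w G ↔ y ∈ lineSat w G := by
  constructor
  · rintro ⟨t, ht⟩
    exact ⟨s + t, by rwa [add_smul, ← add_assoc]⟩
  · rintro ⟨t, ht⟩
    refine ⟨t - s, ?_⟩
    convert ht using 1
    module

theorem volume_compl_mClosure_inter_le {d : ℕ} {E : Set (Euc d)} (hE : MeasurableSet E)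
    (B : Set (Euc d)) : volume ((mClosure d E)ᶜ ∩ B) ≤ volume (B ∩ Eᶜ) := by
  have h : (mClosure d E)ᶜ ∩ B ⊆ (B ∩ Eᶜ) ∪ (E ∩ mClosure d Eᶜ) := by
    rintro x ⟨h1, h2⟩
    by_cases hx : x ∈ E
    · right
      have : x ∈ mClosure d E ∪ mClosure d Eᶜ := by rw [mClosure_union_compl]; trivial
      exact ⟨hx, this.resolve_left h1⟩
    · exact Or.inl ⟨h2, hx⟩
  refine (measure_mono h).trans ((measure_union_le _ _).trans ?_)
  rw [volume_inter_mClosure_compl hE, add_zero]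

/-- The density threshold used for line arguments. -/
def densThr (d : ℕ) : ℝ≥0∞ := volume (ball (0 : Euc d) 1) / (4 * 6 ^ d)

theorem volume_lineSat_eq_zero_of_slab {d : ℕ} {E : Set (Euc d)} (hE : MeasurableSet E)
    {w : Euc d} (hw : ‖w‖ = 1) {δ a : ℝ} (hδ : 0 < δ) {G : Set (Euc d)}
    (hG : G ⊆ lowDens d Eᶜ (densThr d) δ)
    (hG' : ∀ x ∈ G, ∀ s : ℝ, 0 < s → s < δ → x + s • w ∉ mClosure d E)
    (ha : ∀ x ∈ G, a ≤ (inner ℝ w x) ∧ (inner ℝ w x) ≤ a + δ / 2) : volume (lineSat w G) = 0 := by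
  by_contra hZ
  set Z := lineSat w G with hZdef
  have hww : inner ℝ w w = 1 := by rw [real_inner_self_eq_norm_sq, hw]; norm_num
  have : (ae (volume.restrict Z)).NeBot := by
    rw [ae_neBot]; simpa using hZ
  obtain ⟨p, hp⟩ := (Besicovitch.ae_tendsto_measure_inter_div (volume : Measure (Euc d)) Z).exists
  have h1 : ∀ᶠ r in 𝓝[>] (0 : ℝ),
      (1 / 2 : ℝ≥0∞) < volume (Z ∩ closedBall p r) / volume (closedBall p r) :=
    hp.eventually_const_lt (ENNReal.half_lt_self one_ne_zero ENNReal.one_ne_top)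
  obtain ⟨r, hr, ⟨hr0, hrδ⟩⟩ := (h1.and (Ioo_mem_nhdsGT (show (0 : ℝ) < δ / 10 by positivity))).exists
  have hb0 : volume (closedBall p r) ≠ 0 := (measure_closedBall_pos _ _ hr0).ne'
  have hb1 : volume (closedBall p r) ≠ ⊤ := measure_closedBall_lt_top.ne
  have hr2 : 1 / 2 * volume (closedBall p r) < volume (Z ∩ closedBall p r) :=
    (ENNReal.lt_div_iff_mul_lt (Or.inl hb0) (Or.inl hb1)).1 hr
  set K := {x | x ∈ G ∧ ∃ s : ℝ, ‖x + s • w - p‖ ≤ r}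
  have hKne : K.Nonempty := by
    have : (Z ∩ closedBall p r).Nonempty := by
      by_contra hne
      rw [not_nonempty_iff_eq_empty] at hne
      simp [hne] at hr2
    obtain ⟨y, ⟨t, ht⟩, hy⟩ := this
    refine ⟨y + t • w, ht, -t, ?_⟩
    rw [mem_closedBall, dist_eq_norm] at hy
    have e : y + t • w + (-t) • w - p = y - p := by module
    rwa [e]
  set S := (fun x => (inner ℝ w x)) '' K
  have hSb : BddAbove S := ⟨a + δ / 2, by rintro _ ⟨x, hx, rfl⟩; exact (ha x hx.1).2⟩
  obtain ⟨_, ⟨x, hxK, rfl⟩, hx⟩ := exists_lt_of_lt_csSup (hKne.image (fun x => (inner ℝ w x)))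
    (show sSup S - r / 2 < sSup S by linarith)
  obtain ⟨hxG, s, hs⟩ := hxK
  simp only at hx
  set σ := (inner ℝ w x) + 2 * r - (inner ℝ w p) with hσ
  set p' := p + σ • w with hp'
  have hhp' : inner ℝ w p' = (inner ℝ w x) + 2 * r := by
    rw [hp', inner_add_right, inner_smul_right, hww]; ring
  have hsub : Z ∩ closedBall p' r ⊆ (mClosure d E)ᶜ ∩ closedBall p' r := by
    rintro q ⟨⟨t, ht⟩, hq⟩
    refine ⟨?_, hq⟩
    rw [mem_closedBall, dist_eq_norm] at hq
    have hK : q + t • w ∈ K := by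
      refine ⟨ht, -t - σ, ?_⟩
      have e : q + t • w + (-t - σ) • w - p = q - p' := by rw [hp']; module
      rwa [e]
    have h2 : (inner ℝ w (q + t • w)) ≤ sSup S := le_csSup hSb ⟨_, hK, rfl⟩
    have h3 : |(inner ℝ w (q - p'))| ≤ r := by
      refine (abs_real_inner_le_norm _ _).trans ?_
      rw [hw, one_mul]; exact hq
    rw [inner_sub_right, hhp', abs_le] at h3
    have h4 := (ha _ ht).1
    have h5 := (ha _ hxG).2
    rw [inner_add_right, inner_smul_right, hww] at h2 h4
    have h6 := hG' _ ht (-t) (by linarith) (by linarith)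
    simpa using h6
  have hball : closedBall p' r ⊆ ball x (6 * r) := by
    refine (closedBall_subset_ball' (ε₂ := 6 * r) ?_)
    rw [dist_eq_norm]
    have e1 : p' - x = (s + σ) • w - (x + s • w - p) := by rw [hp']; module
    have e2 : |(inner ℝ w (x + s • w - p))| ≤ r := by
      refine (abs_real_inner_le_norm _ _).trans ?_
      rw [hw, one_mul]; exact hs
    have e3 : (inner ℝ w (x + s • w - p)) = (s + σ) - 2 * r := by
      rw [inner_sub_right, inner_add_right, inner_smul_right, hww, hσ]; ring
    rw [e3, abs_le] at e2
    have e4 : ‖p' - x‖ ≤ |s + σ| + r := by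
      rw [e1]
      refine (norm_sub_le _ _).trans ?_
      rw [norm_smul, hw, mul_one, Real.norm_eq_abs]
      linarith
    have e5 : |s + σ| ≤ 3 * r := by rw [abs_le]; constructor <;> linarith
    linarith
  have htrans : volume (Z ∩ closedBall p r) = volume (Z ∩ closedBall p' r) := by
    rw [← measure_preimage_add_right volume (σ • w) (Z ∩ closedBall p' r)]
    congr 1
    ext y
    simp only [mem_inter_iff, mem_preimage, mem_closedBall, hp', dist_add_right]
    rw [hZdef, add_smul_mem_lineSat]
  have hfin : volume (Z ∩ closedBall p r) ≤ densThr d * ENNReal.ofReal ((6 * r) ^ d) := by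
    rw [htrans]
    calc _ ≤ volume ((mClosure d E)ᶜ ∩ closedBall p' r) := measure_mono hsub
      _ ≤ volume (closedBall p' r ∩ Eᶜ) := volume_compl_mClosure_inter_le hE _
      _ ≤ volume (ball x (6 * r) ∩ Eᶜ) := measure_mono (inter_subset_inter_left _ hball)
      _ ≤ _ := hG hxG _ (by linarith) (by linarith)
  have h7 := hr2.trans_le hfin
  rw [volume_closedBall_euc d p hr0.le, densThr, mul_pow, ENNReal.ofReal_mul (by positivity)] at h7
  have hv' : volume (ball (0 : Euc d) 1) ≠ ⊤ := measure_ball_lt_top.ne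
  have h8 := ENNReal.toReal_strict_mono (by finiteness) h7
  rw [ENNReal.toReal_mul, ENNReal.toReal_mul, ENNReal.toReal_mul, ENNReal.toReal_div,
    ENNReal.toReal_div, ENNReal.toReal_mul, ENNReal.toReal_mul,
    ENNReal.toReal_ofReal (by positivity), ENNReal.toReal_ofReal (by positivity)] at h8
  simp only [ENNReal.toReal_one, ENNReal.toReal_ofNat, ENNReal.toReal_pow] at h8
  have hvp : 0 < (volume (ball (0 : Euc d) 1)).toReal :=
    ENNReal.toReal_pos (measure_ball_pos _ _ one_pos).ne' hv'
  have h9 : (volume (ball (0 : Euc d) 1)).toReal / (4 * 6 ^ d) * (6 ^ d * r ^ d)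
      = 4⁻¹ * (r ^ d * (volume (ball (0 : Euc d) 1)).toReal) := by field_simp
  rw [h9] at h8
  have : 0 < r ^ d * (volume (ball (0 : Euc d) 1)).toReal := by positivity
  linarith

theorem volume_lineSat_eq_zero {d : ℕ} {E : Set (Euc d)} (hE : MeasurableSet E)
    {w : Euc d} (hw : ‖w‖ = 1) {δ : ℝ} (hδ : 0 < δ) {G : Set (Euc d)}
    (hG : G ⊆ lowDens d Eᶜ (densThr d) δ)
    (hG' : ∀ x ∈ G, ∀ s : ℝ, 0 < s → s < δ → x + s • w ∉ mClosure d E) :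
    volume (lineSat w G) = 0 := by
  have hU : G = ⋃ j : ℤ, {x | x ∈ G ∧ ⌊(inner ℝ w x) / (δ / 2)⌋ = j} := by
    ext x; simp
  rw [hU, lineSat_iUnion, measure_iUnion_null_iff]
  intro j
  refine volume_lineSat_eq_zero_of_slab hE hw hδ (fun x hx => hG hx.1) (fun x hx => hG' x hx.1)
    (a := j * (δ / 2)) ?_
  rintro x ⟨_, hx⟩
  obtain ⟨h1, h2⟩ := Int.floor_eq_iff.1 hx
  have hd2 : 0 < δ / 2 := by positivity
  rw [le_div_iff₀ hd2] at h1
  rw [div_lt_iff₀ hd2] at h2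
  exact ⟨h1, by linarith⟩

theorem exists_left_gap {I : Set ℝ} {t₀ s ε : ℝ} (hF : frontier I ∩ Ioo (t₀ - ε) (t₀ + ε) ⊆ I)
    (ht₀ : t₀ ∈ I) (hs : s ∉ I) (hst : s < t₀) (hsε : t₀ - ε < s) :
    ∃ b ∈ frontier I, b ∈ Ioo (t₀ - ε) (t₀ + ε) ∧ s < b ∧ Ioo s b ⊆ Iᶜ := by
  set A := {t | t ∈ I ∧ s ≤ t}
  have hA : BddBelow A := ⟨s, fun t ht => ht.2⟩
  have hAne : A.Nonempty := ⟨t₀, ht₀, hst.le⟩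
  have hsb : s ≤ sInf A := le_csInf hAne fun t ht => ht.2
  have hbt : sInf A ≤ t₀ := csInf_le hA ⟨ht₀, hst.le⟩
  have hgap : Ico s (sInf A) ⊆ Iᶜ := fun t ht h => not_le.2 ht.2 (csInf_le hA ⟨h, ht.1⟩)
  have hcl : sInf A ∈ closure I :=
    closure_mono (fun t ht => ht.1) (csInf_mem_closure hAne hA)
  have hfr : sInf A ∈ frontier I := by
    refine ⟨hcl, fun hint => ?_⟩
    rcases hsb.eq_or_lt with h | h
    · exact hs (h ▸ interior_subset hint)
    · obtain ⟨l, hl, hl'⟩ := exists_Ioc_subset_of_mem_nhds (mem_interior_iff_mem_nhds.1 hint) ⟨s, h⟩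
      have h1 : max l s < sInf A := max_lt hl h
      obtain ⟨u, hu1, hu2⟩ := exists_between h1
      exact hgap ⟨(le_max_right _ _).trans hu1.le, hu2⟩
        (hl' ⟨(le_max_left _ _).trans_lt hu1, hu2.le⟩)
  have hIoo : sInf A ∈ Ioo (t₀ - ε) (t₀ + ε) := ⟨by linarith, by linarith⟩
  have hbI := hF ⟨hfr, hIoo⟩
  refine ⟨sInf A, hfr, hIoo, hsb.lt_of_ne ?_, fun t ht => hgap ⟨ht.1.le, ht.2⟩⟩
  rintro h
  exact hs (h ▸ hbI)

theorem exists_gap {I : Set ℝ} {t₀ ε : ℝ} (hε : 0 < ε)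
    (hF : frontier I ∩ Ioo (t₀ - ε) (t₀ + ε) ⊆ I)
    (ht₀ : t₀ ∈ frontier I) :
    ∃ b ∈ frontier I, b ∈ Ioo (t₀ - ε) (t₀ + ε) ∧
      ∃ η > 0, Ioo (b - η) b ⊆ Iᶜ ∨ Ioo b (b + η) ⊆ Iᶜ := by
  have hI : t₀ ∈ I := hF ⟨ht₀, by constructor <;> linarith⟩
  have : t₀ ∈ closure Iᶜ := by
    rw [closure_compl]; exact ht₀.2
  obtain ⟨s, hs, hst⟩ := Metric.mem_closure_iff.1 this ε hε
  rw [Real.dist_eq, abs_lt] at hst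
  have hne : s ≠ t₀ := fun h => hs (h ▸ hI)
  rcases lt_or_gt_of_ne hne with h | h
  · obtain ⟨b, hb, hb', hsb, hg⟩ := exists_left_gap hF hI hs h (by linarith)
    exact ⟨b, hb, hb', b - s, by linarith, Or.inl (by simpa using hg)⟩
  · have hfr : frontier (-I) = - frontier I :=
      ((Homeomorph.neg ℝ).preimage_frontier I).symm
    obtain ⟨b, hb, hb', hsb, hg⟩ := exists_left_gap (I := -I) (t₀ := -t₀) (s := -s) (ε := ε)
      (by
        rw [hfr]
        rintro x ⟨hx, hx1, hx2⟩
        exact hF ⟨hx, by linarith, by linarith⟩)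
      (by simpa using hI) (by simpa using hs) (by linarith) (by linarith)
    rw [hfr] at hb
    refine ⟨-b, hb, ⟨by linarith [hb'.2], by linarith [hb'.1]⟩, s + b, by linarith, Or.inr ?_⟩
    rintro x ⟨hx1, hx2⟩ hx
    exact hg (show -x ∈ Ioo (-s) b by constructor <;> linarith) (by simpa using hx)

/-- A Baire category argument on the frontier of a set of reals. -/
theorem exists_gap_of_closed_cover {ι : Type*} [Countable ι] {I : Set ℝ} {C : ι → Set ℝ}
    (hI : I.Nonempty) (hI' : I ≠ univ) (hC : ∀ i, IsClosed (C i)) (hcov : frontier I ⊆ ⋃ i, C i)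
    (hCI : ∀ i, C i ⊆ I ∨ C i ⊆ Iᶜ) :
    ∃ i, ∃ b ∈ C i, ∃ η > 0,
      (C i ⊆ I ∧ (Ioo (b - η) b ⊆ Iᶜ ∨ Ioo b (b + η) ⊆ Iᶜ)) ∨
      (C i ⊆ Iᶜ ∧ (Ioo (b - η) b ⊆ I ∨ Ioo b (b + η) ⊆ I)) := by
  have hne : (frontier I).Nonempty := by
    rw [nonempty_iff_ne_empty, Ne, frontier_eq_empty_iff]
    exact fun h => h.elim hI.ne_empty hI'
  have : Nonempty (frontier I) := hne.to_subtype
  have : CompleteSpace (frontier I) := isClosed_frontier.completeSpace_coe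
  obtain ⟨i, ⟨t, ht⟩, hti⟩ := nonempty_interior_of_iUnion_of_closed
    (f := fun i => ((↑) : frontier I → ℝ) ⁻¹' C i)
    (fun i => (hC i).preimage continuous_subtype_val) (by
      rw [← preimage_iUnion]; exact eq_univ_of_forall fun x => hcov x.2)
  obtain ⟨ε, hε, hball⟩ := Metric.mem_nhds_iff.1 (mem_interior_iff_mem_nhds.1 hti)
  have hsub : frontier I ∩ Ioo (t - ε) (t + ε) ⊆ C i := by
    rintro x ⟨hx, hx1, hx2⟩
    refine hball (show (⟨x, hx⟩ : frontier I) ∈ ball _ ε from ?_)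
    rw [mem_ball, Subtype.dist_eq, Real.dist_eq, abs_lt]
    constructor <;> simp only <;> linarith
  refine ⟨i, ?_⟩
  rcases hCI i with h | h
  · obtain ⟨b, hb, hb', η, hη, hg⟩ := exists_gap hε (hsub.trans h) ht
    exact ⟨b, hsub ⟨hb, hb'⟩, η, hη, Or.inl ⟨h, hg⟩⟩
  · rw [← frontier_compl] at hsub ht
    obtain ⟨b, hb, hb', η, hη, hg⟩ := exists_gap hε (hsub.trans h) ht
    exact ⟨b, hsub ⟨hb, hb'⟩, η, hη, Or.inr ⟨h, by simpa using hg⟩⟩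

/-- Points where `E` is thick at all small scales although a segment in direction `w`
starting there avoids the closure of `E`. -/
def badSet {d : ℕ} (E : Set (Euc d)) (w : Euc d) (k : ℕ) : Set (Euc d) :=
  {x | x ∈ lowDens d Eᶜ (densThr d) (1 / ((k : ℝ) + 1)) ∧
    ∀ s : ℝ, 0 < s → s < 1 / ((k : ℝ) + 1) → x + s • w ∉ mClosure d E}

/-- The union of the lines in the unit direction `w` that meet some bad set. -/
def excUnit {d : ℕ} (E : Set (Euc d)) (w : Euc d) : Set (Euc d) :=
  ⋃ k, lineSat w (badSet E w k ∪ badSet E (-w) k ∪ badSet Eᶜ w k ∪ badSet Eᶜ (-w) k)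

theorem lineSat_neg {d : ℕ} (w : Euc d) (G : Set (Euc d)) : lineSat (-w) G = lineSat w G := by
  ext y
  constructor
  · rintro ⟨t, ht⟩
    exact ⟨-t, by simpa using ht⟩
  · rintro ⟨t, ht⟩
    exact ⟨-t, by simpa using ht⟩

theorem lineSat_union {d : ℕ} (w : Euc d) (G H : Set (Euc d)) :
    lineSat w (G ∪ H) = lineSat w G ∪ lineSat w H := by
  ext y
  exact exists_or

theorem volume_lineSat_badSet {d : ℕ} {E : Set (Euc d)} (hE : MeasurableSet E)
    {w : Euc d} (hw : ‖w‖ = 1) (k : ℕ) : volume (lineSat w (badSet E w k)) = 0 :=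
  volume_lineSat_eq_zero hE hw (δ := 1 / ((k : ℝ) + 1)) (by positivity) (fun _ hx => hx.1)
    fun _ hx => hx.2

theorem volume_excUnit {d : ℕ} {E : Set (Euc d)} (hE : MeasurableSet E)
    {w : Euc d} (hw : ‖w‖ = 1) : volume (excUnit E w) = 0 := by
  refine measure_iUnion_null fun k => ?_
  have hw' : ‖-w‖ = 1 := by rwa [norm_neg]
  simp only [lineSat_union, measure_union_null_iff]
  refine ⟨⟨⟨?_, ?_⟩, ?_⟩, ?_⟩
  · exact volume_lineSat_badSet hE hw k
  · rw [← lineSat_neg]; exact volume_lineSat_badSet hE hw' k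
  · exact volume_lineSat_badSet hE.compl hw k
  · rw [← lineSat_neg]; exact volume_lineSat_badSet hE.compl hw' k

theorem densThr_pos (d : ℕ) : 0 < densThr d :=
  ENNReal.div_pos (measure_ball_pos _ _ one_pos).ne' (by finiteness)

theorem densThr_lt (d : ℕ) : densThr d < volume (ball (0 : Euc d) 1) := by
  refine (ENNReal.div_lt_of_lt_mul ?_)
  have h0 : volume (ball (0 : Euc d) 1) ≠ 0 := (measure_ball_pos _ _ one_pos).ne'
  have h1 : volume (ball (0 : Euc d) 1) ≠ ⊤ := measure_ball_lt_top.ne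
  conv_lhs => rw [← mul_one (volume (ball (0 : Euc d) 1))]
  refine ENNReal.mul_lt_mul_right h0 h1 ?_
  have : (1 : ℝ≥0∞) ≤ 6 ^ d := one_le_pow₀ (by norm_num)
  calc (1 : ℝ≥0∞) < 4 * 1 := by norm_num
    _ ≤ _ := by gcongr

theorem exists_lowDens_of_notMem {d : ℕ} {E : Set (Euc d)} {x : Euc d} (hx : x ∉ mClosure d E) :
    ∃ k : ℕ, x ∈ lowDens d E (densThr d) (1 / ((k : ℝ) + 1)) := by
  obtain ⟨δ, hδ, h⟩ := notMem_mClosure_iff.1 hx _ (densThr_pos d)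
  obtain ⟨k, hk⟩ := exists_nat_one_div_lt hδ
  exact ⟨k, lowDens_mono le_rfl hk.le h⟩

theorem mem_badSet_of_gap {d : ℕ} {E : Set (Euc d)} {x w : Euc d} {k : ℕ} {η : ℝ} (hη : 0 < η)
    (hx : x ∈ lowDens d Eᶜ (densThr d) (1 / ((k : ℝ) + 1)))
    (h : ∀ s : ℝ, 0 < s → s < η → x + s • w ∉ mClosure d E) : ∃ j, x ∈ badSet E w j := by
  have : 0 < min η (1 / ((k : ℝ) + 1)) := lt_min hη (by positivity)
  obtain ⟨j, hj⟩ := exists_nat_one_div_lt this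
  refine ⟨j, lowDens_mono le_rfl (hj.le.trans (min_le_right _ _)) hx, fun s hs hs' => ?_⟩
  exact h s hs (hs'.trans (hj.trans_le (min_le_left _ _)))

set_option maxHeartbeats 800000 in
theorem exists_mem_mBoundary_of_unit {d : ℕ} {E : Set (Euc d)} {w x : Euc d} {T : ℝ} (hT : 0 < T)
    (hx : x ∉ excUnit E w) (h0 : x ∉ mClosure d E) (h1 : x + T • w ∉ mClosure d Eᶜ) :
    ∃ t ∈ Ioo 0 T, x + t • w ∈ mBoundary d E := by
  by_contra! hno
  have hγ : Continuous fun t : ℝ => x + t • w := by fun_prop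
  have hdisj (y : Euc d) : y ∈ mClosure d E ∨ y ∈ mClosure d Eᶜ := by
    have : y ∈ mClosure d E ∪ mClosure d Eᶜ := by rw [mClosure_union_compl]; trivial
    exact this
  have hA : ∀ t ∈ Icc 0 T, x + t • w ∈ mClosure d E → x + t • w ∉ mClosure d Eᶜ := by
    intro t ht h h'
    rcases ht.1.eq_or_lt with rfl | h2
    · exact h0 (by simpa using h)
    rcases ht.2.eq_or_lt with rfl | h3
    · exact h1 h'
    exact hno t ⟨h2, h3⟩ ⟨h, h'⟩
  set I : Set ℝ := {t | 0 ≤ t ∧ (t ≤ T → x + t • w ∉ mClosure d Eᶜ)} with hIdef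
  set C : Bool × ℕ → Set ℝ := fun p => Icc 0 T ∩
    (fun t : ℝ => x + t • w) ⁻¹' (lowDens d (bif p.1 then E else Eᶜ) (densThr d) (1 / ((p.2 : ℝ) + 1)))
  have h0I : (0 : ℝ) ∉ I := fun h => (hdisj x).elim h0 (by simpa using h.2 hT.le)
  have hTI : T ∈ I := ⟨hT.le, fun _ => h1⟩
  have hCt (k : ℕ) : C (true, k) ⊆ Iᶜ := by
    rintro t ⟨ht, hk⟩ htI
    refine htI.2 ht.2 (lowDens_compl_subset_mClosure (δ := 1 / ((k : ℝ) + 1)) (by positivity)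
      (densThr_lt d) ?_)
    simpa using hk
  have hCf (k : ℕ) : C (false, k) ⊆ I := by
    rintro t ⟨ht, hk⟩
    exact ⟨ht.1, fun _ => hA t ht (lowDens_compl_subset_mClosure (δ := 1 / ((k : ℝ) + 1))
      (by positivity) (densThr_lt d) hk)⟩
  have hfr : frontier I ⊆ ⋃ i, C i := by
    intro t ht
    have htIcc : t ∈ Icc 0 T := by
      refine ⟨?_, ?_⟩
      · exact closure_minimal (t := Ici (0 : ℝ)) (fun s hs => hs.1) isClosed_Ici ht.1
      · by_contra! h
        refine ht.2 (interior_maximal (s := I) (t := Ioi T) ?_ isOpen_Ioi h)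
        exact fun s hs => ⟨hT.le.trans (le_of_lt hs), fun h => absurd hs (not_lt.2 h)⟩
    rw [mem_iUnion]
    by_cases h : x + t • w ∈ mClosure d E
    · obtain ⟨k, hk⟩ := exists_lowDens_of_notMem (hA t htIcc h)
      exact ⟨(false, k), htIcc, hk⟩
    · obtain ⟨k, hk⟩ := exists_lowDens_of_notMem h
      exact ⟨(true, k), htIcc, hk⟩
  obtain ⟨⟨β, k⟩, b, hb, η, hη, hgap⟩ := exists_gap_of_closed_cover (C := C) ⟨T, hTI⟩
    (fun h => h0I (h ▸ mem_univ _))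
    (fun i => isClosed_Icc.inter ((isClosed_lowDens _ _ _ _).preimage hγ)) hfr
    (by rintro ⟨β, k⟩; cases β
        · exact Or.inl (hCf k)
        · exact Or.inr (hCt k))
  have hexc (v : Euc d) (hv : ∃ t : ℝ, x + t • w = v) (j : ℕ) :
      v ∉ badSet E w j ∧ v ∉ badSet E (-w) j ∧ v ∉ badSet Eᶜ w j ∧ v ∉ badSet Eᶜ (-w) j := by
    obtain ⟨t, rfl⟩ := hv
    have h : x + t • w ∉ badSet E w j ∪ badSet E (-w) j ∪ badSet Eᶜ w j ∪ badSet Eᶜ (-w) j :=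
      fun h => hx (mem_iUnion.2 ⟨j, t, h⟩)
    exact ⟨fun h' => h (Or.inl (Or.inl (Or.inl h'))), fun h' => h (Or.inl (Or.inl (Or.inr h'))),
      fun h' => h (Or.inl (Or.inr h')), fun h' => h (Or.inr h')⟩
  have hIout {t : ℝ} (ht : t ∈ Icc 0 T) (htI : t ∉ I) : x + t • w ∉ mClosure d E := fun h =>
    htI ⟨ht.1, fun _ => hA t ht h⟩
  have hbx (s : ℝ) : x + b • w + s • w = x + (b + s) • w := by module
  have hbx' (s : ℝ) : x + b • w + s • -w = x + (b - s) • w := by module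
  cases β
  · have hb0 : 0 < b := lt_of_le_of_ne hb.1.1 (fun h => h0I (h ▸ hCf k hb))
    rcases hgap with ⟨_, hg | hg⟩ | ⟨hg, -⟩
    · obtain ⟨j, hj⟩ := mem_badSet_of_gap (w := -w) (lt_min hη hb0) hb.2 (fun s hs hs' => by
        rw [hbx']
        have := lt_min_iff.1 hs'
        exact hIout ⟨by linarith, by linarith [hb.1.2]⟩ (hg ⟨by linarith, by linarith⟩))
      exact (hexc _ ⟨b, rfl⟩ j).2.1 hj
    · have hbT : b < T := by
        refine lt_of_le_of_ne hb.1.2 fun h => ?_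
        have hm : b + η / 2 ∈ Ioo b (b + η) := ⟨by linarith, by linarith⟩
        exact hg hm ⟨by linarith, fun h' => by linarith⟩
      obtain ⟨j, hj⟩ := mem_badSet_of_gap (w := w) (lt_min hη (sub_pos.2 hbT)) hb.2
        (fun s hs hs' => by
          rw [hbx]
          have := lt_min_iff.1 hs'
          exact hIout ⟨by linarith, by linarith [hb.1.2]⟩ (hg ⟨by linarith, by linarith⟩))
      exact (hexc _ ⟨b, rfl⟩ j).1 hj
    · exact hg hb (hCf k hb)
  · have hbT : b < T := lt_of_le_of_ne hb.1.2 (fun h => (hCt k hb) (h ▸ hTI))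
    have hb2 : x + b • w ∈ lowDens d Eᶜᶜ (densThr d) (1 / ((k : ℝ) + 1)) := by simpa using hb.2
    rcases hgap with ⟨hg, -⟩ | ⟨_, hg | hg⟩
    · exact hCt k hb (hg hb)
    · have hb0 : 0 < b := by
        refine lt_of_le_of_ne hb.1.1 fun h => ?_
        have hm : b - η / 2 ∈ Ioo (b - η) b := ⟨by linarith, by linarith⟩
        have := (hg hm).1
        linarith
      obtain ⟨j, hj⟩ := mem_badSet_of_gap (w := -w) (lt_min hη hb0) hb2 (fun s hs hs' => by
        rw [hbx']
        have := lt_min_iff.1 hs'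
        have hm : b - s ∈ Ioo (b - η) b := ⟨by linarith, by linarith⟩
        exact (hg hm).2 (by linarith [hb.1.2]))
      exact (hexc _ ⟨b, rfl⟩ j).2.2.2 hj
    · obtain ⟨j, hj⟩ := mem_badSet_of_gap (w := w) (lt_min hη (sub_pos.2 hbT)) hb2
        (fun s hs hs' => by
          rw [hbx]
          have := lt_min_iff.1 hs'
          have hm : b + s ∈ Ioo b (b + η) := ⟨by linarith, by linarith⟩
          exact (hg hm).2 (by linarith [hb.1.2]))
      exact (hexc _ ⟨b, rfl⟩ j).2.2.1 hj

/-- The exceptional set of lines in direction `w`. -/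
def exc {d : ℕ} (E : Set (Euc d)) (w : Euc d) : Set (Euc d) := excUnit E (‖w‖⁻¹ • w)

theorem volume_exc {d : ℕ} {E : Set (Euc d)} (hE : MeasurableSet E) {w : Euc d} (hw : w ≠ 0) :
    volume (exc E w) = 0 := by
  refine volume_excUnit hE ?_
  rw [norm_smul, norm_inv, norm_norm, inv_mul_cancel₀ (norm_ne_zero_iff.2 hw)]

theorem add_smul_mem_exc {d : ℕ} {E : Set (Euc d)} {w y : Euc d} (s : ℝ) :
    y + s • w ∈ exc E w ↔ y ∈ exc E w := by
  rcases eq_or_ne w 0 with rfl | hw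
  · simp
  have : s • w = (s * ‖w‖) • (‖w‖⁻¹ • w) := by
    rw [smul_smul, mul_assoc, mul_inv_cancel₀ (norm_ne_zero_iff.2 hw), mul_one]
  rw [this]
  simp only [exc, excUnit, mem_iUnion, add_smul_mem_lineSat]

/-- A line outside the exceptional set which passes from the exterior to the interior of `E`
meets the measure theoretic boundary in between. -/
theorem exists_mem_mBoundary {d : ℕ} {E : Set (Euc d)} {w x : Euc d} {T : ℝ} (hT : 0 < T)
    (hw : w ≠ 0) (hx : x ∉ exc E w) (h0 : x ∉ mClosure d E) (h1 : x + T • w ∉ mClosure d Eᶜ) :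
    ∃ t ∈ Ioo 0 T, x + t • w ∈ mBoundary d E := by
  have hw' : 0 < ‖w‖ := norm_pos_iff.2 hw
  have e (s : ℝ) : s • (‖w‖⁻¹ • w) = (s / ‖w‖) • w := by rw [smul_smul, div_eq_mul_inv]
  obtain ⟨t, ht, h⟩ := exists_mem_mBoundary_of_unit (T := T * ‖w‖) (by positivity) hx h0
    (by rw [e, mul_div_cancel_right₀ _ hw'.ne']; exact h1)
  rw [e] at h
  exact ⟨t / ‖w‖, ⟨by have := ht.1; positivity, by rw [div_lt_iff₀ hw']; exact ht.2⟩, h⟩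

/-- The open unit cube. -/
def ucube (d : ℕ) : Set (Euc d) := {x : Euc d | ∀ i, x i ∈ Set.Ioo (0:ℝ) 1}

/-- An axis parallel box. -/
def box (d : ℕ) (a b : Fin d → ℝ) : Set (Euc d) := {x : Euc d | ∀ i, x i ∈ Ioo (a i) (b i)}

theorem volume_box (d : ℕ) (a b : Fin d → ℝ) :
    volume (box d a b) = ∏ i, ENNReal.ofReal (b i - a i) := by
  rw [← Real.volume_pi_Ioo,
    ← (PiLp.volume_preserving_ofLp (Fin d)).measure_preimage
      (MeasurableSet.univ_pi fun _ => measurableSet_Ioo).nullMeasurableSet]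
  congr 1
  ext x
  simp [box]

theorem volume_ucube (d : ℕ) : volume (ucube d) = 1 := by
  rw [show ucube d = box d (fun _ => 0) (fun _ => 1) from rfl, volume_box]
  simp

theorem isOpen_box (d : ℕ) (a b : Fin d → ℝ) : IsOpen (box d a b) := by
  have : box d a b = ⋂ i, (fun x : Euc d => x i) ⁻¹' Ioo (a i) (b i) := by ext; simp [box]
  rw [this]
  exact isOpen_iInter_of_finite fun i => isOpen_Ioo.preimage (by fun_prop)

theorem isOpen_ucube (d : ℕ) : IsOpen (ucube d) := isOpen_box d (fun _ => 0) (fun _ => 1)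

theorem mem_Icc_of_mem_closure_box {d : ℕ} {a b : Fin d → ℝ} {x : Euc d}
    (hx : x ∈ closure (box d a b)) (i : Fin d) : x i ∈ Icc (a i) (b i) :=
  closure_minimal (t := (fun x : Euc d => x i) ⁻¹' Icc (a i) (b i))
    (fun y (hy : y ∈ box d a b) => Ioo_subset_Icc_self (hy i)) (isClosed_Icc.preimage (by fun_prop)) hx

theorem abs_coord_le_norm {d : ℕ} (x : Euc d) (i : Fin d) : |x i| ≤ ‖x‖ := PiLp.norm_apply_le x i

theorem norm_le_of_coord {d : ℕ} {x : Euc d} {M : ℝ} (hM : 0 ≤ M) (h : ∀ i, |x i| ≤ M) :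
    ‖x‖ ≤ d * M := by
  rw [EuclideanSpace.norm_eq]
  refine Real.sqrt_le_iff.2 ⟨by positivity, ?_⟩
  calc ∑ i, ‖x i‖ ^ 2 ≤ ∑ _i : Fin d, M ^ 2 := by
        gcongr with i
        exact h i
    _ = d * M ^ 2 := by simp
    _ ≤ (d * M) ^ 2 := by
        rw [mul_pow]
        gcongr
        exact_mod_cast Nat.le_self_pow two_ne_zero d

/-- A position of a cube: the image of the unit cube under `x ↦ l • r x + v`. -/
structure CubeFrame (d : ℕ) where
  /-- the side length -/
  l : ℝ
  hl : 0 < l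
  /-- the rotation -/
  r : Euc d ≃ₗᵢ[ℝ] Euc d
  /-- the translation -/
  v : Euc d

namespace CubeFrame

variable {d : ℕ} (F : CubeFrame d)

/-- The similarity mapping the unit cube to the cube. -/
def map (x : Euc d) : Euc d := F.l • F.r x + F.v

/-- The inverse of `CubeFrame.map`. -/
def inv (y : Euc d) : Euc d := F.r.symm (F.l⁻¹ • (y - F.v))

/-- The cube described by the frame. -/
def cube : Set (Euc d) := F.map '' ucube d

@[simp] theorem map_inv (y : Euc d) : F.map (F.inv y) = y := by
  simp [map, inv, smul_smul, mul_inv_cancel₀ F.hl.ne']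

@[simp] theorem inv_map (x : Euc d) : F.inv (F.map x) = x := by
  simp [map, inv, smul_smul, inv_mul_cancel₀ F.hl.ne']

theorem dist_map (x y : Euc d) : dist (F.map x) (F.map y) = F.l * dist x y := by
  rw [dist_eq_norm, dist_eq_norm, map, map, add_sub_add_right_eq_sub, ← smul_sub, ← map_sub,
    norm_smul, LinearIsometryEquiv.norm_map, Real.norm_of_nonneg F.hl.le]

theorem dist_inv (x y : Euc d) : dist (F.inv x) (F.inv y) = F.l⁻¹ * dist x y := by
  have := F.dist_map (F.inv x) (F.inv y)
  rw [map_inv, map_inv] at this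
  rw [this, ← mul_assoc, inv_mul_cancel₀ F.hl.ne', one_mul]

theorem continuous_map : Continuous F.map := by
  unfold map; fun_prop

theorem continuous_inv : Continuous F.inv := by
  unfold inv; fun_prop

/-- `CubeFrame.map` as a homeomorphism. -/
def homeo : Euc d ≃ₜ Euc d where
  toFun := F.map
  invFun := F.inv
  left_inv := F.inv_map
  right_inv := F.map_inv
  continuous_toFun := F.continuous_map
  continuous_invFun := F.continuous_inv

theorem image_map_eq (S : Set (Euc d)) : F.map '' S = F.inv ⁻¹' S :=
  F.homeo.toEquiv.image_eq_preimage_symm S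

theorem mem_cube_iff {y : Euc d} : y ∈ F.cube ↔ F.inv y ∈ ucube d := by
  rw [cube, image_map_eq, mem_preimage]

theorem isOpen_cube : IsOpen F.cube := F.homeo.isOpenMap _ (isOpen_ucube d)

open scoped Pointwise in
theorem volume_image (S : Set (Euc d)) :
    volume (F.map '' S) = ENNReal.ofReal (F.l ^ d) * volume S := by
  have h : F.map '' S = (fun x => x + F.v) '' (F.l • (F.r '' S)) := by
    rw [← image_smul, image_image, image_image]; rfl
  rw [h, image_add_right, measure_preimage_add_right, Measure.addHaar_smul, finrank_euclideanSpace_fin,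
    abs_of_pos (pow_pos F.hl d)]
  have h2 : F.r '' S = F.r.symm.toMeasurableEquiv ⁻¹' S := F.r.toEquiv.image_eq_preimage_symm S
  rw [h2, MeasurePreserving.measure_preimage_equiv (μb := volume) F.r.symm.measurePreserving S]

theorem volume_cube : volume F.cube = ENNReal.ofReal (F.l ^ d) := by
  rw [cube, volume_image, volume_ucube, mul_one]

theorem inv_mem_Icc_of_mem_closure {y : Euc d} (hy : y ∈ closure F.cube) (i : Fin d) :
    F.inv y i ∈ Icc (0 : ℝ) 1 := by
  have h : closure F.cube = F.map '' closure (ucube d) := (F.homeo.image_closure _).symm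
  rw [h, image_map_eq] at hy
  exact mem_Icc_of_mem_closure_box (a := fun _ => 0) (b := fun _ => 1) hy i

end CubeFrame

theorem isCube_iff_exists_frame {d : ℕ} {Q : Set (Euc d)} :
    IsCube d Q ↔ ∃ F : CubeFrame d, Q = F.cube :=
  ⟨fun ⟨l, hl, r, v, h⟩ => ⟨⟨l, hl, r, v⟩, h⟩, fun ⟨F, h⟩ => ⟨F.l, F.hl, F.r, F.v, h⟩⟩

/-- The parametrization of `ℝ^{n+1}` by lines whose direction has `i`-th coordinate `1` and the
other coordinates given by `a`. -/
def shear {n : ℕ} (i : Fin (n + 1)) (a : Fin n → ℝ) (p : ℝ × (Fin n → ℝ)) : Euc (n + 1) :=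
  WithLp.toLp 2 (i.insertNth (α := fun _ => ℝ) p.1 (p.1 • a + p.2))

theorem shear_apply_same {n : ℕ} (i : Fin (n + 1)) (a : Fin n → ℝ) (p : ℝ × (Fin n → ℝ)) :
    shear i a p i = p.1 := by
  simp [shear]

theorem shear_apply_succAbove {n : ℕ} (i : Fin (n + 1)) (a : Fin n → ℝ) (p : ℝ × (Fin n → ℝ))
    (j : Fin n) : shear i a p (i.succAbove j) = p.1 * a j + p.2 j := by
  simp [shear]

theorem measurePreserving_shear {n : ℕ} (i : Fin (n + 1)) (a : Fin n → ℝ) :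
    MeasurePreserving (shear i a) := by
  have h1 : MeasurePreserving (fun p : ℝ × (Fin n → ℝ) => (p.1, p.1 • a + p.2))
      (volume.prod volume) (volume.prod volume) :=
    (MeasurePreserving.id (volume : Measure ℝ)).skew_product (g := fun t q => t • a + q)
      (by unfold Function.uncurry; fun_prop)
      (ae_of_all _ fun t => (measurePreserving_add_left volume (t • a)).map_eq)
  have h2 := (volume_preserving_piFinSuccAbove (fun _ : Fin (n + 1) => ℝ) i).symm
  exact ((PiLp.volume_preserving_toLp (Fin (n + 1))).comp h2).comp h1

/-- The projection of `ℝ^{n+1}` to `ℝ^n` along the direction `w`. -/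
def projAlong {n : ℕ} (i : Fin (n + 1)) (w : Euc (n + 1)) (y : Euc (n + 1)) : Fin n → ℝ :=
  fun j => y (i.succAbove j) - y i * (w (i.succAbove j) / w i)

theorem projAlong_shear {n : ℕ} (i : Fin (n + 1)) (w : Euc (n + 1)) (p : ℝ × (Fin n → ℝ)) :
    projAlong i w (shear i (fun j => w (i.succAbove j) / w i) p) = p.2 := by
  ext j
  simp [projAlong, shear_apply_same, shear_apply_succAbove]

theorem projAlong_add_smul {n : ℕ} {i : Fin (n + 1)} {w : Euc (n + 1)} (hw : w i ≠ 0)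
    (y : Euc (n + 1)) (t : ℝ) : projAlong i w (y + t • w) = projAlong i w y := by
  ext j
  simp only [projAlong, PiLp.add_apply, PiLp.smul_apply, smul_eq_mul]
  field_simp
  ring

theorem continuous_projAlong {n : ℕ} (i : Fin (n + 1)) (w : Euc (n + 1)) :
    Continuous (projAlong i w) := by
  unfold projAlong; fun_prop

theorem lipschitzWith_projAlong {n : ℕ} {i : Fin (n + 1)} {w : Euc (n + 1)} {K : ℝ≥0}
    (h : ∀ j, |w (i.succAbove j)| ≤ K * |w i|) : LipschitzWith (1 + K) (projAlong i w) := by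
  refine LipschitzWith.of_dist_le_mul fun x y => ?_
  rw [dist_pi_le_iff (by positivity)]
  intro j
  have h1 := abs_coord_le_norm (x - y) (i.succAbove j)
  have h2 := abs_coord_le_norm (x - y) i
  have h3 : |w (i.succAbove j) / w i| ≤ K := by
    rw [abs_div]
    exact div_le_of_le_mul₀ (abs_nonneg _) K.2 (h j)
  have h4 : projAlong i w x j - projAlong i w y j
      = (x - y) (i.succAbove j) - (x - y) i * (w (i.succAbove j) / w i) := by
    simp [projAlong]; ring
  rw [Real.dist_eq, h4, dist_eq_norm]
  refine (abs_sub _ _).trans ?_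
  rw [abs_mul]
  push_cast
  have := mul_le_mul h2 h3 (abs_nonneg _) (norm_nonneg _)
  linarith

theorem volume_projAlong_preimage {n : ℕ} (i : Fin (n + 1)) (w : Euc (n + 1)) {I : Set ℝ}
    (hI : MeasurableSet I) {G : Set (Fin n → ℝ)} (hG : MeasurableSet G) :
    volume {y : Euc (n + 1) | y i ∈ I ∧ projAlong i w y ∈ G} = volume I * volume G := by
  set a : Fin n → ℝ := fun j => w (i.succAbove j) / w i
  have hm : MeasurableSet {y : Euc (n + 1) | y i ∈ I ∧ projAlong i w y ∈ G} :=
    (hI.preimage (by fun_prop : Measurable fun y : Euc (n + 1) => y i)).inter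
      (hG.preimage (continuous_projAlong i w).measurable)
  rw [← (measurePreserving_shear i a).measure_preimage hm.nullMeasurableSet,
    Measure.volume_eq_prod, ← Measure.prod_prod]
  congr 1
  ext p
  simp [a, projAlong_shear, shear_apply_same]

namespace CubeFrame

theorem map_add_smul {d : ℕ} (F : CubeFrame d) (u w : Euc d) (t : ℝ) :
    F.map (u + t • F.r.symm w) = F.map u + (F.l * t) • w := by
  simp [map, smul_smul]
  module

theorem inv_add_smul {d : ℕ} (F : CubeFrame d) (y w : Euc d) (t : ℝ) :
    F.inv (y + t • w) = F.inv y + (t / F.l) • F.r.symm w := by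
  simp only [inv, map_smul, map_sub, map_add]
  module

theorem volume_preimage_map {d : ℕ} (F : CubeFrame d) (S : Set (Euc d)) :
    ENNReal.ofReal (F.l ^ d) * volume (F.map ⁻¹' S) = volume S := by
  rw [← volume_image]
  congr 1
  exact image_preimage_eq _ F.homeo.surjective

variable {n : ℕ} (F : CubeFrame (n + 1))

/-- The parametrization of the plane `{u_i = s}` in the coordinates of the cube. -/
def face (i : Fin (n + 1)) (s : ℝ) (q : Fin n → ℝ) : Euc (n + 1) :=
  F.map (shear i 0 (s, q))

theorem inv_face (i : Fin (n + 1)) (s : ℝ) (q : Fin n → ℝ) :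
    F.inv (F.face i s q) = shear i 0 (s, q) := by
  rw [face, inv_map]

theorem continuous_face (i : Fin (n + 1)) (s : ℝ) : Continuous (F.face i s) := by
  refine F.continuous_map.comp ?_
  unfold shear
  refine (PiLp.continuous_toLp 2 _).comp ?_
  fun_prop

theorem lipschitzWith_face (i : Fin (n + 1)) (s : ℝ) :
    LipschitzWith (F.l.toNNReal * (n + 1 : ℕ)) (F.face i s) := by
  refine LipschitzWith.of_dist_le_mul fun x y => ?_
  rw [face, face, dist_map, NNReal.coe_mul, Real.coe_toNNReal _ F.hl.le, mul_assoc]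
  refine mul_le_mul_of_nonneg_left ?_ F.hl.le
  rw [dist_eq_norm]
  refine norm_le_of_coord dist_nonneg fun j => ?_
  rw [PiLp.sub_apply]
  refine Fin.succAboveCases i ?_ (fun k => ?_) j
  · simp [shear_apply_same]
  · simp only [shear_apply_succAbove]
    simpa [Real.dist_eq] using dist_le_pi_dist x y k

theorem volume_face_exc {E : Set (Euc (n + 1))} (hE : MeasurableSet E) {w : Euc (n + 1)}
    {i : Fin (n + 1)} (hw : F.r.symm w i ≠ 0) (s : ℝ) :
    volume {q | F.face i s q ∈ exc E w} = 0 := by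
  have hw0 : w ≠ 0 := by
    rintro rfl
    simp at hw
  set ω := F.r.symm w with hω
  set a : Fin n → ℝ := fun j => ω (i.succAbove j) / ω i with ha
  have h1 : volume (F.map ⁻¹' exc E w) = 0 := by
    have := F.volume_preimage_map (exc E w)
    rw [volume_exc hE hw0, mul_eq_zero] at this
    refine this.resolve_left ?_
    simpa using pow_pos F.hl (n + 1)
  have h2 : ∀ᵐ p : ℝ × (Fin n → ℝ), F.map (shear i a p) ∉ exc E w :=
    (measurePreserving_shear i a).quasiMeasurePreserving.ae (p := fun u => F.map u ∉ exc E w)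
      (measure_eq_zero_iff_ae_notMem.1 h1)
  rw [Measure.volume_eq_prod] at h2
  obtain ⟨t, ht⟩ := (Measure.ae_ae_of_ae_prod h2).exists
  have h3 : volume ((fun q => q + s • a) ⁻¹' {q | F.face i s q ∈ exc E w}) = 0 := by
    refine measure_mono_null ?_ ht
    intro q hq hn
    refine hn ?_
    have e : shear i a (t, q) = shear i 0 (s, q + s • a) + ((t - s) / ω i) • ω := by
      ext j
      rw [PiLp.add_apply, PiLp.smul_apply, smul_eq_mul]
      refine Fin.succAboveCases i ?_ (fun k => ?_) j
      · simp only [shear_apply_same]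
        field_simp
        ring
      · simp only [shear_apply_succAbove, ha, Pi.zero_apply, Pi.add_apply, Pi.smul_apply,
          smul_eq_mul]
        field_simp
        ring
    rw [e, hω, map_add_smul, add_smul_mem_exc]
    exact hq
  rwa [measure_preimage_add_right] at h3

theorem volume_face_le {E : Set (Euc (n + 1))} (hE : MeasurableSet E) {w : Euc (n + 1)}
    {i : Fin (n + 1)} {s : ℝ} {K : ℝ≥0} (hw : F.r.symm w i ≠ 0)
    (hK : ∀ j, |F.r.symm w j| ≤ K * |F.r.symm w i|) {A : Set (Euc (n + 1))}
    (hA : ∀ x ∈ A, x ∉ mClosure (n + 1) E)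
    (hA' : ∀ x ∈ A, x - F.l • w ∉ mClosure (n + 1) Eᶜ) :
    volume {q | F.face i s q ∈ A} ≤ ((1 + K) * F.l.toNNReal⁻¹ : ℝ≥0) ^ n *
      μH[n] (mBoundary (n + 1) E ∩ {y | ∃ t ∈ Ioo 0 F.l, y + t • w ∈ A}) := by
  have hw0 : w ≠ 0 := by
    rintro rfl
    simp at hw
  set ω := F.r.symm w with hω
  set a : Fin n → ℝ := fun j => ω (i.succAbove j) / ω i with ha
  set D := mBoundary (n + 1) E ∩ {y | ∃ t ∈ Ioo 0 F.l, y + t • w ∈ A}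
  set g : Euc (n + 1) → (Fin n → ℝ) := fun y => projAlong i ω (F.inv y) + s • a with hg
  have hgL : LipschitzWith ((1 + K) * F.l.toNNReal⁻¹) g := by
    have h1 : LipschitzWith F.l.toNNReal⁻¹ F.inv := LipschitzWith.of_dist_le_mul fun x y => by
      rw [dist_inv, NNReal.coe_inv, Real.coe_toNNReal _ F.hl.le]
    have h2 := (lipschitzWith_projAlong (i := i) (w := ω) (K := K) fun j => hK _).comp h1
    intro x y
    rw [hg]
    simpa [edist_add_right] using h2 x y
  have hsub : {q | F.face i s q ∈ A} ⊆ {q | F.face i s q ∈ exc E (-w)} ∪ g '' D := by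
    intro q hq
    by_cases hex : F.face i s q ∈ exc E (-w)
    · exact Or.inl hex
    right
    obtain ⟨t, ht, h⟩ := exists_mem_mBoundary F.hl (neg_ne_zero.2 hw0) hex (hA _ hq)
      (by simpa [sub_eq_add_neg] using hA' _ hq)
    refine ⟨F.face i s q + t • -w, ⟨h, t, ht, by simpa using hq⟩, ?_⟩
    have e : F.face i s q + t • -w = F.face i s q + (-t) • w := by module
    simp only [hg]
    rw [e, inv_add_smul, projAlong_add_smul hw, inv_face]
    ext j
    simp only [Pi.add_apply, Pi.smul_apply, projAlong, shear_apply_same, shear_apply_succAbove,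
      smul_eq_mul, ha, Pi.zero_apply]
    ring
  refine (measure_mono hsub).trans ((measure_union_le _ _).trans ?_)
  have hw2 : F.r.symm (-w) i ≠ 0 := by simpa using hw
  rw [F.volume_face_exc hE hw2, zero_add]
  have h3 := hgL.hausdorffMeasure_image_le (d := (n : ℝ)) n.cast_nonneg D
  have h4 : (μH[(n : ℝ)] : Measure (Fin n → ℝ)) = volume := by
    rw [← hausdorffMeasure_pi_real, Fintype.card_fin]
  rw [h4, ENNReal.rpow_natCast] at h3
  exact h3

theorem le_volume_directions {E : Set (Euc (n + 1))} (hE : MeasurableSet E) {ε : ℝ} (hε : 0 < ε)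
    (hd : ENNReal.ofReal ε * volume F.cube ≤ volume (E ∩ F.cube)) {i : Fin (n + 1)} (x : Euc (n + 1)) :
    ENNReal.ofReal (ε / 2) ≤ volume {w : Euc (n + 1) | x - F.l • w ∈ F.cube ∧
      x - F.l • w ∉ mClosure (n + 1) Eᶜ ∧ ε / 4 ≤ |F.r.symm w i|} := by
  set u := F.inv x with hu
  set M := F.map ⁻¹' (F.cube ∩ (mClosure (n + 1) Eᶜ)ᶜ) with hM
  set W := {w : Euc (n + 1) | x - F.l • w ∈ F.cube ∧
      x - F.l • w ∉ mClosure (n + 1) Eᶜ ∧ ε / 4 ≤ |F.r.symm w i|} with hW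
  have h1 : ENNReal.ofReal ε ≤ volume M := by
    have hl : ENNReal.ofReal (F.l ^ (n + 1)) ≠ 0 := by simpa using pow_pos F.hl (n + 1)
    have h2 := F.volume_preimage_map (F.cube ∩ (mClosure (n + 1) Eᶜ)ᶜ)
    have h3 : volume (E ∩ F.cube) ≤ volume (F.cube ∩ (mClosure (n + 1) Eᶜ)ᶜ) := by
      have : E ∩ F.cube ⊆ (F.cube ∩ (mClosure (n + 1) Eᶜ)ᶜ) ∪ (E ∩ mClosure (n + 1) Eᶜ) := by
        rintro y ⟨h, h'⟩
        by_cases hy : y ∈ mClosure (n + 1) Eᶜ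
        · exact Or.inr ⟨h, hy⟩
        · exact Or.inl ⟨h', hy⟩
      refine (measure_mono this).trans ((measure_union_le _ _).trans ?_)
      rw [volume_inter_mClosure_compl hE, add_zero]
    have h4 := hd.trans h3
    rw [← h2, volume_cube, mul_comm] at h4
    exact (ENNReal.mul_le_mul_iff_right hl ENNReal.ofReal_ne_top).1 h4
  set W' := (fun z => F.r (u - z)) ⁻¹' W with hW'
  have hvol : volume W' = volume W := by
    have h5 : MeasurePreserving (fun z : Euc (n + 1) => F.r.toMeasurableEquiv (u - z))
        volume volume :=
      F.r.measurePreserving.comp (Measure.measurePreserving_sub_left volume u)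
    refine h5.measure_preimage ?_
    have hc : Continuous fun w : Euc (n + 1) => x - F.l • w := by fun_prop
    have hc' : Continuous fun w : Euc (n + 1) => |F.r.symm w i| := by fun_prop
    have hWm : MeasurableSet W := ((F.isOpen_cube.preimage hc).measurableSet).inter
      (((measurableSet_mClosure _ Eᶜ).compl.preimage hc.measurable).inter
      (measurableSet_le measurable_const hc'.measurable))
    exact hWm.nullMeasurableSet
  set B := box (n + 1) (Function.update 0 i (u i - ε / 4)) (Function.update 1 i (u i + ε / 4))
  have hB : volume B = ENNReal.ofReal (ε / 2) := by
    rw [volume_box, Finset.prod_eq_single i]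
    · simp only [Function.update_self]
      congr 1
      ring
    · intro j _ hj
      simp [Function.update_of_ne hj]
    · simp
  have hcov : M ⊆ W' ∪ B := by
    intro z hz
    have hz2 : x - F.l • F.r (u - z) = F.map z := by
      have h6 := F.map_add_smul u (F.r (u - z)) (-1)
      rw [LinearIsometryEquiv.symm_apply_apply, hu, map_inv, ← hu] at h6
      have e : u + (-1 : ℝ) • (u - z) = z := by module
      rw [e] at h6
      rw [h6]
      module
    by_cases hzi : ε / 4 ≤ |(u - z) i|
    · left
      refine ⟨?_, ?_, ?_⟩
      · rw [hz2]; exact hz.1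
      · rw [hz2]; exact hz.2
      · rwa [LinearIsometryEquiv.symm_apply_apply]
    · right
      rw [not_le, PiLp.sub_apply, abs_lt] at hzi
      intro j
      rcases eq_or_ne j i with rfl | hj
      · simp only [Function.update_self]
        constructor <;> linarith
      · simp only [Function.update_of_ne hj]
        have := hz.1
        rw [mem_cube_iff, inv_map] at this
        exact this j
  have h7 := h1.trans ((measure_mono hcov).trans (measure_union_le _ _))
  rw [hvol, hB] at h7
  have h8 : ENNReal.ofReal ε = ENNReal.ofReal (ε / 2) + ENNReal.ofReal (ε / 2) := by
    rw [← ENNReal.ofReal_add (by positivity) (by positivity)]; ring_nf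
  rw [h8] at h7
  exact (ENNReal.add_le_add_iff_right ENNReal.ofReal_ne_top).1 h7

end CubeFrame

theorem sum_lintegral_le {α ι : Type*} [MeasurableSpace α] (μ : Measure α) (s : Finset ι)
    (f : ι → α → ℝ≥0∞) : ∑ i ∈ s, ∫⁻ a, f i a ∂μ ≤ ∫⁻ a, ∑ i ∈ s, f i a ∂μ := by
  classical
  induction s using Finset.induction_on with
  | empty => simp
  | insert i s hi ih =>
    simp only [Finset.sum_insert hi]
    exact (add_le_add le_rfl ih).trans (le_lintegral_add _ _)

theorem exists_disjoint_family {α κ : Type*} [Fintype κ] [MeasurableSpace α] {A : κ → Set α}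
    (hA : ∀ k, MeasurableSet (A k)) :
    ∃ B : κ → Set α, (∀ k, MeasurableSet (B k)) ∧ (∀ k, B k ⊆ A k) ∧ (⋃ k, A k) ⊆ (⋃ k, B k) ∧
      Pairwise (Function.onFun Disjoint B) := by
  classical
  set e := Fintype.equivFin κ
  refine ⟨fun k => A k \ ⋃ j ∈ {j | e j < e k}, A j, fun k => ?_, fun k => sdiff_subset, ?_, ?_⟩
  · exact (hA k).diff (.biUnion (Set.toFinite _).countable fun j _ => hA j)
  · intro x hx
    rw [mem_iUnion] at hx
    obtain ⟨k, hk, hmin⟩ := (Set.toFinite {k | x ∈ A k}).exists_minimalFor e _ hx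
    refine mem_iUnion.2 ⟨k, hk, fun h => ?_⟩
    rw [mem_iUnion₂] at h
    obtain ⟨j, hj, hxj⟩ := h
    have hj' : e j < e k := hj
    exact not_lt.2 (hmin hxj hj'.le) hj'
  · intro j k hjk
    refine Set.disjoint_left.2 fun x hx hx' => ?_
    rcases lt_or_gt_of_ne (fun h => hjk (e.injective h)) with h | h
    · exact hx'.2 (mem_iUnion₂.2 ⟨j, h, hx.1⟩)
    · exact hx.2 (mem_iUnion₂.2 ⟨k, h, hx'.1⟩)

namespace CubeFrame

variable {n : ℕ} (F : CubeFrame (n + 1))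

/-- The part of a closed cube lying in the plane `{u_i = s}`. -/
def side (i : Fin (n + 1)) (s : ℝ) : Set (Euc (n + 1)) :=
  {x | (∀ j, F.inv x j ∈ Icc (0 : ℝ) 1) ∧ F.inv x i = s}

/-- The points of `A` from which the direction `-w` leads to an interior point of `E`
inside the cube. -/
def dirSet (E : Set (Euc (n + 1))) (c : ℝ) (i : Fin (n + 1)) (A : Set (Euc (n + 1)))
    (w : Euc (n + 1)) : Set (Euc (n + 1)) :=
  {x | x ∈ A ∧ x - F.l • w ∈ F.cube ∧ x - F.l • w ∉ mClosure (n + 1) Eᶜ ∧ c ≤ |F.r.symm w i|}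

/-- The union of the open segments of direction `-w` starting in a set. -/
def sweep (A : Set (Euc (n + 1))) (w : Euc (n + 1)) : Set (Euc (n + 1)) :=
  {y | ∃ t ∈ Ioo 0 F.l, y + t • w ∈ A}

theorem inv_sub_l_smul (x w : Euc (n + 1)) :
    F.inv (x - F.l • w) = F.inv x - F.r.symm w := by
  have := F.inv_add_smul x w (-F.l)
  rw [neg_div, div_self F.hl.ne'] at this
  rw [sub_eq_add_neg, ← neg_smul, this]
  module

theorem abs_dir_le {E A : Set (Euc (n + 1))} {c s : ℝ} {i : Fin (n + 1)} {w x : Euc (n + 1)}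
    (hA : A ⊆ F.side i s) (hx : x ∈ F.dirSet E c i A w) (j : Fin (n + 1)) :
    |F.r.symm w j| ≤ 1 := by
  have h1 := (hA hx.1).1 j
  have h2 := (F.mem_cube_iff.1 hx.2.1) j
  rw [inv_sub_l_smul, PiLp.sub_apply] at h2
  rw [abs_le]
  constructor <;> linarith [h1.1, h1.2, h2.1, h2.2]

theorem norm_dir_le {E A : Set (Euc (n + 1))} {c s : ℝ} {i : Fin (n + 1)} {w x : Euc (n + 1)}
    (hA : A ⊆ F.side i s) (hx : x ∈ F.dirSet E c i A w) : ‖w‖ ≤ (n + 1 : ℕ) := by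
  rw [← F.r.symm.norm_map w]
  simpa using norm_le_of_coord zero_le_one (F.abs_dir_le hA hx)

theorem sweep_subset_cube {E A : Set (Euc (n + 1))} {c s : ℝ} {i : Fin (n + 1)} {w : Euc (n + 1)}
    (hA : A ⊆ F.side i s) : F.sweep (F.dirSet E c i A w) w ⊆ F.cube := by
  rintro y ⟨t, ht, hx⟩
  rw [mem_cube_iff]
  intro j
  have h1 := (hA hx.1).1 j
  have h2 := (F.mem_cube_iff.1 hx.2.1) j
  rw [inv_sub_l_smul, inv_add_smul, PiLp.sub_apply] at h2
  rw [inv_add_smul] at h1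
  simp only [PiLp.add_apply, PiLp.smul_apply, smul_eq_mul] at h1 h2
  have h3 : 0 < t / F.l := div_pos ht.1 F.hl
  have h4 : t / F.l < 1 := by rw [div_lt_one F.hl]; exact ht.2
  generalize t / F.l = θ at *
  constructor <;> nlinarith [h1.1, h1.2, h2.1, h2.2]

theorem measurableSet_dirSet {E A : Set (Euc (n + 1))} (c : ℝ) (i : Fin (n + 1))
    (w : Euc (n + 1)) (hA : MeasurableSet A) : MeasurableSet (F.dirSet E c i A w) := by
  have hc : Continuous fun x : Euc (n + 1) => x - F.l • w := by fun_prop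
  have h : MeasurableSet {x : Euc (n + 1) | c ≤ |F.r.symm w i|} := MeasurableSet.const _
  exact hA.inter ((F.isOpen_cube.preimage hc).measurableSet.inter
    (((measurableSet_mClosure _ Eᶜ).compl.preimage hc.measurable).inter h))

theorem measurableSet_sweep {E A : Set (Euc (n + 1))} {c s : ℝ} (hc : 0 < c) {i : Fin (n + 1)}
    (w : Euc (n + 1)) (hA : MeasurableSet A) (hAs : A ⊆ F.side i s) :
    MeasurableSet (F.sweep (F.dirSet E c i A w) w) := by
  by_cases hw : c ≤ |F.r.symm w i|
  · have hw0 : F.r.symm w i ≠ 0 := by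
      intro h
      rw [h, abs_zero] at hw
      linarith
    set τ : Euc (n + 1) → ℝ := fun y => F.l * ((s - F.inv y i) / F.r.symm w i) with hτ
    have hτc : Continuous τ := by
      have := F.continuous_inv
      fun_prop
    have hγ : Continuous fun y => y + τ y • w := by fun_prop
    have : F.sweep (F.dirSet E c i A w) w =
        τ ⁻¹' Ioo 0 F.l ∩ (fun y => y + τ y • w) ⁻¹' F.dirSet E c i A w := by
      ext y
      constructor
      · rintro ⟨t, ht, hx⟩
        have h1 := (hAs hx.1).2
        rw [inv_add_smul, PiLp.add_apply, PiLp.smul_apply, smul_eq_mul] at h1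
        have h2 : τ y = t := by
          have := F.hl.ne'
          simp only [hτ, ← h1]
          field_simp
          ring
        rw [mem_inter_iff, mem_preimage, mem_preimage, h2]
        exact ⟨ht, hx⟩
      · rintro ⟨h1, h2⟩
        exact ⟨τ y, h1, h2⟩
    rw [this]
    exact (measurableSet_Ioo.preimage hτc.measurable).inter
      ((F.measurableSet_dirSet c i w hA).preimage hγ.measurable)
  · have : F.sweep (F.dirSet E c i A w) w = ∅ := by
      refine eq_empty_of_forall_notMem ?_
      rintro y ⟨t, ht, hx⟩
      exact hw hx.2.2.2
    rw [this]
    exact .empty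

theorem hausdorff_side_le {E A : Set (Euc (n + 1))} (hE : MeasurableSet E) {ε : ℝ} (hε : 0 < ε)
    (hd : ENNReal.ofReal ε * volume F.cube ≤ volume (E ∩ F.cube)) {i : Fin (n + 1)} {s : ℝ}
    (hA : MeasurableSet A) (hAs : A ⊆ F.side i s) :
    μH[n] A * ENNReal.ofReal (ε / 2) ≤ (F.l.toNNReal * (n + 1 : ℕ) : ℝ≥0) ^ n *
      ∫⁻ w in closedBall (0 : Euc (n + 1)) (n + 1 : ℕ),
        volume {q | F.face i s q ∈ F.dirSet E (ε / 4) i A w} := by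
  set B := F.face i s ⁻¹' A
  have hBm : MeasurableSet B := hA.preimage (F.continuous_face i s).measurable
  have hAB : A ⊆ F.face i s '' B := by
    intro x hx
    have e : F.face i s (fun j => F.inv x (i.succAbove j)) = x := by
      rw [face]
      conv_rhs => rw [← F.map_inv x]
      congr 1
      ext j
      refine Fin.succAboveCases i ?_ (fun k => ?_) j
      · rw [shear_apply_same, (hAs hx).2]
      · simp [shear_apply_succAbove]
    exact ⟨_, by simpa [B, e] using hx, e⟩
  have h1 : μH[n] A ≤ (F.l.toNNReal * (n + 1 : ℕ) : ℝ≥0) ^ n * volume B := by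
    have h3 := (F.lipschitzWith_face i s).hausdorffMeasure_image_le (d := (n : ℝ)) n.cast_nonneg B
    have h4 : (μH[(n : ℝ)] : Measure (Fin n → ℝ)) = volume := by
      rw [← hausdorffMeasure_pi_real, Fintype.card_fin]
    rw [h4, ENNReal.rpow_natCast] at h3
    exact (measure_mono hAB).trans h3
  set T : Set ((Fin n → ℝ) × Euc (n + 1)) :=
    {p | F.face i s p.1 ∈ F.dirSet E (ε / 4) i A p.2} with hT
  have hTm : MeasurableSet T := by
    have hf : Continuous fun p : (Fin n → ℝ) × Euc (n + 1) => F.face i s p.1 :=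
      (F.continuous_face i s).comp continuous_fst
    have hc : Continuous fun p : (Fin n → ℝ) × Euc (n + 1) => F.face i s p.1 - F.l • p.2 := by
      fun_prop
    have hc' : Continuous fun p : (Fin n → ℝ) × Euc (n + 1) => |F.r.symm p.2 i| := by fun_prop
    exact (hA.preimage hf.measurable).inter ((F.isOpen_cube.preimage hc).measurableSet.inter
      (((measurableSet_mClosure _ Eᶜ).compl.preimage hc.measurable).inter
      (measurableSet_le measurable_const hc'.measurable)))
  have h2 : volume B * ENNReal.ofReal (ε / 2) ≤ ∫⁻ q, volume (Prod.mk q ⁻¹' T) := by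
    rw [mul_comm, ← lintegral_indicator_const hBm]
    refine lintegral_mono fun q => ?_
    by_cases hq : q ∈ B
    · rw [indicator_of_mem hq]
      refine (F.le_volume_directions hE hε hd (i := i) (F.face i s q)).trans (measure_mono ?_)
      exact fun w hw => ⟨hq, hw⟩
    · simp [hq]
  have h3 : ∫⁻ q, volume (Prod.mk q ⁻¹' T) =
      ∫⁻ w, volume {q | F.face i s q ∈ F.dirSet E (ε / 4) i A w} := by
    rw [← Measure.prod_apply hTm, Measure.prod_apply_symm hTm]
    rfl
  have h4 : ∫⁻ w, volume {q | F.face i s q ∈ F.dirSet E (ε / 4) i A w} =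
      ∫⁻ w in closedBall (0 : Euc (n + 1)) (n + 1 : ℕ),
        volume {q | F.face i s q ∈ F.dirSet E (ε / 4) i A w} := by
    rw [← lintegral_indicator isClosed_closedBall.measurableSet]
    congr 1
    ext w
    by_cases hw : w ∈ closedBall (0 : Euc (n + 1)) (n + 1 : ℕ)
    · rw [indicator_of_mem hw]
    · rw [indicator_of_notMem hw]
      have : {q | F.face i s q ∈ F.dirSet E (ε / 4) i A w} = ∅ := by
        refine eq_empty_of_forall_notMem fun q hq => hw ?_
        rw [mem_closedBall_zero_iff]
        exact F.norm_dir_le hAs hq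
      rw [this, measure_empty]
  calc μH[n] A * ENNReal.ofReal (ε / 2)
      ≤ (F.l.toNNReal * (n + 1 : ℕ) : ℝ≥0) ^ n * volume B * ENNReal.ofReal (ε / 2) := by gcongr
    _ = (F.l.toNNReal * (n + 1 : ℕ) : ℝ≥0) ^ n * (volume B * ENNReal.ofReal (ε / 2)) := by ring
    _ ≤ _ := by
        gcongr
        exact h2.trans (h3.trans h4).le

theorem volume_dirSet_le {E A : Set (Euc (n + 1))} (hE : MeasurableSet E) {ε : ℝ} (hε : 0 < ε)
    {i : Fin (n + 1)} {s : ℝ} (hAs : A ⊆ F.side i s) (hAE : ∀ x ∈ A, x ∉ mClosure (n + 1) E)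
    (w : Euc (n + 1)) :
    volume {q | F.face i s q ∈ F.dirSet E (ε / 4) i A w} ≤
      ((1 + (4 / ε).toNNReal) * F.l.toNNReal⁻¹ : ℝ≥0) ^ n *
      μH[n] (mBoundary (n + 1) E ∩ F.sweep (F.dirSet E (ε / 4) i A w) w) := by
  rcases (F.dirSet E (ε / 4) i A w).eq_empty_or_nonempty with h | ⟨x, hx⟩
  · simp [h]
  have h1 := hx.2.2.2
  refine F.volume_face_le hE (fun h => ?_) (fun j => ?_) (fun x hx => hAE x hx.1)
    fun x hx => hx.2.2.1
  · rw [h, abs_zero] at h1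
    linarith
  · refine (F.abs_dir_le hAs hx j).trans ?_
    rw [Real.coe_toNNReal _ (by positivity)]
    calc (1 : ℝ) = 4 / ε * (ε / 4) := by field_simp
      _ ≤ _ := by gcongr

theorem hausdorff_side_le_sweep {E A : Set (Euc (n + 1))} (hE : MeasurableSet E) {ε : ℝ}
    (hε : 0 < ε) (hd : ENNReal.ofReal ε * volume F.cube ≤ volume (E ∩ F.cube)) {i : Fin (n + 1)}
    {s : ℝ} (hA : MeasurableSet A) (hAs : A ⊆ F.side i s)
    (hAE : ∀ x ∈ A, x ∉ mClosure (n + 1) E) :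
    μH[n] A * ENNReal.ofReal (ε / 2) ≤ ((n + 1 : ℕ) * (1 + (4 / ε).toNNReal) : ℝ≥0) ^ n *
      ∫⁻ w in closedBall (0 : Euc (n + 1)) (n + 1 : ℕ),
        μH[n] (mBoundary (n + 1) E ∩ F.sweep (F.dirSet E (ε / 4) i A w) w) := by
  refine (F.hausdorff_side_le hE hε hd hA hAs).trans ?_
  have hl : F.l.toNNReal ≠ 0 := by simpa using F.hl
  calc _ ≤ (F.l.toNNReal * (n + 1 : ℕ) : ℝ≥0) ^ n *
        ∫⁻ w in closedBall (0 : Euc (n + 1)) (n + 1 : ℕ),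
        ((1 + (4 / ε).toNNReal) * F.l.toNNReal⁻¹ : ℝ≥0) ^ n *
        μH[n] (mBoundary (n + 1) E ∩ F.sweep (F.dirSet E (ε / 4) i A w) w) := by
        gcongr with w
        exact F.volume_dirSet_le hE hε hAs hAE w
    _ = _ := by
        rw [lintegral_const_mul' _ _ (by finiteness), ← mul_assoc]
        congr 1
        norm_cast
        rw [← mul_pow]
        congr 1
        field_simp

end CubeFrame

/-- The boundary of a finite union of cubes in each of which `E` has density bounded below is
controlled, away from the closure of `E`, by the boundary of `E` in the union. -/
theorem hausdorff_frontier_le (n : ℕ) {ε : ℝ} (hε : 0 < ε) :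
    ∃ C : ℝ≥0∞, C ≠ ⊤ ∧ ∀ (ι : Type) [Fintype ι] (F : ι → CubeFrame (n + 1))
      (E : Set (Euc (n + 1))), MeasurableSet E →
      (∀ a, ENNReal.ofReal ε * volume (F a).cube ≤ volume (E ∩ (F a).cube)) →
      μH[n] (frontier (⋃ a, (F a).cube) \ mClosure (n + 1) E) ≤
        C * μH[n] (mBoundary (n + 1) E ∩ ⋃ a, (F a).cube) := by
  set c : ℝ≥0∞ := ((n + 1 : ℕ) * (1 + (4 / ε).toNNReal) : ℝ≥0) ^ n with hc
  set W := closedBall (0 : Euc (n + 1)) (n + 1 : ℕ) with hW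
  have hε0 : ENNReal.ofReal (ε / 2) ≠ 0 := by simpa using hε
  have hWfin : volume W ≠ ⊤ := measure_closedBall_lt_top.ne
  refine ⟨c * volume W / ENNReal.ofReal (ε / 2), ?_, fun ι _ F E hE hd => ?_⟩
  · exact ENNReal.div_ne_top (by finiteness) hε0
  set V := ⋃ a, (F a).cube with hV
  have hVo : IsOpen V := isOpen_iUnion fun a => (F a).isOpen_cube
  set s : Bool → ℝ := fun b => bif b then 1 else 0 with hs
  set A' : ι × Fin (n + 1) × Bool → Set (Euc (n + 1)) := fun k =>
    ((F k.1).side k.2.1 (s k.2.2) ∩ Vᶜ) \ mClosure (n + 1) E with hA'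
  have hA'm : ∀ k, MeasurableSet (A' k) := by
    intro k
    refine MeasurableSet.diff (MeasurableSet.inter ?_ hVo.measurableSet.compl)
      (measurableSet_mClosure _ _)
    have h1 (j : Fin (n + 1)) : Continuous fun x => (F k.1).inv x j := by
      have := (F k.1).continuous_inv
      fun_prop
    have h2 : (F k.1).side k.2.1 (s k.2.2) = (⋂ j, (fun x => (F k.1).inv x j) ⁻¹' Icc 0 1) ∩
        (fun x => (F k.1).inv x k.2.1) ⁻¹' {s k.2.2} := by
      ext x
      simp [CubeFrame.side]
    rw [h2]
    exact ((isClosed_iInter fun j => isClosed_Icc.preimage (h1 j)).inter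
      (isClosed_singleton.preimage (h1 _))).measurableSet
  have hcov : frontier V \ mClosure (n + 1) E ⊆ ⋃ k, A' k := by
    rintro x ⟨hx, hxE⟩
    have hxV : x ∉ V := by
      rw [hVo.frontier_eq] at hx
      exact hx.2
    have hxc : x ∈ ⋃ a, closure (F a).cube := by
      rw [← closure_iUnion_of_finite]
      exact hx.1
    obtain ⟨a, ha⟩ := mem_iUnion.1 hxc
    have hI := (F a).inv_mem_Icc_of_mem_closure ha
    have hxa : x ∉ (F a).cube := fun h => hxV (mem_iUnion.2 ⟨a, h⟩)
    rw [CubeFrame.mem_cube_iff] at hxa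
    simp only [ucube, mem_ofPred_eq, not_forall] at hxa
    obtain ⟨i, hi⟩ := hxa
    have : (F a).inv x i = 0 ∨ (F a).inv x i = 1 := by
      by_contra! h
      exact hi ⟨(hI i).1.lt_of_ne h.1.symm, (hI i).2.lt_of_ne h.2⟩
    rcases this with h | h
    · exact mem_iUnion.2 ⟨(a, i, false), ⟨⟨hI, h⟩, hxV⟩, hxE⟩
    · exact mem_iUnion.2 ⟨(a, i, true), ⟨⟨hI, h⟩, hxV⟩, hxE⟩
  obtain ⟨A, hAm, hAA, hAcov, hdisj⟩ := exists_disjoint_family hA'm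
  have hAs (k) : A k ⊆ (F k.1).side k.2.1 (s k.2.2) := fun x hx => (hAA k hx).1.1
  have hAV (k) (x) (hx : x ∈ A k) : x ∉ V := (hAA k hx).1.2
  have hAE (k) (x) (hx : x ∈ A k) : x ∉ mClosure (n + 1) E := (hAA k hx).2
  set D : ι × Fin (n + 1) × Bool → Euc (n + 1) → Set (Euc (n + 1)) := fun k w =>
    (F k.1).sweep ((F k.1).dirSet E (ε / 4) k.2.1 (A k) w) w with hD
  have hDcube (k w) : D k w ⊆ V := ((F k.1).sweep_subset_cube (hAs k)).trans
    (subset_iUnion (fun a => (F a).cube) k.1)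
  have hDm (k w) : MeasurableSet (D k w) :=
    (F k.1).measurableSet_sweep (by positivity) w (hAm k) (hAs k)
  have hDstep (k k' w) (y : Euc (n + 1)) (t t' : ℝ) (ht : 0 < t) (htt : t < t')
      (h : y + t • w ∈ A k) (ht' : t' < (F k'.1).l)
      (h' : y + t' • w ∈ (F k'.1).dirSet E (ε / 4) k'.2.1 (A k') w) : False := by
    refine hAV k _ h (hDcube k' w ⟨t' - t, ⟨by linarith, by linarith⟩, ?_⟩)
    have e : y + t • w + (t' - t) • w = y + t' • w := by module
    rwa [e]
  have hDdisj (w) : Pairwise (Function.onFun Disjoint fun k => mBoundary (n + 1) E ∩ D k w) := by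
    intro k k' hkk
    refine Set.disjoint_left.2 ?_
    rintro y ⟨-, t, ht, hx⟩ ⟨-, t', ht', hx'⟩
    rcases lt_trichotomy t t' with h | rfl | h
    · exact hDstep k k' w y t t' ht.1 h hx.1 ht'.2 hx'
    · exact Set.disjoint_left.1 (hdisj hkk) hx.1 hx'.1
    · exact hDstep k' k w y t' t ht'.1 h hx'.1 ht.2 hx
  have hsum (w) : ∑ k, μH[n] (mBoundary (n + 1) E ∩ D k w) ≤ μH[n] (mBoundary (n + 1) E ∩ V) := by
    rw [← measure_biUnion_finset (fun k _ k' _ h => hDdisj w h)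
      (fun k _ => (measurableSet_mBoundary _ _).inter (hDm k w))]
    exact measure_mono (iUnion₂_subset fun k _ => inter_subset_inter_right _ (hDcube k w))
  have hmain : μH[n] (frontier V \ mClosure (n + 1) E) * ENNReal.ofReal (ε / 2) ≤
      c * volume W * μH[n] (mBoundary (n + 1) E ∩ V) := by
    calc _ ≤ (∑ k, μH[n] (A k)) * ENNReal.ofReal (ε / 2) := by
          gcongr
          exact (measure_mono (hcov.trans hAcov)).trans (measure_iUnion_fintype_le _ _)
      _ = ∑ k, μH[n] (A k) * ENNReal.ofReal (ε / 2) := Finset.sum_mul _ _ _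
      _ ≤ ∑ k, c * ∫⁻ w in W, μH[n] (mBoundary (n + 1) E ∩ D k w) :=
          Finset.sum_le_sum fun k _ =>
            (F k.1).hausdorff_side_le_sweep hE hε (hd k.1) (hAm k) (hAs k) (hAE k)
      _ = c * ∑ k, ∫⁻ w in W, μH[n] (mBoundary (n + 1) E ∩ D k w) := by rw [Finset.mul_sum]
      _ ≤ c * ∫⁻ _w in W, μH[n] (mBoundary (n + 1) E ∩ V) := by
          gcongr
          exact (sum_lintegral_le _ _ _).trans (lintegral_mono fun w => hsum w)
      _ = _ := by rw [setLIntegral_const]; ring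
  rw [← ENNReal.le_div_iff_mul_le (Or.inl hε0) (Or.inl ENNReal.ofReal_ne_top)] at hmain
  refine hmain.trans_eq ?_
  simp only [div_eq_mul_inv]
  ac_rfl

theorem lintegral_volume_translate {d : ℕ} {A B : Set (Euc d)} (hA : MeasurableSet A)
    (hB : MeasurableSet B) :
    ∫⁻ w, volume {x : Euc d | x ∈ A ∧ x + w ∈ B} = volume A * volume B := by
  have h1 (w : Euc d) : volume {x : Euc d | x ∈ A ∧ x + w ∈ B} =
      ∫⁻ x, A.indicator 1 x * B.indicator 1 (x + w) := by
    have : MeasurableSet {x : Euc d | x ∈ A ∧ x + w ∈ B} :=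
      hA.inter (hB.preimage (measurable_add_const w))
    rw [← lintegral_indicator_one this]
    refine lintegral_congr fun x => ?_
    by_cases h : x ∈ A <;> by_cases h' : x + w ∈ B <;> simp [h, h']
  simp_rw [h1]
  rw [lintegral_lintegral_swap]
  · have h2 (x : Euc d) : ∫⁻ w, A.indicator (1 : Euc d → ℝ≥0∞) x * B.indicator 1 (x + w) =
        A.indicator (1 : Euc d → ℝ≥0∞) x * volume B := by
      rw [lintegral_const_mul (f := fun w => B.indicator (1 : Euc d → ℝ≥0∞) (x + w)) _
          ((measurable_one.indicator hB).comp (measurable_const_add x)),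
        lintegral_add_left_eq_self (fun w => B.indicator (1 : Euc d → ℝ≥0∞) w) x,
        lintegral_indicator_one hB]
    simp_rw [h2]
    rw [lintegral_mul_const _ (measurable_one.indicator hA), lintegral_indicator_one hA]
  · refine Measurable.aemeasurable ?_
    exact ((measurable_one.indicator hA).comp measurable_snd).mul
      ((measurable_one.indicator hB).comp (measurable_snd.add measurable_fst))

namespace CubeFrame

theorem add_smul_mem_cube {d : ℕ} (F : CubeFrame d) {x w : Euc d} (hx : x ∈ F.cube)
    (hxw : x + w ∈ F.cube) {t : ℝ} (ht : t ∈ Ioo (0 : ℝ) 1) : x + t • w ∈ F.cube := by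
  rw [mem_cube_iff] at *
  intro i
  have h1 := hx i
  have h2 := hxw i
  rw [← one_smul ℝ w, inv_add_smul, PiLp.add_apply, PiLp.smul_apply, smul_eq_mul] at h2
  rw [inv_add_smul, PiLp.add_apply, PiLp.smul_apply, smul_eq_mul]
  set b := F.r.symm w i
  have e : F.inv x i + t / F.l * b = (1 - t) * F.inv x i + t * (F.inv x i + 1 / F.l * b) := by ring
  rw [e]
  obtain ⟨h0, h1'⟩ := ht
  have := mul_pos (sub_pos.2 h1') h1.1
  have := mul_pos h0 h2.1
  have := mul_pos (sub_pos.2 h1') (sub_pos.2 h1.2)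
  have := mul_pos h0 (sub_pos.2 h2.2)
  constructor <;> linarith

theorem norm_le_of_mem_ucube {d : ℕ} {x : Euc d} (hx : x ∈ ucube d) : ‖x‖ ≤ d := by
  have := norm_le_of_coord zero_le_one fun i => abs_le.2 ⟨by linarith [(hx i).1], (hx i).2.le⟩
  simpa using this

theorem norm_sub_v_le {d : ℕ} (F : CubeFrame d) {x : Euc d} (hx : x ∈ F.cube) :
    ‖x - F.v‖ ≤ d * F.l := by
  obtain ⟨u, hu, rfl⟩ := hx
  have e : F.map u - F.v = F.l • F.r u := by simp [map]
  rw [e, norm_smul, LinearIsometryEquiv.norm_map, Real.norm_of_nonneg F.hl.le, mul_comm]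
  exact mul_le_mul_of_nonneg_right (norm_le_of_mem_ucube hu) F.hl.le

theorem dist_le_of_mem_cube {d : ℕ} (F : CubeFrame d) {x y : Euc d} (hx : x ∈ F.cube)
    (hy : y ∈ F.cube) : dist x y ≤ d * F.l := by
  obtain ⟨u, hu, rfl⟩ := hx
  obtain ⟨u', hu', rfl⟩ := hy
  rw [dist_map, mul_comm, dist_eq_norm]
  refine mul_le_mul_of_nonneg_right ?_ F.hl.le
  have := norm_le_of_coord (x := u - u') zero_le_one fun i => abs_le.2
    ⟨by have := hu i; have := hu' i; simp at *; linarith,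
      by have := hu i; have := hu' i; simp at *; linarith⟩
  simpa using this

variable {n : ℕ} (F : CubeFrame (n + 1))

theorem volume_translate_le {E : Set (Euc (n + 1))} (hE : MeasurableSet E) (w : Euc (n + 1)) :
    volume {x | x ∈ F.cube \ E ∧ x + w ∈ E ∩ F.cube} ≤
      ENNReal.ofReal (2 * (n + 1 : ℕ) * F.l) *
        (2 ^ n * μH[n] (mBoundary (n + 1) E ∩ F.cube)) := by
  rcases eq_or_ne w 0 with rfl | hw
  · have : {x | x ∈ F.cube \ E ∧ x + 0 ∈ E ∩ F.cube} = ∅ := by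
      ext x
      simp only [add_zero, mem_ofPred_eq, mem_empty_iff_false, iff_false]
      exact fun h => h.1.2 h.2.1
    rw [this, measure_empty]
    exact zero_le
  obtain ⟨i, -, hi⟩ := Finset.exists_max_image Finset.univ (fun i => |w i|) Finset.univ_nonempty
  have hwi : w i ≠ 0 := by
    intro h
    refine hw ?_
    ext j
    have := hi j (Finset.mem_univ j)
    rw [h, abs_zero] at this
    simpa using this
  set B := mBoundary (n + 1) E ∩ F.cube
  set G := toMeasurable volume (projAlong i w '' B)
  have hG : volume G ≤ 2 ^ n * μH[n] B := by
    rw [measure_toMeasurable]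
    have h2 := lipschitzWith_projAlong (i := i) (w := w) (K := 1) fun j => by
      simpa using hi _ (Finset.mem_univ _)
    have h3 := h2.hausdorffMeasure_image_le (d := (n : ℝ)) n.cast_nonneg B
    have h4 : (μH[(n : ℝ)] : Measure (Fin n → ℝ)) = volume := by
      rw [← hausdorffMeasure_pi_real, Fintype.card_fin]
    rw [h4, ENNReal.rpow_natCast] at h3
    refine h3.trans_eq ?_
    norm_num
  set I := Icc (F.v i - (n + 1 : ℕ) * F.l) (F.v i + (n + 1 : ℕ) * F.l)
  have hI : volume I = ENNReal.ofReal (2 * (n + 1 : ℕ) * F.l) := by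
    rw [Real.volume_Icc]
    congr 1
    ring
  set Z := (fun x => x + w) ⁻¹' (E ∩ mClosure (n + 1) Eᶜ)
  have hZ : volume Z = 0 := by
    rw [measure_preimage_add_right, volume_inter_mClosure_compl hE]
  have hsub : {x | x ∈ F.cube \ E ∧ x + w ∈ E ∩ F.cube} ⊆
      {y | y i ∈ I ∧ projAlong i w y ∈ G} ∪ (exc E w ∪ (Eᶜ ∩ mClosure (n + 1) E ∪ Z)) := by
    rintro x ⟨⟨hxF, hxE⟩, hwE, hwF⟩
    by_cases h1 : x ∈ exc E w
    · exact Or.inr (Or.inl h1)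
    by_cases h2 : x ∈ mClosure (n + 1) E
    · exact Or.inr (Or.inr (Or.inl ⟨hxE, h2⟩))
    by_cases h3 : x + w ∈ mClosure (n + 1) Eᶜ
    · exact Or.inr (Or.inr (Or.inr ⟨hwE, h3⟩))
    left
    obtain ⟨t, ht, h⟩ := exists_mem_mBoundary one_pos hw h1 h2 (by simpa using h3)
    refine ⟨?_, subset_toMeasurable _ _ ⟨x + t • w, ⟨h, F.add_smul_mem_cube hxF hwF ht⟩,
      projAlong_add_smul hwi _ _⟩⟩
    have := abs_le.1 ((abs_coord_le_norm (x - F.v) i).trans (F.norm_sub_v_le hxF))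
    rw [PiLp.sub_apply] at this
    constructor <;> linarith
  refine (measure_mono hsub).trans ((measure_union_le _ _).trans ?_)
  have hnull : volume (exc E w ∪ (Eᶜ ∩ mClosure (n + 1) E ∪ Z)) = 0 := by
    rw [measure_union_null_iff, measure_union_null_iff]
    exact ⟨volume_exc hE hw, volume_compl_inter_mClosure hE, hZ⟩
  rw [hnull, add_zero, volume_projAlong_preimage i w measurableSet_Icc
    (measurableSet_toMeasurable _ _), hI]
  gcongr

end CubeFrame

/-- The relative isoperimetric inequality in a cube. -/
theorem relative_isoperimetric (n : ℕ) {κ : ℝ} (hκ : 0 < κ) :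
    ∃ C : ℝ≥0∞, C ≠ ⊤ ∧ ∀ (F : CubeFrame (n + 1)) (E : Set (Euc (n + 1))), MeasurableSet E →
      ENNReal.ofReal κ * volume F.cube ≤ volume (E ∩ F.cube) →
      ENNReal.ofReal κ * volume F.cube ≤ volume (F.cube \ E) →
      ENNReal.ofReal (F.l ^ n) ≤ C * μH[n] (mBoundary (n + 1) E ∩ F.cube) := by
  set d := n + 1 with hd
  set b := volume (closedBall (0 : Euc d) 1)
  set A : ℝ≥0∞ := ENNReal.ofReal κ * ENNReal.ofReal κ with hA
  have hA0 : A ≠ 0 := by simp [A, hκ]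
  refine ⟨ENNReal.ofReal (2 * d * d ^ d) * 2 ^ n * b / A, ?_, fun F E hE h1 h2 => ?_⟩
  · exact ENNReal.div_ne_top (by have := (measure_closedBall_lt_top : b < ⊤); finiteness) hA0
  set H := μH[n] (mBoundary d E ∩ F.cube)
  have h3 := lintegral_volume_translate (F.isOpen_cube.measurableSet.diff hE)
    (hE.inter F.isOpen_cube.measurableSet)
  have h4 : ∫⁻ w, volume {x : Euc d | x ∈ F.cube \ E ∧ x + w ∈ E ∩ F.cube} ≤
      ENNReal.ofReal (2 * d * F.l) * (2 ^ n * H) * (ENNReal.ofReal ((d * F.l) ^ d) * b) := by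
    calc _ ≤ ∫⁻ w, (closedBall (0 : Euc d) (d * F.l)).indicator
          (fun _ => ENNReal.ofReal (2 * d * F.l) * (2 ^ n * H)) w := by
          refine lintegral_mono fun w => ?_
          by_cases hw : w ∈ closedBall (0 : Euc d) (d * F.l)
          · rw [indicator_of_mem hw]
            exact F.volume_translate_le hE w
          · rw [indicator_of_notMem hw]
            have : {x : Euc d | x ∈ F.cube \ E ∧ x + w ∈ E ∩ F.cube} = ∅ := by
              refine eq_empty_of_forall_notMem fun x hx => hw ?_
              have := F.dist_le_of_mem_cube hx.2.2 hx.1.1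
              rw [dist_eq_norm, add_sub_cancel_left] at this
              simpa using this
            rw [this, measure_empty]
      _ = _ := by
          rw [lintegral_indicator_const measurableSet_closedBall,
            Measure.addHaar_closedBall volume (0 : Euc d) (mul_nonneg d.cast_nonneg F.hl.le),
            finrank_euclideanSpace_fin]
          congr 2
          rw [← Measure.addHaar_unitClosedBall_eq_addHaar_unitBall]
  rw [h3] at h4
  have h5 := (mul_le_mul' h2 h1).trans h4
  rw [F.volume_cube] at h5
  have hl := F.hl
  have e1 : ENNReal.ofReal κ * ENNReal.ofReal (F.l ^ d) * (ENNReal.ofReal κ * ENNReal.ofReal (F.l ^ d))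
      = ENNReal.ofReal (F.l ^ (n + 2)) * (ENNReal.ofReal (F.l ^ n) * A) := by
    have : ENNReal.ofReal (F.l ^ d) * ENNReal.ofReal (F.l ^ d) =
        ENNReal.ofReal (F.l ^ (n + 2)) * ENNReal.ofReal (F.l ^ n) := by
      rw [← ENNReal.ofReal_mul (by positivity), ← ENNReal.ofReal_mul (by positivity)]
      congr 1
      simp only [d]
      ring
    calc _ = A * (ENNReal.ofReal (F.l ^ d) * ENNReal.ofReal (F.l ^ d)) := by rw [hA]; ring
      _ = _ := by rw [this]; ring
  have e2 : ENNReal.ofReal (2 * d * F.l) * (2 ^ n * H) * (ENNReal.ofReal ((d * F.l) ^ d) * b) =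
      ENNReal.ofReal (F.l ^ (n + 2)) * (ENNReal.ofReal (2 * d * d ^ d) * 2 ^ n * b * H) := by
    have : ENNReal.ofReal (2 * d * F.l) * ENNReal.ofReal ((d * F.l) ^ d) =
        ENNReal.ofReal (F.l ^ (n + 2)) * ENNReal.ofReal (2 * d * d ^ d) := by
      rw [← ENNReal.ofReal_mul (by positivity), ← ENNReal.ofReal_mul (by positivity)]
      congr 1
      have : F.l ^ (n + 2) = F.l * F.l ^ d := by simp only [d]; ring
      rw [this, mul_pow]
      ring
    calc _ = (ENNReal.ofReal (2 * d * F.l) * ENNReal.ofReal ((d * F.l) ^ d)) * (2 ^ n * H * b) := by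
          ring
      _ = _ := by rw [this]; ring
  rw [e1, e2, ENNReal.mul_le_mul_iff_right (by simpa using pow_pos hl _) ENNReal.ofReal_ne_top,
    ← ENNReal.le_div_iff_mul_le (Or.inl hA0) (Or.inl (by finiteness))] at h5
  refine h5.trans_eq ?_
  simp only [div_eq_mul_inv]
  ac_rfl

/-- The index of the parent of a dyadic cube. -/
def half {d : ℕ} (k : Fin d → ℕ) : Fin d → ℕ := fun i => k i / 2

theorem half_lt {d m : ℕ} {k : Fin d → ℕ} (hk : ∀ i, k i < 2 ^ (m + 1)) (i : Fin d) :
    half k i < 2 ^ m := by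
  have := hk i
  rw [pow_succ] at this
  unfold half
  omega

theorem volume_coord_eq (d : ℕ) (i : Fin d) (c : ℝ) : volume {u : Euc d | u i = c} = 0 := by
  have h := Measure.pi_hyperplane (fun _ : Fin d => (volume : Measure ℝ)) i c
  rw [← volume_pi] at h
  have hm : MeasurableSet {x : Fin d → ℝ | x i = c} := measurableSet_eq_fun (by fun_prop) (by fun_prop)
  rw [← (PiLp.volume_preserving_ofLp (Fin d)).measure_preimage hm.nullMeasurableSet] at h
  exact h

namespace CubeFrame

variable {d : ℕ} (F : CubeFrame d)

/-- The dyadic subcubes of a cube. -/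
def sub (m : ℕ) (k : Fin d → ℕ) : CubeFrame d where
  l := F.l / 2 ^ m
  hl := div_pos F.hl (by positivity)
  r := F.r
  v := F.map (WithLp.toLp 2 fun i => (k i : ℝ) / 2 ^ m)

theorem sub_map (m : ℕ) (k : Fin d → ℕ) (u : Euc d) :
    (F.sub m k).map u = F.map (WithLp.toLp 2 fun i => (k i + u i) / 2 ^ m) := by
  have e : WithLp.toLp 2 (fun i => (k i + u i) / 2 ^ m : Fin d → ℝ) =
      (2 ^ m : ℝ)⁻¹ • u + WithLp.toLp 2 fun i => (k i : ℝ) / 2 ^ m := by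
    ext i
    simp
    ring
  rw [e]
  simp only [map, sub, map_add, map_smul]
  module

theorem sub_inv (m : ℕ) (k : Fin d → ℕ) (y : Euc d) (i : Fin d) :
    (F.sub m k).inv y i = 2 ^ m * F.inv y i - k i := by
  have h := congrArg F.inv (F.sub_map m k ((F.sub m k).inv y))
  rw [map_inv, inv_map] at h
  rw [h]
  field_simp
  simp

theorem mem_sub_cube {m : ℕ} {k : Fin d → ℕ} {y : Euc d} :
    y ∈ (F.sub m k).cube ↔ ∀ i, (k i : ℝ) < 2 ^ m * F.inv y i ∧ 2 ^ m * F.inv y i < k i + 1 := by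
  rw [mem_cube_iff]
  refine forall_congr' fun i => ?_
  rw [sub_inv, mem_Ioo]
  constructor <;> rintro ⟨h1, h2⟩ <;> constructor <;> linarith

theorem sub_zero_cube : (F.sub 0 0).cube = F.cube := by
  ext y
  rw [mem_sub_cube, mem_cube_iff]
  refine forall_congr' fun i => ?_
  simp

theorem isDyadicOf_sub {m : ℕ} {k : Fin d → ℕ} (hk : ∀ i, k i < 2 ^ m) :
    IsDyadicOf d (F.sub m k).cube F.cube := by
  refine ⟨F.l, F.r, F.v, F.hl, rfl, m, k, hk, ?_⟩
  change _ = F.map '' _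
  ext y
  rw [mem_sub_cube, image_map_eq, mem_preimage]
  refine forall_congr' fun i => ?_
  rw [mem_Ioo, div_lt_iff₀' (by positivity), lt_div_iff₀' (by positivity)]

theorem sub_cube_subset_half (m : ℕ) (k : Fin d → ℕ) :
    (F.sub (m + 1) k).cube ⊆ (F.sub m (half k)).cube := by
  intro y hy
  rw [mem_sub_cube] at *
  intro i
  have h := hy i
  have e : (2 : ℝ) ^ (m + 1) * F.inv y i = 2 * (2 ^ m * F.inv y i) := by ring
  rw [e] at h
  have h1 : 2 * (half k i) ≤ k i := by unfold half; omega
  have h2 : k i + 1 ≤ 2 * (half k i + 1) := by unfold half; omega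
  have h1' : 2 * (half k i : ℝ) ≤ k i := by exact_mod_cast h1
  have h2' : (k i : ℝ) + 1 ≤ 2 * (half k i + 1) := by exact_mod_cast h2
  constructor <;> linarith

theorem sub_cube_subset {m : ℕ} {k : Fin d → ℕ} (hk : ∀ i, k i < 2 ^ m) :
    (F.sub m k).cube ⊆ F.cube := by
  induction m generalizing k with
  | zero =>
    have : k = 0 := by
      ext i
      simpa using hk i
    rw [this, sub_zero_cube]
  | succ m ih => exact (F.sub_cube_subset_half m k).trans (ih (half_lt hk))

theorem volume_sub_half (m : ℕ) (k : Fin d → ℕ) :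
    volume (F.sub m (half k)).cube = 2 ^ d * volume (F.sub (m + 1) k).cube := by
  rw [volume_cube, volume_cube]
  have : (2 : ℝ≥0∞) ^ d = ENNReal.ofReal (2 ^ d) := by
    rw [ENNReal.ofReal_pow zero_le_two]; norm_num
  rw [this, ← ENNReal.ofReal_mul (by positivity)]
  congr 1
  simp only [sub]
  rw [← mul_pow]
  congr 1
  field_simp
  ring

/-- The points on the boundary of some dyadic subcube. -/
def dyadicNull : Set (Euc d) := {y | ∃ (i : Fin d) (m j : ℕ), 2 ^ m * F.inv y i = j}

theorem volume_dyadicNull : volume F.dyadicNull = 0 := by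
  have : F.dyadicNull = ⋃ (i : Fin d) (m : ℕ) (j : ℕ), {y | 2 ^ m * F.inv y i = j} := by
    ext; simp [dyadicNull]
  rw [this]
  simp only [measure_iUnion_null_iff]
  intro i m j
  rw [← F.volume_preimage_map]
  refine mul_eq_zero_of_right _ (measure_mono_null ?_ (volume_coord_eq d i (j / 2 ^ m)))
  intro u hu
  simp only [mem_preimage, mem_ofPred_eq, inv_map] at hu
  rw [mem_ofPred_eq, ← hu]
  field_simp

/-- The index of the dyadic cube of generation `m` containing a point. -/
def addr (m : ℕ) (y : Euc d) : Fin d → ℕ := fun i => ⌊2 ^ m * F.inv y i⌋₊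

theorem addr_eq_of_mem {m : ℕ} {k : Fin d → ℕ} {y : Euc d} (hy : y ∈ (F.sub m k).cube) :
    F.addr m y = k := by
  rw [mem_sub_cube] at hy
  ext i
  exact (Nat.floor_eq_iff ((k i).cast_nonneg.trans (hy i).1.le)).2 ⟨(hy i).1.le, (hy i).2⟩

theorem mem_sub_addr (m : ℕ) {y : Euc d} (hy : y ∈ F.cube) (hn : y ∉ F.dyadicNull) :
    y ∈ (F.sub m (F.addr m y)).cube := by
  rw [mem_sub_cube]
  rw [mem_cube_iff] at hy
  intro i
  refine ⟨(Nat.floor_le (mul_nonneg (by positivity) (hy i).1.le)).lt_of_ne fun h => ?_,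
    Nat.lt_floor_add_one _⟩
  exact hn ⟨i, m, _, h.symm⟩

theorem half_addr (m : ℕ) (y : Euc d) : half (F.addr (m + 1) y) = F.addr m y := by
  ext i
  have h := Nat.floor_div_natCast (2 ^ (m + 1) * F.inv y i) 2
  simp only [half, addr]
  rw [← h]
  congr 1
  push_cast
  ring

theorem addr_lt (m : ℕ) {y : Euc d} (hy : y ∈ F.cube) (i : Fin d) : F.addr m y i < 2 ^ m := by
  rw [mem_cube_iff] at hy
  have h := hy i
  refine (Nat.floor_lt (mul_nonneg (by positivity) h.1.le)).2 ?_
  push_cast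
  have := mul_lt_mul_of_pos_left h.2 (by positivity : (0:ℝ) < 2 ^ m)
  linarith

theorem measurableSet_cube : MeasurableSet F.cube := F.isOpen_cube.measurableSet

theorem volume_cube_ne_top : volume F.cube ≠ ⊤ := by rw [volume_cube]; exact ENNReal.ofReal_ne_top

theorem volume_cube_ne_zero : volume F.cube ≠ 0 := by
  rw [volume_cube]; simpa using pow_pos F.hl d

/-- The index of a child of a dyadic cube. -/
def child {d : ℕ} (k : Fin d → ℕ) (e : Fin d → Bool) : Fin d → ℕ := fun i => 2 * k i + (e i).toNat

theorem half_child (k : Fin d → ℕ) (e : Fin d → Bool) : half (child k e) = k := by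
  ext i
  have := (e i).toNat_le
  simp only [half, child]
  omega

theorem child_lt {m : ℕ} {k : Fin d → ℕ} (hk : ∀ i, k i < 2 ^ m) (e : Fin d → Bool) (i : Fin d) :
    child k e i < 2 ^ (m + 1) := by
  have := hk i
  have := (e i).toNat_le
  simp only [child, pow_succ]
  omega

theorem pairwise_disjoint_child (m : ℕ) (k : Fin d → ℕ) :
    Pairwise (Function.onFun Disjoint fun e => (F.sub (m + 1) (child k e)).cube) := by
  intro e e' hne
  refine Set.disjoint_left.2 fun y hy hy' => hne ?_
  have h := (F.addr_eq_of_mem hy).symm.trans (F.addr_eq_of_mem hy')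
  ext i
  have := congrFun h i
  simp only [child] at this
  cases h1 : e i <;> cases h2 : e' i <;> simp_all

theorem iUnion_child_ae_eq {m : ℕ} {k : Fin d → ℕ} (hk : ∀ i, k i < 2 ^ m) :
    (⋃ e, (F.sub (m + 1) (child k e)).cube) =ᵐ[volume] (F.sub m k).cube := by
  have h1 : (⋃ e, (F.sub (m + 1) (child k e)).cube) ⊆ (F.sub m k).cube :=
    iUnion_subset fun e => (F.sub_cube_subset_half m _).trans (by rw [half_child])
  refine h1.eventuallyLE.antisymm ?_
  rw [ae_le_set]
  refine measure_mono_null ?_ F.volume_dyadicNull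
  rintro y ⟨hy, hy'⟩
  by_contra hn
  refine hy' (mem_iUnion.2 ⟨fun i => decide (F.addr (m + 1) y i % 2 = 1), ?_⟩)
  have h2 : child k (fun i => decide (F.addr (m + 1) y i % 2 = 1)) = F.addr (m + 1) y := by
    ext i
    have h3 := congrFun (F.half_addr m y) i
    rw [F.addr_eq_of_mem hy] at h3
    simp only [half] at h3
    simp only [child]
    rcases Nat.mod_two_eq_zero_or_one (F.addr (m + 1) y i) with h | h <;> simp [h] <;> omega
  rw [h2]
  exact F.mem_sub_addr _ (F.sub_cube_subset hk hy) hn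

end CubeFrame

theorem ofReal_integral_le_lintegral {α : Type*} [MeasurableSpace α] {μ : Measure α} {g : α → ℝ}
    (hg : Integrable g μ) : ENNReal.ofReal (∫ x, g x ∂μ) ≤ ∫⁻ x, ENNReal.ofReal (g x) ∂μ := by
  have h1 : ∫ x, g x ∂μ ≤ ∫ x, max (g x) 0 ∂μ :=
    integral_mono hg hg.pos_part fun x => le_max_left _ _
  refine (ENNReal.ofReal_le_ofReal h1).trans ?_
  rw [ofReal_integral_eq_lintegral_ofReal hg.pos_part (ae_of_all _ fun x => le_max_right _ _)]
  refine lintegral_mono fun x => ?_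
  rw [ENNReal.ofReal_max, ENNReal.ofReal_zero, max_eq_left zero_le]

theorem lintegral_ofReal_sub_eq {α : Type*} [MeasurableSpace α] {μ : Measure α} [SFinite μ]
    {f : α → ℝ} (hf : Measurable f) (a : ℝ) :
    ∫⁻ x, ENNReal.ofReal (f x - a) ∂μ = ∫⁻ t in Ioi a, μ {x | t ≤ f x} := by
  have h1 (x : α) : ENNReal.ofReal (f x - a) =
      ∫⁻ t in Ioi a, {p : α × ℝ | p.2 ≤ f p.1}.indicator 1 (x, t) := by
    have e : (fun t => {p : α × ℝ | p.2 ≤ f p.1}.indicator (1 : α × ℝ → ℝ≥0∞) (x, t)) =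
        (Iic (f x)).indicator 1 := by
      ext t
      simp [indicator]
    rw [e, lintegral_indicator_one measurableSet_Iic, Measure.restrict_apply measurableSet_Iic,
      Iic_inter_Ioi, Real.volume_Ioc]
  have hm : MeasurableSet {p : α × ℝ | p.2 ≤ f p.1} :=
    measurableSet_le measurable_snd (hf.comp measurable_fst)
  simp_rw [h1]
  rw [lintegral_lintegral_swap
    (f := fun x t => {p : α × ℝ | p.2 ≤ f p.1}.indicator (1 : α × ℝ → ℝ≥0∞) (x, t))
    (measurable_one.indicator hm).aemeasurable]
  refine lintegral_congr fun t => ?_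
  have e : (fun x => {p : α × ℝ | p.2 ≤ f p.1}.indicator (1 : α × ℝ → ℝ≥0∞) (x, t)) =
      {x | t ≤ f x}.indicator 1 := by
    ext t
    simp [indicator]
  rw [e, lintegral_indicator_one (measurableSet_le measurable_const hf)]

namespace CubeFrame

variable {d : ℕ} (F : CubeFrame d)

theorem exists_dense_sub {E : Set (Euc d)} {x : Euc d} (hx : x ∈ F.cube)
    (hn : x ∉ F.dyadicNull) (hE : x ∉ mClosure d Eᶜ) (M : ℕ) :
    ∃ m ≥ M, volume (F.sub m (F.addr m x)).cube <
      2 ^ (d + 1) * volume (E ∩ (F.sub m (F.addr m x)).cube) := by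
  set c : ℝ := 1 / (4 * (d + 1) ^ d)
  obtain ⟨δ, hδ, h⟩ := notMem_mClosure_iff.1 hE (ENNReal.ofReal c)
    (by rw [ENNReal.ofReal_pos]; positivity)
  obtain ⟨M', hM'⟩ := exists_pow_lt_of_lt_one (div_pos hδ (mul_pos (by positivity : (0:ℝ) < d + 1) F.hl))
    (by norm_num : (1 / 2 : ℝ) < 1)
  set m := max M M'
  refine ⟨m, le_max_left _ _, ?_⟩
  set D := F.sub m (F.addr m x) with hD
  have hDl : D.l = F.l * (1 / 2) ^ m := by
    simp [D, sub, div_eq_mul_inv]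
  have hxD : x ∈ D.cube := F.mem_sub_addr m hx hn
  set r := (d + 1) * D.l
  have hr : 0 < r := mul_pos (by positivity) D.hl
  have hrδ : r < δ := by
    have h1 : (1 / 2 : ℝ) ^ m ≤ (1 / 2) ^ M' :=
      pow_le_pow_of_le_one (by norm_num) (by norm_num) (le_max_right _ _)
    rw [lt_div_iff₀ (mul_pos (by positivity : (0:ℝ) < d + 1) F.hl)] at hM'
    have := mul_le_mul_of_nonneg_right h1 (mul_pos (by positivity : (0:ℝ) < d + 1) F.hl).le
    simp only [r, hDl]
    linarith
  have h1 := h r hr hrδ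
  have h2 : volume (D.cube \ E) ≤ ENNReal.ofReal (1 / 4) * volume D.cube := by
    have h3 : D.cube \ E ⊆ ball x r ∩ Eᶜ := fun y hy => by
      refine ⟨?_, hy.2⟩
      have := D.dist_le_of_mem_cube hy.1 hxD
      rw [mem_ball]
      have := D.hl
      simp only [r]
      linarith
    refine (measure_mono h3).trans (h1.trans_eq ?_)
    rw [volume_cube, ← ENNReal.ofReal_mul (by positivity), ← ENNReal.ofReal_mul (by positivity)]
    congr 1
    simp only [r, c, mul_pow]
    field_simp
  by_contra! h4
  have h5 : volume D.cube ≤ volume (E ∩ D.cube) + volume (D.cube \ E) := by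
    rw [inter_comm]
    exact measure_le_inter_add_sdiff _ _ _
  have h6 : 2 * volume (E ∩ D.cube) ≤ volume D.cube := by
    refine le_trans ?_ h4
    gcongr
    exact le_self_pow₀ one_le_two (by omega)
  have hfin := D.volume_cube_ne_top
  have hfin2 : volume (E ∩ D.cube) ≠ ⊤ := measure_ne_top_of_subset inter_subset_right hfin
  have hfin3 : volume (D.cube \ E) ≠ ⊤ := measure_ne_top_of_subset sdiff_subset hfin
  have hpos := ENNReal.toReal_pos D.volume_cube_ne_zero hfin
  have h5' := ENNReal.toReal_mono (by finiteness) h5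
  rw [ENNReal.toReal_add hfin2 hfin3] at h5'
  have h6' := ENNReal.toReal_mono hfin h6
  have h2' := ENNReal.toReal_mono (by finiteness) h2
  rw [ENNReal.toReal_mul, ENNReal.toReal_ofReal (by norm_num)] at h2'
  rw [ENNReal.toReal_mul, ENNReal.toReal_ofNat] at h6'
  linarith

variable (f : Euc d → ℝ) (halt : ℝ → ℕ → (Fin d → ℕ) → Prop)

/-- Some dyadic cube of positive generation containing the given one is stopped at level `t`. -/
def ancStop (t : ℝ) : ℕ → (Fin d → ℕ) → Prop
  | 0, _ => False
  | m + 1, k => halt t (m + 1) k ∨ ancStop t m (half k)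

/-- A dyadic cube below a stopped one with a large share of the superlevel set. -/
def denseAt (t : ℝ) (m : ℕ) (k : Fin d → ℕ) : Prop :=
  ancStop halt t m k ∧
    volume (F.sub m k).cube < 2 ^ (d + 1) * volume ({x | t ≤ f x} ∩ (F.sub m k).cube)

/-- No strict dyadic ancestor is dense. -/
def noDense (t : ℝ) : ℕ → (Fin d → ℕ) → Prop
  | 0, _ => True
  | m + 1, k => ¬ F.denseAt f halt t m (half k) ∧ noDense t m (half k)

/-- The maximal dense cubes in which the superlevel set has density at most one half. -/
def goodAt (t : ℝ) (m : ℕ) (k : Fin d → ℕ) : Prop :=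
  (∀ i, k i < 2 ^ m) ∧ F.denseAt f halt t m k ∧ F.noDense f halt t m k ∧
    2 * volume ({x | t ≤ f x} ∩ (F.sub m k).cube) ≤ volume (F.sub m k).cube

/-- The part of the superlevel set in the good cubes. -/
def goodSet (t : ℝ) : Set (Euc d) :=
  ⋃ (m : ℕ) (k : Fin d → ℕ) (_ : F.goodAt f halt t m k), {x | t ≤ f x} ∩ (F.sub m k).cube

/-- A dyadic cube not below a stopped one at some level above `b` at which the superlevel set
occupies more than half of a child. -/
def badAt (b : ℝ) (m : ℕ) (k : Fin d → ℕ) : Prop :=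
  ∃ k', half k' = k ∧ ∃ t > b, ¬ ancStop halt t m k ∧
    volume (F.sub (m + 1) k').cube < 2 * volume ({x | t ≤ f x} ∩ (F.sub (m + 1) k').cube)

/-- No strict dyadic ancestor is bad. -/
def noBad (b : ℝ) : ℕ → (Fin d → ℕ) → Prop
  | 0, _ => True
  | m + 1, k => ¬ F.badAt f halt b m (half k) ∧ noBad b m (half k)

variable {f halt}

theorem volume_lt_of_child {t : ℝ} {m : ℕ} {k : Fin d → ℕ}
    (h : volume (F.sub (m + 1) k).cube < 2 * volume ({x | t ≤ f x} ∩ (F.sub (m + 1) k).cube)) :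
    volume (F.sub m (half k)).cube <
      2 ^ (d + 1) * volume ({x | t ≤ f x} ∩ (F.sub m (half k)).cube) := by
  rw [volume_sub_half, pow_succ, mul_assoc]
  refine (ENNReal.mul_lt_mul_iff_right (by positivity) (by finiteness)).2 (h.trans_le ?_)
  gcongr
  exact F.sub_cube_subset_half m k

theorem exists_goodAt {b t : ℝ} (ht : b < t) {m : ℕ} {k : Fin d → ℕ} (hk : ∀ i, k i < 2 ^ m)
    (hb : F.noBad f halt b m k) (h : F.denseAt f halt t m k ∨ ¬ F.noDense f halt t m k) :
    ∃ m' k', F.goodAt f halt t m' k' ∧ (F.sub m k).cube ⊆ (F.sub m' k').cube := by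
  induction m generalizing k with
  | zero =>
    rcases h with h | h
    · exact h.1.elim
    · exact (h trivial).elim
  | succ m ih =>
    by_cases h1 : F.denseAt f halt t m (half k) ∨ ¬ F.noDense f halt t m (half k)
    · obtain ⟨m', k', hg, hs⟩ := ih (half_lt hk) hb.2 h1
      exact ⟨m', k', hg, (F.sub_cube_subset_half m k).trans hs⟩
    push Not at h1
    have hnd : F.noDense f halt t (m + 1) k := h1
    have hd : F.denseAt f halt t (m + 1) k := h.resolve_right (not_not.2 hnd)
    refine ⟨m + 1, k, ⟨hk, hd, hnd, ?_⟩, subset_rfl⟩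
    by_contra! h2
    by_cases h3 : ancStop halt t m (half k)
    · exact h1.1 ⟨h3, F.volume_lt_of_child h2⟩
    · exact hb.1 ⟨k, rfl, t, ht, h3, h2⟩

theorem not_denseAt_addr {t : ℝ} {m : ℕ} {y : Euc d} (h : F.noDense f halt t m (F.addr m y))
    {j : ℕ} (hj : j < m) : ¬ F.denseAt f halt t j (F.addr j y) := by
  induction m with
  | zero => omega
  | succ m ih =>
    rw [noDense, half_addr] at h
    rcases (Nat.lt_succ_iff_lt_or_eq).1 hj with hj | rfl
    · exact ih h.2 hj
    · exact h.1

theorem goodAt_unique {t : ℝ} {m m' : ℕ} {k k' : Fin d → ℕ} (h : F.goodAt f halt t m k)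
    (h' : F.goodAt f halt t m' k') {y : Euc d} (hy : y ∈ (F.sub m k).cube)
    (hy' : y ∈ (F.sub m' k').cube) : m = m' ∧ k = k' := by
  obtain rfl := F.addr_eq_of_mem hy
  obtain rfl := F.addr_eq_of_mem hy'
  have : m = m' := by
    rcases lt_trichotomy m m' with hlt | heq | hlt
    · exact (F.not_denseAt_addr h'.2.2.1 hlt h.2.1).elim
    · exact heq
    · exact (F.not_denseAt_addr h.2.2.1 hlt h'.2.1).elim
  exact ⟨this, by rw [this]⟩

theorem exists_stop_of_ancStop {t : ℝ} {m : ℕ} {k : Fin d → ℕ} (hk : ∀ i, k i < 2 ^ m)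
    (h : ancStop halt t m k) : ∃ m' k', (∀ i, k' i < 2 ^ m') ∧ halt t m' k' ∧
      (F.sub m k).cube ⊆ (F.sub m' k').cube := by
  induction m generalizing k with
  | zero => exact h.elim
  | succ m ih =>
    rcases h with h | h
    · exact ⟨m + 1, k, hk, h, subset_rfl⟩
    · obtain ⟨m', k', hk', hs, hsub⟩ := ih (half_lt hk) h
      exact ⟨m', k', hk', hs, (F.sub_cube_subset_half m k).trans hsub⟩

end CubeFrame

namespace CubeFrame

variable {d : ℕ} (F : CubeFrame d) {f : Euc d → ℝ} {halt : ℝ → ℕ → (Fin d → ℕ) → Prop}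

theorem noBad_addr {b : ℝ} {N : ℕ} (hN1 : 1 ≤ N) (hN : ∀ t m k, N ≤ m → halt t m k) {y : Euc d}
    (h : F.noBad f halt b N (F.addr N y)) {m : ℕ} (hm : N ≤ m) :
    F.noBad f halt b m (F.addr m y) := by
  induction m, hm using Nat.le_induction with
  | base => exact h
  | succ m hm ih =>
    rw [noBad, half_addr]
    refine ⟨?_, ih⟩
    rintro ⟨k', -, t, -, hs, -⟩
    obtain ⟨m, rfl⟩ : ∃ j, m = j + 1 := ⟨m - 1, by omega⟩
    exact hs (Or.inl (hN _ _ _ hm))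

theorem leaf_subset_goodSet {b t : ℝ} (ht : b < t) {N : ℕ} (hN1 : 1 ≤ N)
    (hN : ∀ t m k, N ≤ m → halt t m k) {k : Fin d → ℕ} (hk : ∀ i, k i < 2 ^ N)
    (hb : F.noBad f halt b N k) {x : Euc d} (hx : x ∈ (F.sub N k).cube) (hxt : t ≤ f x)
    (hn : x ∉ F.dyadicNull) (hE : x ∉ mClosure d {x | t ≤ f x}ᶜ) :
    x ∈ F.goodSet f halt t := by
  have hxF := F.sub_cube_subset hk hx
  obtain rfl := F.addr_eq_of_mem hx
  obtain ⟨m, hm, hd⟩ := F.exists_dense_sub hxF hn hE N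
  have hs : ancStop halt t m (F.addr m x) := by
    obtain ⟨m, rfl⟩ : ∃ j, m = j + 1 := ⟨m - 1, by omega⟩
    exact Or.inl (hN _ _ _ hm)
  obtain ⟨m', k', hg, hsub⟩ := F.exists_goodAt ht (F.addr_lt m hxF)
    (F.noBad_addr hN1 hN hb hm) (Or.inl ⟨hs, hd⟩)
  simp only [goodSet, mem_iUnion]
  exact ⟨m', k', hg, hxt, hsub (F.mem_sub_addr m hxF hn)⟩

theorem volume_leaf_le (hf : Measurable f) {b t : ℝ} (ht : b < t) {N : ℕ} (hN1 : 1 ≤ N)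
    (hN : ∀ t m k, N ≤ m → halt t m k) {k : Fin d → ℕ} (hk : ∀ i, k i < 2 ^ N)
    (hb : F.noBad f halt b N k) : volume ({x | t ≤ f x} ∩ (F.sub N k).cube) ≤
      volume (F.goodSet f halt t ∩ (F.sub N k).cube) := by
  have hsub : {x | t ≤ f x} ∩ (F.sub N k).cube ⊆ (F.goodSet f halt t ∩ (F.sub N k).cube) ∪
      (F.dyadicNull ∪ {x | t ≤ f x} ∩ mClosure d {x | t ≤ f x}ᶜ) := by
    rintro x ⟨hxt, hx⟩
    by_cases hn : x ∈ F.dyadicNull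
    · exact Or.inr (Or.inl hn)
    by_cases hE : x ∈ mClosure d {x | t ≤ f x}ᶜ
    · exact Or.inr (Or.inr ⟨hxt, hE⟩)
    exact Or.inl ⟨F.leaf_subset_goodSet ht hN1 hN hk hb hx hxt hn hE, hx⟩
  refine (measure_mono hsub).trans ((measure_union_le _ _).trans ?_)
  have : volume (F.dyadicNull ∪ {x | t ≤ f x} ∩ mClosure d {x | t ≤ f x}ᶜ) = 0 :=
    measure_union_null F.volume_dyadicNull
      (volume_inter_mClosure_compl (measurableSet_le measurable_const hf))
  rw [this, add_zero]

theorem setIntegral_sub_const_eq (hfi : Integrable f) (a : ℝ) :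
    ∫ x in F.cube, (f x - a) = (avg d f F.cube - a) * (volume F.cube).toReal := by
  have hpos := ENNReal.toReal_pos F.volume_cube_ne_zero F.volume_cube_ne_top
  rw [integral_sub hfi.integrableOn (integrableOn_const F.volume_cube_ne_top), setIntegral_const, avg,
    smul_eq_mul, Measure.real]
  field_simp

theorem ofReal_setIntegral_sub_const_le (hfi : Integrable f) (a b : ℝ) :
    ENNReal.ofReal (∫ x in F.cube, (f x - a)) ≤
      ENNReal.ofReal (b - a) * volume F.cube +
        ENNReal.ofReal (avg d f F.cube - b) * volume F.cube := by
  have e := ENNReal.ofReal_toReal F.volume_cube_ne_top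
  rw [F.setIntegral_sub_const_eq hfi, ENNReal.ofReal_mul' ENNReal.toReal_nonneg, e, ← add_mul]
  gcongr
  refine le_trans (le_of_eq ?_) ENNReal.ofReal_add_le
  congr 1
  ring

/-- The integral over a dyadic cube in terms of the good sets. -/
theorem ofReal_integral_sub_le (hf : Measurable f) (hfi : Integrable f) {a b : ℝ} (hab : a ≤ b)
    (hb : avg d f F.cube ≤ b) {N : ℕ} (hN1 : 1 ≤ N) (hN : ∀ t m k, N ≤ m → halt t m k)
    (hhalt : ∀ t m k, t ≤ avg d f (F.sub m k).cube → halt t m k)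
    (j m : ℕ) (hj : m + j = N) (k : Fin d → ℕ) (hk : ∀ i, k i < 2 ^ m)
    (hbad : F.noBad f halt b m k) :
    ENNReal.ofReal (∫ x in (F.sub m k).cube, (f x - a)) ≤
      2 ^ (d + 1) * (ENNReal.ofReal (b - a) * volume ({x | a ≤ f x} ∩ (F.sub m k).cube) +
        ∫⁻ t in Ioi b, volume (F.goodSet f halt t ∩ (F.sub m k).cube)) := by
  have hmono {t t' : ℝ} (h : t ≤ t') (S : Set (Euc d)) :
      volume ({x | t' ≤ f x} ∩ S) ≤ volume ({x | t ≤ f x} ∩ S) :=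
    measure_mono (inter_subset_inter_left _ fun x (hx : t' ≤ f x) => h.trans hx)
  have hM : (1 : ℝ≥0∞) ≤ 2 ^ (d + 1) := one_le_pow₀ one_le_two
  induction j generalizing m k with
  | zero =>
    obtain rfl : m = N := by omega
    refine le_trans ?_ (le_mul_of_one_le_left zero_le hM)
    set P := (F.sub m k).cube
    have hi : Integrable (fun x => f x - a) (volume.restrict P) :=
      hfi.integrableOn.sub (integrableOn_const (F.sub m k).volume_cube_ne_top)
    refine (ofReal_integral_le_lintegral hi).trans ?_
    rw [lintegral_ofReal_sub_eq hf, ← Ioc_union_Ioi_eq_Ioi hab]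
    refine (lintegral_union_le _ _ _).trans ?_
    have hr (t : ℝ) : volume.restrict P {x | t ≤ f x} = volume ({x | t ≤ f x} ∩ P) :=
      Measure.restrict_apply (measurableSet_le measurable_const hf)
    simp only [hr]
    gcongr ?_ + ?_
    · refine (setLIntegral_mono measurable_const fun t ht => hmono ht.1.le P).trans ?_
      rw [setLIntegral_const, Real.volume_Ioc, mul_comm]
    · exact setLIntegral_mono' measurableSet_Ioi fun t ht => F.volume_leaf_le hf ht hN1 hN hk hbad
  | succ j ih =>
    by_cases hR : F.badAt f halt b m k
    · refine ((F.sub m k).ofReal_setIntegral_sub_const_le hfi a b).trans ?_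
      obtain ⟨k', rfl, t, ht, hs, hlt⟩ := hR
      have hlt' := F.volume_lt_of_child hlt
      set P := (F.sub m (half k')).cube with hP
      rw [mul_add]
      gcongr ?_ + ?_
      · rw [mul_left_comm]
        gcongr
        refine hlt'.le.trans ?_
        gcongr
        exact hab.trans (le_of_lt ht)
      · rw [← Real.volume_Ioc, mul_comm, ← setLIntegral_const,
          ← lintegral_const_mul' _ _ (by finiteness)]
        refine (setLIntegral_mono' measurableSet_Ioc fun s hs' => ?_).trans
          (lintegral_mono_set Ioc_subset_Ioi_self)
        have hanc : ancStop halt s m (half k') ∧ s ≤ t := by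
          cases m with
          | zero =>
            exfalso
            have : half k' = 0 := by
              ext i
              simpa using hk i
            rw [hP, this, sub_zero_cube] at hs'
            linarith [hs'.1, hs'.2]
          | succ m =>
            refine ⟨Or.inl (hhalt _ _ _ hs'.2), ?_⟩
            by_contra! hlt2
            exact hs (Or.inl (hhalt _ _ _ (hlt2.le.trans hs'.2)))
        have hd : volume P < 2 ^ (d + 1) * volume ({x | s ≤ f x} ∩ P) :=
          hlt'.trans_le (by gcongr; exact hanc.2)
        obtain ⟨m', k'', hg, hsub⟩ := F.exists_goodAt hs'.1 hk hbad (Or.inl ⟨hanc.1, hd⟩)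
        refine hd.le.trans (mul_le_mul' le_rfl (measure_mono ?_))
        rintro x ⟨hx, hxP⟩
        refine ⟨?_, hxP⟩
        simp only [goodSet, mem_iUnion]
        exact ⟨m', k'', hg, hx, hsub hxP⟩
    · have hchild (e : Fin d → Bool) := ih (m + 1) (by omega) (child k e) (child_lt hk e)
        ⟨by rwa [half_child], by rwa [half_child]⟩
      have hdisj := F.pairwise_disjoint_child m k
      have hsubs (e : Fin d → Bool) : (F.sub (m + 1) (child k e)).cube ⊆ (F.sub m k).cube :=
        (F.sub_cube_subset_half m _).trans (by rw [half_child])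
      have hi : IntegrableOn (fun x => f x - a) (F.sub m k).cube :=
        hfi.integrableOn.sub (integrableOn_const (F.sub m k).volume_cube_ne_top)
      have hint : ∫ x in (F.sub m k).cube, (f x - a) =
          ∑ e, ∫ x in (F.sub (m + 1) (child k e)).cube, (f x - a) := by
        rw [← setIntegral_congr_set (F.iUnion_child_ae_eq hk),
          integral_iUnion_fintype (fun e => measurableSet_cube _) hdisj
            fun e => hi.mono_set (hsubs e)]
      have hvol (T : Set (Euc d)) : ∑ e, volume (T ∩ (F.sub (m + 1) (child k e)).cube) ≤
          volume (T ∩ (F.sub m k).cube) := by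
        have h1 (e : Fin d → Bool) : volume (T ∩ (F.sub (m + 1) (child k e)).cube) =
            volume.restrict T (F.sub (m + 1) (child k e)).cube := by
          rw [Measure.restrict_apply (measurableSet_cube _), inter_comm]
        simp only [h1]
        rw [← tsum_fintype (L := .unconditional _), ← measure_iUnion hdisj (fun e => measurableSet_cube _)]
        refine (measure_mono (iUnion_subset hsubs)).trans_eq ?_
        rw [Measure.restrict_apply (measurableSet_cube _), inter_comm]
      rw [hint]
      calc _ ≤ ∑ e, ENNReal.ofReal (∫ x in (F.sub (m + 1) (child k e)).cube, (f x - a)) :=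
            Finset.le_sum_of_subadditive _ ENNReal.ofReal_zero.le (fun _ _ => ENNReal.ofReal_add_le) _ _
        _ ≤ ∑ e, _ := Finset.sum_le_sum fun e _ => hchild e
        _ = 2 ^ (d + 1) * (ENNReal.ofReal (b - a) *
              ∑ e, volume ({x | a ≤ f x} ∩ (F.sub (m + 1) (child k e)).cube) +
              ∑ e, ∫⁻ t in Ioi b, volume (F.goodSet f halt t ∩ (F.sub (m + 1) (child k e)).cube)) := by
            rw [← Finset.mul_sum, Finset.sum_add_distrib, ← Finset.mul_sum]
        _ ≤ _ := by
            gcongr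
            · exact hvol _
            · exact (sum_lintegral_le _ _ _).trans (lintegral_mono fun t => hvol _)

/-- If the superlevel set at level `a` has small density in a cube with average `b`, then `b - a` is
controlled by the good sets. -/
theorem ofReal_sub_mul_volume_le (hf : Measurable f) (hfi : Integrable f) {a : ℝ}
    (hab : a ≤ avg d f F.cube) {N : ℕ} (hN1 : 1 ≤ N) (hN : ∀ t m k, N ≤ m → halt t m k)
    (hhalt : ∀ t m k, t ≤ avg d f (F.sub m k).cube → halt t m k)
    (ha : 2 ^ (d + 2) * volume ({x | a ≤ f x} ∩ F.cube) ≤ volume F.cube) :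
    ENNReal.ofReal (avg d f F.cube - a) * volume F.cube ≤
      2 ^ (d + 2) * ∫⁻ t in Ioi (avg d f F.cube), volume (F.goodSet f halt t ∩ F.cube) := by
  have h := F.ofReal_integral_sub_le hf hfi hab le_rfl hN1 hN hhalt N 0 (by omega) 0
    (by simp) trivial
  rw [sub_zero_cube, setIntegral_sub_const_eq _ hfi, ENNReal.ofReal_mul' ENNReal.toReal_nonneg,
    ENNReal.ofReal_toReal F.volume_cube_ne_top] at h
  set I := ∫⁻ t in Ioi (avg d f F.cube), volume (F.goodSet f halt t ∩ F.cube)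
  set x := ENNReal.ofReal (avg d f F.cube - a) * volume F.cube with hx
  have hxt : x ≠ ⊤ := ENNReal.mul_ne_top ENNReal.ofReal_ne_top F.volume_cube_ne_top
  have h2 : 2 * x ≤ x + 2 ^ (d + 2) * I := by
    calc 2 * x ≤ 2 * (2 ^ (d + 1) * (ENNReal.ofReal (avg d f F.cube - a) *
            volume ({x | a ≤ f x} ∩ F.cube) + I)) := by gcongr
      _ = ENNReal.ofReal (avg d f F.cube - a) * (2 ^ (d + 2) * volume ({x | a ≤ f x} ∩ F.cube)) +
          2 ^ (d + 2) * I := by ring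
      _ ≤ _ := by rw [hx]; gcongr
  rw [two_mul] at h2
  exact (ENNReal.add_le_add_iff_left hxt).1 h2

end CubeFrame

namespace CubeFrame

variable {d : ℕ} (F : CubeFrame d)

/-- The concentric cube of `1 - 2 θ` times the side length. -/
def shrink (θ : ℝ) (hθ : θ < 1 / 2) : CubeFrame d where
  l := F.l * (1 - 2 * θ)
  hl := mul_pos F.hl (by linarith)
  r := F.r
  v := F.map (WithLp.toLp 2 fun _ => θ)

theorem shrink_map (θ : ℝ) (hθ : θ < 1 / 2) (u : Euc d) :
    (F.shrink θ hθ).map u = F.map (WithLp.toLp 2 fun i => θ + (1 - 2 * θ) * u i) := by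
  have e : WithLp.toLp 2 (fun i => θ + (1 - 2 * θ) * u i : Fin d → ℝ) =
      (1 - 2 * θ) • u + WithLp.toLp 2 fun _ => θ := by
    ext i
    simp
    ring
  rw [e]
  simp only [map, shrink, map_add, map_smul]
  module

theorem shrink_inv (θ : ℝ) (hθ : θ < 1 / 2) (y : Euc d) (i : Fin d) :
    F.inv y i = θ + (1 - 2 * θ) * (F.shrink θ hθ).inv y i := by
  have h := congrArg F.inv (F.shrink_map θ hθ ((F.shrink θ hθ).inv y))
  rw [map_inv, inv_map] at h
  rw [h]

theorem mem_shrink_cube {θ : ℝ} (hθ : θ < 1 / 2) {y : Euc d} :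
    y ∈ (F.shrink θ hθ).cube ↔ ∀ i, θ < F.inv y i ∧ F.inv y i < 1 - θ := by
  rw [mem_cube_iff]
  refine forall_congr' fun i => ?_
  rw [F.shrink_inv θ hθ y i, mem_Ioo]
  have h : 0 < 1 - 2 * θ := by linarith
  constructor
  · rintro ⟨h1, h2⟩
    constructor <;> nlinarith
  · rintro ⟨h1, h2⟩
    constructor
    · by_contra! h3
      nlinarith
    · by_contra! h3
      nlinarith

theorem shrink_cube_subset {θ : ℝ} (hθ : θ < 1 / 2) (h0 : 0 ≤ θ) :
    (F.shrink θ hθ).cube ⊆ F.cube := fun y hy => by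
  rw [mem_shrink_cube] at hy
  rw [mem_cube_iff]
  exact fun i => ⟨by linarith [(hy i).1], by linarith [(hy i).2]⟩

theorem closure_shrink_subset {θ θ' : ℝ} (hθ : θ < 1 / 2) (hθ' : θ' < θ) :
    closure (F.shrink θ hθ).cube ⊆ (F.shrink θ' (hθ'.trans hθ)).cube := fun y hy => by
  rw [mem_shrink_cube]
  intro i
  have h := (F.shrink θ hθ).inv_mem_Icc_of_mem_closure hy i
  rw [F.shrink_inv θ hθ y i]
  have h' : 0 < 1 - 2 * θ := by linarith
  constructor
  · nlinarith [mul_nonneg h'.le h.1]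
  · nlinarith [mul_le_mul_of_nonneg_left h.2 h'.le]

/-- A small parameter depending only on the dimension. -/
def margin (d : ℕ) : ℝ := 1 / (2 ^ (d + 4) * (d + 1))

theorem margin_pos (d : ℕ) : 0 < margin d := by unfold margin; positivity

theorem margin_lt (d : ℕ) : margin d < 1 / 4 := by
  unfold margin
  have h1 : (16 : ℝ) ≤ 2 ^ (d + 4) := by
    rw [pow_add]
    have : (1 : ℝ) ≤ 2 ^ d := one_le_pow₀ one_le_two
    linarith
  have : (16 : ℝ) ≤ 2 ^ (d + 4) * (d + 1) := by nlinarith [d.cast_nonneg (α := ℝ)]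
  rw [div_lt_div_iff₀ (by positivity) (by norm_num)]
  linarith

theorem margin_lt_half (d : ℕ) : margin d < 1 / 2 := (margin_lt d).trans (by norm_num)

/-- The concentric cube with a small margin removed. -/
abbrev core : CubeFrame d := F.shrink (margin d) (margin_lt_half d)

theorem core_cube_subset : F.core.cube ⊆ F.cube := F.shrink_cube_subset _ (margin_pos d).le

theorem volume_diff_core_le : 2 ^ (d + 3) * volume (F.cube \ F.core.cube) ≤ volume F.cube := by
  have h1 := measure_sdiff_add_inter (μ := volume) F.cube F.core.measurableSet_cube
  rw [inter_eq_self_of_subset_right F.core_cube_subset, F.core.volume_cube, F.volume_cube] at h1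
  rw [F.volume_cube]
  have hfin : volume (F.cube \ F.core.cube) ≠ ⊤ :=
    measure_ne_top_of_subset sdiff_subset F.volume_cube_ne_top
  have hl := F.hl
  have hl' := F.core.hl
  have h2 := congrArg ENNReal.toReal h1
  rw [ENNReal.toReal_add hfin ENNReal.ofReal_ne_top, ENNReal.toReal_ofReal (by positivity),
    ENNReal.toReal_ofReal (by positivity)] at h2
  rw [← ENNReal.ofReal_toReal hfin]
  have : (2 : ℝ≥0∞) ^ (d + 3) = ENNReal.ofReal (2 ^ (d + 3)) := by
    rw [ENNReal.ofReal_pow zero_le_two]; norm_num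
  rw [this, ← ENNReal.ofReal_mul (by positivity)]
  refine ENNReal.ofReal_le_ofReal ?_
  have h3 : F.core.l = F.l * (1 - 2 * margin d) := rfl
  rw [h3, mul_pow] at h2
  have h4 := one_add_mul_le_pow (a := -(2 * margin d)) (by linarith [margin_lt d]) d
  have h5 : (volume (F.cube \ F.core.cube)).toReal ≤ F.l ^ d * (d * (2 * margin d)) := by
    have := mul_le_mul_of_nonneg_left h4 (pow_pos hl d).le
    rw [← sub_eq_add_neg] at this
    linarith
  have h6 : 2 ^ (d + 3) * (d * (2 * margin d)) ≤ 1 := by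
    unfold margin
    rw [show (2:ℝ) ^ (d + 4) = 2 ^ (d + 3) * 2 by ring]
    have : (d : ℝ) ≤ d + 1 := by linarith
    field_simp
    exact this
  calc _ ≤ 2 ^ (d + 3) * (F.l ^ d * (d * (2 * margin d))) := by gcongr
    _ = F.l ^ d * (2 ^ (d + 3) * (d * (2 * margin d))) := by ring
    _ ≤ F.l ^ d * 1 := by gcongr
    _ = _ := mul_one _

/-- The resolution at which positions of cubes are distinguished. -/
def mesh (d : ℕ) : ℝ := margin d / (d + 1) ^ 2

theorem mesh_pos (d : ℕ) : 0 < mesh d := div_pos (margin_pos d) (by positivity)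

/-- The dyadic scale of a cube. -/
def scale : ℤ := Int.log 2 F.l

theorem two_zpow_scale_le : (2 : ℝ) ^ F.scale ≤ F.l := by
  exact_mod_cast Int.zpow_log_le_self one_lt_two F.hl

theorem lt_two_zpow_scale : F.l < 2 * (2 : ℝ) ^ F.scale := by
  have := Int.lt_zpow_succ_log_self (b := 2) one_lt_two F.l
  rw [zpow_add_one₀ (by norm_num), mul_comm] at this
  exact_mod_cast this

/-- The rounded position of a cube. -/
def key : ℤ × (Fin d → ℤ) × (Fin d → Fin d → ℤ) :=
  (F.scale, fun i => ⌊F.v i / (mesh d * 2 ^ F.scale)⌋,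
    fun j i => ⌊(F.l • F.r (EuclideanSpace.single j 1)) i / (mesh d * 2 ^ F.scale)⌋)

variable {F} in
theorem dist_map_le_of_key_eq {G : CubeFrame d} (h : F.key = G.key) {u : Euc d}
    (hu : ∀ i, |u i| ≤ 1) : dist (F.map u) (G.map u) ≤ margin d * 2 ^ G.scale := by
  simp only [key, Prod.mk.injEq] at h
  obtain ⟨h1, h2, h3⟩ := h
  rw [h1] at h2 h3
  set s := mesh d * 2 ^ G.scale with hs
  have hs0 : 0 < s := mul_pos (mesh_pos d) (by positivity)
  have hfl {a b : ℝ} (h : ⌊a / s⌋ = ⌊b / s⌋) : |a - b| ≤ s := by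
    have := Int.abs_sub_lt_one_of_floor_eq_floor h
    rw [← sub_div, abs_div, abs_of_pos hs0, div_lt_one hs0] at this
    exact this.le
  have hmap (F : CubeFrame d) (i : Fin d) : F.map u i =
      ∑ j, u j * (F.l • F.r (EuclideanSpace.single j 1)) i + F.v i := by
    have hu' : u = ∑ j, u j • EuclideanSpace.single j (1 : ℝ) := by
      ext i
      simp [Finset.sum_apply, Pi.single_apply]
    have : F.map u = ∑ j, u j • (F.l • F.r (EuclideanSpace.single j 1)) + F.v := by
      conv_lhs => rw [hu']
      simp only [map, map_sum, map_smul, Finset.smul_sum]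
      congr 1
      exact Finset.sum_congr rfl fun j _ => smul_comm _ _ _
    rw [this]
    simp [Finset.sum_apply]
  have hcoord (i : Fin d) : |(F.map u - G.map u) i| ≤ (d + 1) * s := by
    have e : (F.map u - G.map u) i = ∑ j, u j * ((F.l • F.r (EuclideanSpace.single j 1)) i -
        (G.l • G.r (EuclideanSpace.single j 1)) i) + (F.v i - G.v i) := by
      rw [PiLp.sub_apply, hmap, hmap]
      simp only [mul_sub, Finset.sum_sub_distrib]
      ring
    rw [e]
    refine (abs_add_le _ _).trans ?_
    have h4 := hfl (congrFun h2 i)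
    have h5 : |∑ j, u j * ((F.l • F.r (EuclideanSpace.single j 1)) i -
        (G.l • G.r (EuclideanSpace.single j 1)) i)| ≤ ∑ _j : Fin d, s := by
      refine (Finset.abs_sum_le_sum_abs _ _).trans (Finset.sum_le_sum fun j _ => ?_)
      rw [abs_mul]
      have := mul_le_mul (hu j) (hfl (congrFun (congrFun h3 j) i)) (abs_nonneg _) zero_le_one
      linarith
    simp only [Finset.sum_const, Finset.card_univ, Fintype.card_fin, nsmul_eq_mul] at h5
    linarith
  rw [dist_eq_norm]
  refine (norm_le_of_coord (by positivity) hcoord).trans ?_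
  rw [hs, mesh]
  have hm := margin_pos d
  calc (d : ℝ) * ((d + 1) * (margin d / (d + 1) ^ 2 * 2 ^ G.scale))
      = d / (d + 1) * (margin d * 2 ^ G.scale) := by field_simp
    _ ≤ 1 * (margin d * 2 ^ G.scale) := by
      gcongr
      exact (div_le_one (by positivity)).2 (by linarith)
    _ = _ := one_mul _

variable {F} in
theorem core_cube_subset_of_key_eq {G : CubeFrame d} (h : F.key = G.key) :
    F.core.cube ⊆ G.cube := by
  intro y hy
  rw [mem_shrink_cube] at hy
  rw [mem_cube_iff]
  have hm := margin_pos d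
  have h1 := dist_map_le_of_key_eq h (u := F.inv y) fun i =>
    abs_le.2 ⟨by linarith [(hy i).1], by linarith [(hy i).2]⟩
  rw [map_inv] at h1
  have h2 : dist (G.inv y) (F.inv y) ≤ margin d := by
    have h3 := G.dist_inv y (G.map (F.inv y))
    rw [inv_map] at h3
    rw [h3, inv_mul_le_iff₀ G.hl, mul_comm]
    exact h1.trans (mul_le_mul_of_nonneg_left G.two_zpow_scale_le hm.le)
  intro i
  have h4 := (abs_coord_le_norm (G.inv y - F.inv y) i).trans ((dist_eq_norm _ _).symm.trans_le h2)
  rw [PiLp.sub_apply, abs_le] at h4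
  exact ⟨by linarith [(hy i).1], by linarith [(hy i).2]⟩

variable {F} in
theorem scale_eq_of_key_eq {G : CubeFrame d} (h : F.key = G.key) : F.scale = G.scale :=
  congrArg Prod.fst h

variable {F} in
theorem l_le_of_key_eq {G : CubeFrame d} (h : F.key = G.key) : F.l ≤ 2 * G.l := by
  have h1 := F.lt_two_zpow_scale
  rw [scale_eq_of_key_eq h] at h1
  linarith [G.two_zpow_scale_le]

variable {F} in
theorem volume_le_of_key_eq {G : CubeFrame d} (h : F.key = G.key) :
    volume F.cube ≤ 2 ^ d * volume G.cube := by
  rw [volume_cube, volume_cube]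
  have : (2 : ℝ≥0∞) ^ d = ENNReal.ofReal (2 ^ d) := by
    rw [ENNReal.ofReal_pow zero_le_two]; norm_num
  rw [this, ← ENNReal.ofReal_mul (by positivity), ← mul_pow]
  exact ENNReal.ofReal_le_ofReal (pow_le_pow_left₀ F.hl.le (l_le_of_key_eq h) d)

end CubeFrame

theorem mClosure_subset_closure (d : ℕ) (E : Set (Euc d)) : mClosure d E ⊆ closure E := by
  intro x
  contrapose
  intro hx
  obtain ⟨δ, hδ, h⟩ := Metric.isOpen_iff.1 isClosed_closure.isOpen_compl x hx
  refine notMem_mClosure_iff.2 fun c _ => ⟨δ, hδ, fun r _ hr => ?_⟩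
  have : ball x r ∩ E = ∅ := by
    refine disjoint_iff_inter_eq_empty.1 (disjoint_left.2 fun y hy hyE => ?_)
    exact h (ball_subset_ball hr.le hy) (subset_closure hyE)
  rw [this, measure_empty]
  exact zero_le

theorem mBoundary_subset_frontier (d : ℕ) (E : Set (Euc d)) : mBoundary d E ⊆ frontier E := by
  rw [frontier_eq_closure_inter_closure]
  exact inter_subset_inter (mClosure_subset_closure d E) (mClosure_subset_closure d Eᶜ)

namespace CubeFrame

section

variable {n : ℕ} (F : CubeFrame (n + 1))

theorem frontier_cube_subset :
    frontier F.cube ⊆ ⋃ p : Fin (n + 1) × Fin 2, F.face p.1 (p.2 : ℕ) '' Icc 0 1 := by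
  intro x hx
  have hI := F.inv_mem_Icc_of_mem_closure (frontier_subset_closure hx)
  have hn : x ∉ F.cube := fun h => by
    rw [frontier, F.isOpen_cube.interior_eq] at hx
    exact hx.2 h
  rw [mem_cube_iff] at hn
  have : ∃ i, F.inv x i = 0 ∨ F.inv x i = 1 := by
    by_contra! h
    exact hn fun i => ⟨lt_of_le_of_ne (hI i).1 (h i).1.symm, lt_of_le_of_ne (hI i).2 (h i).2⟩
  obtain ⟨i, hi⟩ := this
  have key (s : Fin 2) (hs : F.inv x i = (s : ℕ)) :
      x ∈ ⋃ p : Fin (n + 1) × Fin 2, F.face p.1 (p.2 : ℕ) '' Icc 0 1 := by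
    refine mem_iUnion.2 ⟨(i, s), fun j => F.inv x (i.succAbove j), ⟨fun j => (hI _).1,
      fun j => (hI _).2⟩, ?_⟩
    rw [face]
    conv_rhs => rw [← F.map_inv x]
    congr 1
    ext j
    refine Fin.succAboveCases i ?_ (fun k => ?_) j
    · rw [shear_apply_same, hs]
    · rw [shear_apply_succAbove]
      simp
  rcases hi with h | h
  · exact key 0 (by simpa using h)
  · exact key 1 (by simpa using h)

theorem hausdorff_frontier_cube_le :
    μH[n] (frontier F.cube) ≤ (2 * (n + 1 : ℕ) * (n + 1 : ℕ) ^ n) * ENNReal.ofReal (F.l ^ n) := by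
  have h1 (p : Fin (n + 1) × Fin 2) : μH[n] (F.face p.1 (p.2 : ℕ) '' Icc 0 1) ≤
      (n + 1 : ℕ) ^ n * ENNReal.ofReal (F.l ^ n) := by
    refine ((F.lipschitzWith_face p.1 (p.2 : ℕ)).hausdorffMeasure_image_le
      (d := (n : ℝ)) n.cast_nonneg _).trans ?_
    have e : μH[n] (Icc (0 : Fin n → ℝ) 1) = 1 := by
      have := hausdorffMeasure_pi_real (ι := Fin n)
      rw [Fintype.card_fin] at this
      rw [this, Real.volume_Icc_pi]
      simp
    rw [e, mul_one, ENNReal.rpow_natCast, ENNReal.coe_mul, mul_pow, mul_comm,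
      ENNReal.ofReal_pow F.hl.le]
    rfl
  calc _ ≤ _ := measure_mono F.frontier_cube_subset
    _ ≤ _ := measure_iUnion_fintype_le _ _
    _ ≤ ∑ _p : Fin (n + 1) × Fin 2, (n + 1 : ℕ) ^ n * ENNReal.ofReal (F.l ^ n) :=
      Finset.sum_le_sum fun p _ => h1 p
    _ = _ := by
      simp only [Finset.sum_const, Finset.card_univ, Fintype.card_prod, Fintype.card_fin,
        nsmul_eq_mul, Nat.cast_mul]
      push_cast
      ring

end

theorem hausdorff_frontier_class_le (n : ℕ) :
    ∃ C : ℝ≥0∞, C ≠ ⊤ ∧ ∀ (ι : Type) [Fintype ι] (F : ι → CubeFrame (n + 1))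
      (S : CubeFrame (n + 1)), (∀ a, (F a).key = S.key) →
      μH[n] (frontier (⋃ a, (F a).cube)) ≤ C * ENNReal.ofReal (S.l ^ n) := by
  obtain ⟨C, hC, h⟩ := hausdorff_frontier_le n (ε := (1 / 4) ^ (n + 1)) (by positivity)
  refine ⟨C * (2 * (n + 1 : ℕ) * (n + 1 : ℕ) ^ n), by finiteness, fun ι _ F S hS => ?_⟩
  rcases isEmpty_or_nonempty ι with hι | ⟨⟨a₀⟩⟩
  · simp
  set T := S.shrink (1 / 4) (by norm_num) with hT
  have hTl : T.l = S.l * (1 / 2) := by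
    simp only [T, shrink]
    norm_num
  have hclos (a) : closure T.cube ⊆ (F a).cube :=
    (S.closure_shrink_subset _ (margin_lt _)).trans (core_cube_subset_of_key_eq (hS a).symm)
  have hopen : IsOpen (⋃ a, (F a).cube) := isOpen_iUnion fun a => (F a).isOpen_cube
  have hsub : mClosure (n + 1) T.cube ⊆ ⋃ a, (F a).cube :=
    (mClosure_subset_closure _ _).trans ((hclos a₀).trans (subset_iUnion (fun a => (F a).cube) a₀))
  have h1 := h ι F T.cube T.measurableSet_cube fun a => by
    rw [inter_eq_self_of_subset_left (subset_closure.trans (hclos a)), T.volume_cube, hTl]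
    refine (mul_le_mul_right (volume_le_of_key_eq (hS a)) _).trans ?_
    rw [S.volume_cube]
    have : (2 : ℝ≥0∞) ^ (n + 1) = ENNReal.ofReal (2 ^ (n + 1)) := by
      rw [ENNReal.ofReal_pow zero_le_two]; norm_num
    rw [this, ← ENNReal.ofReal_mul (by positivity), ← ENNReal.ofReal_mul (by positivity),
      ← mul_pow, ← mul_pow]
    refine ENNReal.ofReal_le_ofReal (le_of_eq ?_)
    ring
  have h2 : frontier (⋃ a, (F a).cube) \ mClosure (n + 1) T.cube = frontier (⋃ a, (F a).cube) := by
    refine sdiff_eq_left.2 (disjoint_left.2 fun x hx hx' => ?_)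
    rw [frontier, hopen.interior_eq] at hx
    exact hx.2 (hsub hx')
  rw [h2] at h1
  refine h1.trans ?_
  rw [mul_assoc]
  refine mul_le_mul_right ?_ _
  refine (measure_mono (inter_subset_left.trans (mBoundary_subset_frontier _ _))).trans ?_
  refine T.hausdorff_frontier_cube_le.trans ?_
  refine mul_le_mul_right (ENNReal.ofReal_le_ofReal ?_) _
  refine pow_le_pow_left₀ T.hl.le ?_ n
  rw [hTl]
  linarith [S.hl]

theorem half_l_le_core_l {d : ℕ} (F : CubeFrame d) : F.l / 2 ≤ F.core.l := by
  change F.l / 2 ≤ F.l * (1 - 2 * margin d)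
  nlinarith [F.hl, margin_lt d]

theorem core_isoperimetric (n : ℕ) :
    ∃ C : ℝ≥0∞, C ≠ ⊤ ∧ ∀ (F : CubeFrame (n + 1)) (E : Set (Euc (n + 1))), MeasurableSet E →
      volume F.cube ≤ 2 ^ (n + 2) * volume (E ∩ F.cube) →
      2 * volume (E ∩ F.cube) ≤ volume F.cube →
      ENNReal.ofReal (F.l ^ n) ≤ C * μH[n] (mBoundary (n + 1) E ∩ F.core.cube) := by
  obtain ⟨C, hC, h⟩ := relative_isoperimetric n (κ := (1 / 2) ^ (n + 3)) (by positivity)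
  refine ⟨2 ^ n * C, by finiteness, fun F E hE h1 h2 => ?_⟩
  have hfin := F.volume_cube_ne_top
  have hk : ENNReal.ofReal ((1 / 2 : ℝ) ^ (n + 3)) = (2 ^ (n + 3))⁻¹ := by
    rw [one_div, inv_pow, ENNReal.ofReal_inv_of_pos (by positivity),
      ENNReal.ofReal_pow zero_le_two]
    norm_num
  have hcore := F.volume_diff_core_le
  have hsub := F.core_cube_subset
  have hκ (x y : ℝ≥0∞) (hxy : x ≤ 2 ^ (n + 3) * y) :
      ENNReal.ofReal ((1 / 2 : ℝ) ^ (n + 3)) * x ≤ y := by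
    rw [hk, mul_comm, ← div_eq_mul_inv]
    exact ENNReal.div_le_of_le_mul' hxy
  -- passing to real numbers
  obtain ⟨q, hq⟩ : ∃ q : ℝ≥0, volume F.cube = q := ⟨_, (ENNReal.coe_toNNReal hfin).symm⟩
  have hlt {A : Set (Euc (n + 1))} (hA : A ⊆ F.cube) : ∃ a : ℝ≥0, volume A = a :=
    ⟨_, (ENNReal.coe_toNNReal (measure_ne_top_of_subset hA hfin)).symm⟩
  obtain ⟨a, ha⟩ := hlt (A := E ∩ F.core.cube) (inter_subset_right.trans hsub)
  obtain ⟨b, hb⟩ := hlt (A := F.core.cube \ E) (sdiff_subset.trans hsub)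
  obtain ⟨c, hc⟩ := hlt (A := F.cube \ F.core.cube) sdiff_subset
  obtain ⟨e, he⟩ := hlt (A := E ∩ F.cube) inter_subset_right
  have i1 : volume (E ∩ F.cube) ≤ volume (E ∩ F.core.cube) + volume (F.cube \ F.core.cube) := by
    refine (measure_mono fun x hx => ?_).trans (measure_union_le _ _)
    by_cases h : x ∈ F.core.cube
    · exact Or.inl ⟨hx.1, h⟩
    · exact Or.inr ⟨hx.2, h⟩
  have i2 : volume F.cube ≤ volume (E ∩ F.cube) + volume (F.core.cube \ E) +
      volume (F.cube \ F.core.cube) := by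
    refine (measure_mono fun x hx => ?_).trans ((measure_union_le _ _).trans
      (add_le_add_left (measure_union_le _ _) _))
    by_cases h : x ∈ F.core.cube
    · by_cases h' : x ∈ E
      · exact Or.inl (Or.inl ⟨h', hx⟩)
      · exact Or.inl (Or.inr ⟨h, h'⟩)
    · exact Or.inr ⟨hx, h⟩
  have i3 : volume F.core.cube ≤ volume F.cube := measure_mono hsub
  rw [hq, hc] at hcore
  rw [hq, he] at h1 h2
  rw [he, ha, hc] at i1
  rw [he, hb, hc, hq] at i2
  rw [hq] at i3
  norm_cast at hcore h1 h2 i1 i2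
  have hcore' : (2:ℝ) ^ (n + 1 + 3) * c ≤ q := by exact_mod_cast hcore
  have h1' : (q:ℝ) ≤ 2 ^ (n + 2) * e := by exact_mod_cast h1
  have h2' : (2:ℝ) * e ≤ q := by exact_mod_cast h2
  have i1' : (e:ℝ) ≤ a + c := by exact_mod_cast i1
  have i2' : (q:ℝ) ≤ e + b + c := by exact_mod_cast i2
  rw [show (2:ℝ) ^ (n + 1 + 3) = 2 ^ (n + 2) * 4 by ring] at hcore'
  have hp : (4:ℝ) ≤ 2 ^ (n + 2) := by
    rw [pow_add]
    have : (1 : ℝ) ≤ 2 ^ n := one_le_pow₀ one_le_two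
    linarith
  have hc0 : (0:ℝ) ≤ c := c.2
  have hb0 : (0:ℝ) ≤ b := b.2
  have hq0 : (0:ℝ) ≤ q := q.2
  have h3 := h F.core E hE
    (hκ _ _ (i3.trans (by
      rw [ha]
      have : (q:ℝ) ≤ 2 ^ (n + 3) * a := by
        rw [show (2:ℝ) ^ (n + 3) = 2 ^ (n + 2) * 2 by ring]
        nlinarith
      exact_mod_cast this)))
    (hκ _ _ (i3.trans (by
      rw [hb]
      have : (q:ℝ) ≤ 2 ^ (n + 3) * b := by
        rw [show (2:ℝ) ^ (n + 3) = 2 ^ (n + 2) * 2 by ring]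
        nlinarith
      exact_mod_cast this)))
  rw [mul_assoc]
  refine le_trans ?_ (mul_le_mul_right h3 _)
  have : (2 : ℝ≥0∞) ^ n = ENNReal.ofReal (2 ^ n) := by
    rw [ENNReal.ofReal_pow zero_le_two]; norm_num
  rw [this, ← ENNReal.ofReal_mul (by positivity), ← mul_pow]
  refine ENNReal.ofReal_le_ofReal (pow_le_pow_left₀ F.hl.le ?_ n)
  linarith [F.half_l_le_core_l]

end CubeFrame

theorem exists_representatives {α β : Type*} (s : Finset α) (key : α → β) (v : α → ℝ) :
    ∃ t ⊆ s, InjOn key t ∧ ∀ a ∈ s, ∃ b ∈ t, key b = key a ∧ v a ≤ v b := by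
  classical
  have h : ∀ b ∈ s.image key, ∃ a ∈ s, key a = b ∧ ∀ a' ∈ s, key a' = b → v a' ≤ v a := by
    intro b hb
    obtain ⟨a₀, ha₀, rfl⟩ := Finset.mem_image.1 hb
    obtain ⟨a, ha, hmax⟩ := (s.filter fun a => key a = key a₀).exists_max_image v
      ⟨a₀, Finset.mem_filter.2 ⟨ha₀, rfl⟩⟩
    rw [Finset.mem_filter] at ha
    exact ⟨a, ha.1, ha.2, fun a' h h' => hmax a' (Finset.mem_filter.2 ⟨h, h'⟩)⟩
  rcases s.eq_empty_or_nonempty with rfl | ⟨a₀, -⟩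
  · exact ⟨∅, by simp⟩
  have : Nonempty α := ⟨a₀⟩
  choose! g hg hk hm using h
  refine ⟨(s.image key).image g, ?_, ?_, fun a ha => ?_⟩
  · intro a ha
    obtain ⟨b, hb, rfl⟩ := Finset.mem_image.1 ha
    exact hg b hb
  · intro a ha a' ha' h
    obtain ⟨b, hb, rfl⟩ := Finset.mem_image.1 (Finset.mem_coe.1 ha)
    obtain ⟨b', hb', rfl⟩ := Finset.mem_image.1 (Finset.mem_coe.1 ha')
    rw [hk b hb, hk b' hb'] at h
    rw [h]
  · have hb := Finset.mem_image_of_mem key ha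
    exact ⟨g (key a), Finset.mem_image_of_mem g hb, hk _ hb, hm _ hb a ha rfl⟩

theorem sum_two_zpow_le {ι : Type*} (s : Finset ι) (κ : ι → ℤ) (N : ℕ)
    (hN : ∀ k, (s.filter fun i => κ i = k).card ≤ N) (κ₀ : ℤ) (h : ∀ i ∈ s, κ₀ ≤ κ i) :
    ∑ i ∈ s, (2 : ℝ) ^ (κ₀ - κ i) ≤ 2 * N := by
  set e : ι → ℕ := fun i => (κ i - κ₀).toNat with he
  set M := s.sup e + 1
  have h1 : ∀ i ∈ s, e i ∈ Finset.range M := fun i hi =>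
    Finset.mem_range.2 (Nat.lt_succ_of_le (Finset.le_sup (f := e) hi))
  rw [← Finset.sum_fiberwise_of_maps_to h1]
  calc _ ≤ ∑ j ∈ Finset.range M, (N : ℝ) * (1 / 2) ^ j := by
        refine Finset.sum_le_sum fun j _ => ?_
        have h2 : ∀ i ∈ s.filter fun i => e i = j, (2 : ℝ) ^ (κ₀ - κ i) = (1 / 2) ^ j := by
          intro i hi
          rw [Finset.mem_filter] at hi
          have h3 := h i hi.1
          have h4 : κ₀ - κ i = -(j : ℤ) := by
            have := hi.2
            simp only [e] at this
            omega
          rw [h4, zpow_neg, zpow_natCast, one_div, inv_pow]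
        rw [Finset.sum_congr rfl h2, Finset.sum_const, nsmul_eq_mul]
        refine mul_le_mul_of_nonneg_right ?_ (by positivity)
        refine Nat.cast_le.2 (le_trans (Finset.card_le_card fun i hi => ?_) (hN (κ₀ + j)))
        rw [Finset.mem_filter] at hi ⊢
        have h3 := h i hi.1
        have := hi.2
        simp only [e] at this
        exact ⟨hi.1, by omega⟩
    _ = N * ∑ j ∈ Finset.range M, (1 / 2 : ℝ) ^ j := by rw [Finset.mul_sum]
    _ ≤ N * 2 := by
        gcongr
        exact sum_geometric_two_le M
    _ = _ := mul_comm _ _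

namespace CubeFrame

theorem floor_mem_Icc {a b M : ℝ} (h : |a - b| ≤ M) :
    ⌊a⌋ ∈ Finset.Icc (⌊b⌋ - (⌈M⌉ + 1)) (⌊b⌋ + (⌈M⌉ + 1)) := by
  rw [abs_le] at h
  rw [Finset.mem_Icc]
  have h1 := Int.floor_le a
  have h2 := Int.lt_floor_add_one a
  have h3 := Int.floor_le b
  have h4 := Int.lt_floor_add_one b
  have h5 := Int.le_ceil M
  constructor
  · have : (⌊b⌋ : ℝ) - (⌈M⌉ + 1) < ⌊a⌋ + 1 := by linarith
    have : ⌊b⌋ - (⌈M⌉ + 1) < ⌊a⌋ + 1 := by exact_mod_cast this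
    omega
  · have : (⌊a⌋ : ℝ) < ⌊b⌋ + (⌈M⌉ + 1) := by linarith
    have : ⌊a⌋ < ⌊b⌋ + (⌈M⌉ + 1) := by exact_mod_cast this
    omega

theorem card_le_of_scale_eq (d : ℕ) :
    ∃ N : ℕ, ∀ (ι : Type) (T : Finset ι) (F : ι → CubeFrame d), InjOn (fun i => (F i).key) T →
      ∀ (y : Euc d) (k : ℤ), (∀ i ∈ T, y ∈ (F i).cube) → (∀ i ∈ T, (F i).scale = k) →
      T.card ≤ N := by
  classical
  set M : ℝ := 2 * (d + 1) / mesh d with hM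
  set A : ℤ := ⌈M⌉ + 1 with hA
  set c : ℕ := (2 * A + 1).toNat
  refine ⟨c ^ d * (c ^ d) ^ d, fun ι T F hinj y k hy hk => ?_⟩
  set z : Fin d → ℤ := fun i => ⌊y i / (mesh d * 2 ^ k)⌋
  set P : Finset (ℤ × (Fin d → ℤ) × (Fin d → Fin d → ℤ)) :=
    {k} ×ˢ Fintype.piFinset (fun i => Finset.Icc (z i - A) (z i + A)) ×ˢ
      Fintype.piFinset fun _ => Fintype.piFinset fun _ => Finset.Icc (0 - A) (0 + A) with hP
  have hcard : P.card = c ^ d * (c ^ d) ^ d := by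
    have h1 (z : ℤ) : (Finset.Icc (z - A) (z + A)).card = c := by
      rw [Int.card_Icc]
      congr 1
      ring
    simp only [P, Finset.card_product, Fintype.card_piFinset, h1, Finset.card_singleton, one_mul,
      Finset.prod_const, Finset.card_univ, Fintype.card_fin]
  rw [← hcard]
  refine Finset.card_le_card_of_injOn (fun i => (F i).key) (fun i hi => ?_) hinj
  have hs : 0 < mesh d * 2 ^ k := mul_pos (mesh_pos d) (by positivity)
  have hl : (F i).l < 2 * 2 ^ k := hk i hi ▸ (F i).lt_two_zpow_scale
  have hdiv (a : ℝ) (h : |a| ≤ (d + 1) * (F i).l) : |a / (mesh d * 2 ^ k)| ≤ M := by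
    rw [abs_div, abs_of_pos hs, div_le_iff₀ hs, hM]
    have : 2 * (d + 1) / mesh d * (mesh d * 2 ^ k) = (d + 1) * (2 * 2 ^ k) := by
      have := (mesh_pos d).ne'
      field_simp
    rw [this]
    exact h.trans (mul_le_mul_of_nonneg_left hl.le (by positivity))
  simp only [P, key, Finset.coe_product, mem_prod, Finset.coe_singleton, mem_singleton_iff,
    Finset.mem_coe, Fintype.mem_piFinset, hk i hi, true_and]
  have hl0 := (F i).hl
  refine ⟨fun j => floor_mem_Icc ?_, fun a j => ?_⟩
  · rw [← sub_div]
    refine hdiv _ ?_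
    have h1 := (abs_coord_le_norm (y - (F i).v) j).trans ((F i).norm_sub_v_le (hy i hi))
    rw [PiLp.sub_apply, abs_sub_comm] at h1
    nlinarith
  · rw [← Int.floor_zero (R := ℝ)]
    refine floor_mem_Icc ?_
    rw [sub_zero]
    refine hdiv _ ((abs_coord_le_norm _ j).trans ?_)
    rw [norm_smul, LinearIsometryEquiv.norm_map, Real.norm_of_nonneg hl0.le]
    simp only [PiLp.norm_single, norm_one, mul_one]
    nlinarith [d.cast_nonneg (α := ℝ)]

theorem sum_half_pow_le (d : ℕ) :
    ∃ C : ℝ≥0∞, C ≠ ⊤ ∧ ∀ (ι : Type) (T : Finset ι) (F : ι → CubeFrame d),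
      InjOn (fun i => (F i).key) T → ∀ (y : Euc d) (m : ι → ℕ), (∀ i ∈ T, y ∈ (F i).cube) →
      (∀ i ∈ T, ∀ j ∈ T, margin d * ((F i).l / 2 ^ m i) ≤ d * (F j).l) →
      ∑ i ∈ T, (1 / 2 : ℝ≥0∞) ^ m i ≤ C := by
  obtain ⟨N, hN⟩ := card_le_of_scale_eq d
  refine ⟨ENNReal.ofReal (2 * d / margin d * (2 * N)), ENNReal.ofReal_ne_top,
    fun ι T F hinj y m hy hm => ?_⟩
  rcases T.eq_empty_or_nonempty with rfl | hne
  · simp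
  obtain ⟨j, hj, hmin⟩ := T.exists_min_image (fun i => (F i).scale) hne
  have h1 := sum_two_zpow_le T (fun i => (F i).scale) N (fun k => hN ι _ F
    (hinj.mono fun i hi => (Finset.mem_filter.1 (Finset.mem_coe.1 hi)).1) y k
    (fun i hi => hy i (Finset.mem_filter.1 hi).1)
    fun i hi => (Finset.mem_filter.1 hi).2) (F j).scale hmin
  have hp := margin_pos d
  have h2 : ∀ i ∈ T, (1 / 2 : ℝ≥0∞) ^ m i ≤
      ENNReal.ofReal (2 * d / margin d * 2 ^ ((F j).scale - (F i).scale)) := by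
    intro i hi
    have e : (1 / 2 : ℝ≥0∞) ^ m i = ENNReal.ofReal ((1 / 2) ^ m i) := by
      rw [ENNReal.ofReal_pow (by norm_num), ENNReal.ofReal_div_of_pos two_pos]
      norm_num
    rw [e]
    refine ENNReal.ofReal_le_ofReal ?_
    have h3 := hm i hi j hj
    have h4 := (F i).two_zpow_scale_le
    have h5 := (F j).lt_two_zpow_scale
    rw [zpow_sub₀ two_ne_zero]
    have hpi : (0 : ℝ) < 2 ^ (F i).scale := by positivity
    set x : ℝ := (1 / 2) ^ m i with hx
    have hx0 : 0 < x := by positivity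
    have e2 : (F i).l / 2 ^ m i = (F i).l * x := by
      rw [hx, one_div, inv_pow, div_eq_mul_inv]
    rw [e2] at h3
    rw [div_mul_div_comm, le_div_iff₀ (by positivity)]
    calc x * (margin d * 2 ^ (F i).scale) = margin d * (2 ^ (F i).scale * x) := by ring
      _ ≤ margin d * ((F i).l * x) := by gcongr
      _ ≤ d * (F j).l := h3
      _ ≤ d * (2 * 2 ^ (F j).scale) := by gcongr
      _ = _ := by ring
  refine (Finset.sum_le_sum h2).trans ?_
  rw [← ENNReal.ofReal_sum_of_nonneg fun i _ => by positivity, ← Finset.mul_sum]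
  exact ENNReal.ofReal_le_ofReal (by gcongr)

theorem margin_mul_le {d : ℕ} {R S : CubeFrame d} {y : Euc d} (hyR : y ∈ R.core.cube)
    (hyS : y ∈ S.cube) (h : ¬ S.cube ⊆ R.cube) : margin d * R.l ≤ d * S.l := by
  obtain ⟨z, hzS, hzR⟩ := not_subset.1 h
  refine le_trans ?_ (S.dist_le_of_mem_cube hzS hyS)
  rw [mem_shrink_cube] at hyR
  rw [mem_cube_iff] at hzR
  obtain ⟨i, hi⟩ : ∃ i, ¬ (R.inv z i ∈ Ioo (0 : ℝ) 1) := by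
    by_contra! h'
    exact hzR h'
  have h1 : margin d ≤ |(R.inv z - R.inv y) i| := by
    rw [PiLp.sub_apply]
    by_contra! h'
    rw [abs_lt] at h'
    exact hi ⟨by linarith [(hyR i).1], by linarith [(hyR i).2]⟩
  have h2 := h1.trans (abs_coord_le_norm _ i)
  rw [← dist_eq_norm, dist_inv, ← div_eq_inv_mul, le_div_iff₀ R.hl] at h2
  exact h2

end CubeFrame

namespace CubeFrame

variable {d : ℕ} (F : CubeFrame d)

/-- The stopping rule: a dyadic subcube is stopped at level `t` if its average is at least `t` or
it is not in the family. -/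
def stopAt (𝒬 : Finset (Set (Euc d))) (f : Euc d → ℝ) (t : ℝ) (m : ℕ) (k : Fin d → ℕ) : Prop :=
  t ≤ avg d f (F.sub m k).cube ∨ (F.sub m k).cube ∉ 𝒬

theorem exists_sub_cube_notMem (hd : d ≠ 0) (𝒬 : Finset (Set (Euc d))) :
    ∃ N, ∀ m k, N ≤ m → (F.sub m k).cube ∉ 𝒬 := by
  have h (Q : Set (Euc d)) : ∃ N, ∀ m k, N ≤ m → (F.sub m k).cube ≠ Q := by
    by_cases hQ : ∃ m k, (F.sub m k).cube = Q
    · obtain ⟨m₀, k₀, rfl⟩ := hQ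
      refine ⟨m₀ + 1, fun m k hm he => ?_⟩
      have h1 := congrArg volume he
      rw [volume_cube, volume_cube] at h1
      have h2 : (F.sub m k).l < (F.sub m₀ k₀).l :=
        div_lt_div_of_pos_left F.hl (by positivity) (pow_lt_pow_right₀ one_lt_two (by omega))
      have h3 := pow_lt_pow_left₀ h2 (F.sub m k).hl.le hd
      exact ((ENNReal.ofReal_lt_ofReal_iff (pow_pos (F.sub m₀ k₀).hl d)).2 h3).ne h1
    · push Not at hQ
      exact ⟨0, fun m k _ => hQ m k⟩
  choose N hN using h
  exact ⟨𝒬.sup N, fun m k hm hmem => hN _ m k ((Finset.le_sup hmem).trans hm) rfl⟩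

/-- The levels below the average at which the superlevel set has small density. -/
def lowLevels (f : Euc d → ℝ) : Set ℝ :=
  {a | a ≤ avg d f F.cube ∧ 2 ^ (d + 2) * volume ({x | a ≤ f x} ∩ F.cube) ≤ volume F.cube}

theorem measurableSet_lowLevels (f : Euc d → ℝ) : MeasurableSet (F.lowLevels f) := by
  have h : Antitone fun a : ℝ => 2 ^ (d + 2) * volume ({x | a ≤ f x} ∩ F.cube) := fun a b hab =>
    mul_le_mul_right (measure_mono (inter_subset_inter_left _ fun x hx => hab.trans hx)) _
  exact measurableSet_Iic.inter (h.measurable measurableSet_Iic)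

theorem volume_lowLevels_mul_le (hd : d ≠ 0) (𝒬 : Finset (Set (Euc d))) {f : Euc d → ℝ}
    (hf : Measurable f) (hfi : Integrable f) :
    volume (F.lowLevels f) * volume F.cube ≤
      2 ^ (d + 2) * ∫⁻ t in Ioi (avg d f F.cube),
        volume (F.goodSet f (F.stopAt 𝒬 f) t ∩ F.cube) := by
  obtain ⟨N, hN⟩ := F.exists_sub_cube_notMem hd 𝒬
  set K := 2 ^ (d + 2) * ∫⁻ t in Ioi (avg d f F.cube),
        volume (F.goodSet f (F.stopAt 𝒬 f) t ∩ F.cube) with hK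
  have h1 : ∀ a ∈ F.lowLevels f,
      ENNReal.ofReal (avg d f F.cube - a) * volume F.cube ≤ K := fun a ha =>
    F.ofReal_sub_mul_volume_le hf hfi ha.1 (le_max_left 1 N)
      (fun t m k hm => Or.inr (hN m k ((le_max_right _ _).trans hm))) (fun t m k h => Or.inl h) ha.2
  by_cases hKt : K = ⊤
  · rw [hKt]
    exact le_top
  have h0 := F.volume_cube_ne_zero
  have ht := F.volume_cube_ne_top
  have hB : K / volume F.cube ≠ ⊤ := ENNReal.div_ne_top hKt h0
  rw [← ENNReal.le_div_iff_mul_le (Or.inl h0) (Or.inl ht)]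
  have hsub : F.lowLevels f ⊆
      Icc (avg d f F.cube - (K / volume F.cube).toReal) (avg d f F.cube) := fun a ha => by
    have h2 := h1 a ha
    rw [← ENNReal.le_div_iff_mul_le (Or.inl h0) (Or.inl ht),
      ENNReal.ofReal_le_iff_le_toReal hB] at h2
    exact ⟨by linarith, ha.1⟩
  refine (measure_mono hsub).trans ?_
  rw [Real.volume_Icc, sub_sub_cancel, ENNReal.ofReal_toReal hB]

/-- The core of a dyadic cube if this cube is good, and the empty set otherwise. -/
def goodCore (f : Euc d → ℝ) (halt : ℝ → ℕ → (Fin d → ℕ) → Prop) (t : ℝ)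
    (p : ℕ × (Fin d → ℕ)) : Set (Euc d) :=
  {y | F.goodAt f halt t p.1 p.2 ∧ y ∈ (F.sub p.1 p.2).core.cube}

theorem measurableSet_goodCore (f : Euc d → ℝ) (halt : ℝ → ℕ → (Fin d → ℕ) → Prop) (t : ℝ)
    (p : ℕ × (Fin d → ℕ)) : MeasurableSet (F.goodCore f halt t p) :=
  (MeasurableSet.const _).inter (F.sub p.1 p.2).core.measurableSet_cube

/-- The weighted number of good cubes whose core contains a point. -/
def goodWeight (f : Euc d → ℝ) (halt : ℝ → ℕ → (Fin d → ℕ) → Prop) (t : ℝ) (y : Euc d) : ℝ≥0∞ :=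
  ∑' p : ℕ × (Fin d → ℕ), (F.goodCore f halt t p).indicator (fun _ => (1 / 2) ^ p.1) y

theorem goodWeight_eq_zero {f : Euc d → ℝ} {halt : ℝ → ℕ → (Fin d → ℕ) → Prop} {t : ℝ} {y : Euc d}
    (h : ∀ p, y ∉ F.goodCore f halt t p) : F.goodWeight f halt t y = 0 := by
  simp [goodWeight, h]

theorem goodWeight_eq {f : Euc d → ℝ} {halt : ℝ → ℕ → (Fin d → ℕ) → Prop} {t : ℝ} {y : Euc d}
    {p : ℕ × (Fin d → ℕ)} (h : y ∈ F.goodCore f halt t p) :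
    F.goodWeight f halt t y = (1 / 2) ^ p.1 := by
  rw [goodWeight, tsum_eq_single p, indicator_of_mem h]
  intro q hq
  refine indicator_of_notMem (fun h' => hq ?_) _
  obtain ⟨h1, h2⟩ := F.goodAt_unique h'.1 h.1 (core_cube_subset _ h'.2) (core_cube_subset _ h.2)
  exact Prod.ext h1 h2

end CubeFrame

theorem CubeFrame.volume_goodSet_le (n : ℕ) :
    ∃ C : ℝ≥0∞, C ≠ ⊤ ∧ ∀ (F : CubeFrame (n + 1)) (f : Euc (n + 1) → ℝ) (_ : Measurable f)
      (halt : ℝ → ℕ → (Fin (n + 1) → ℕ) → Prop) (t : ℝ),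
      ENNReal.ofReal (1 / F.l) * volume (F.goodSet f halt t) ≤
        C * ∫⁻ y in mBoundary (n + 1) {x | t ≤ f x}, F.goodWeight f halt t y ∂μH[n] := by
  obtain ⟨C, hC, h⟩ := core_isoperimetric n
  refine ⟨C, hC, fun F f hf halt t => ?_⟩
  set E := {x | t ≤ f x} with hE
  have hEm : MeasurableSet E := measurableSet_le measurable_const hf
  set A : ℕ × (Fin (n + 1) → ℕ) → Set (Euc (n + 1)) := fun p =>
    {y | F.goodAt f halt t p.1 p.2 ∧ y ∈ (F.sub p.1 p.2).cube}
  have h1 : F.goodSet f halt t ⊆ ⋃ p, A p := by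
    intro y hy
    simp only [goodSet, mem_iUnion] at hy
    obtain ⟨m, k, hg, hy⟩ := hy
    exact mem_iUnion.2 ⟨(m, k), hg, hy.2⟩
  have h2 (p : ℕ × (Fin (n + 1) → ℕ)) : ENNReal.ofReal (1 / F.l) * volume (A p) ≤
      C * ((1 / 2) ^ p.1 * μH[n] (F.goodCore f halt t p ∩ mBoundary (n + 1) E)) := by
    by_cases hp : F.goodAt f halt t p.1 p.2
    · have e1 : A p = (F.sub p.1 p.2).cube := by
        ext y
        exact and_iff_right hp
      have e2 : F.goodCore f halt t p = (F.sub p.1 p.2).core.cube := by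
        ext y
        exact and_iff_right hp
      rw [e1, e2, inter_comm, mul_left_comm]
      have h3 := h (F.sub p.1 p.2) E hEm hp.2.1.2.le hp.2.2.2
      refine le_trans (le_of_eq ?_) (mul_le_mul_right h3 _)
      have e3 : (1 / 2 : ℝ≥0∞) ^ p.1 = ENNReal.ofReal ((1 / 2) ^ p.1) := by
        rw [ENNReal.ofReal_pow (by norm_num), ENNReal.ofReal_div_of_pos two_pos]
        norm_num
      have hl := F.hl
      rw [volume_cube, e3, ← ENNReal.ofReal_mul (by positivity), ← ENNReal.ofReal_mul (by positivity)]
      congr 1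
      have e4 : (F.sub p.1 p.2).l = F.l * (1 / 2) ^ p.1 := by
        simp [sub, div_eq_mul_inv]
      rw [e4]
      have hl' := hl.ne'
      field_simp
      ring
    · have e1 : A p = ∅ := by
        ext y
        simp [A, hp]
      rw [e1, measure_empty, mul_zero]
      exact zero_le
  calc _ ≤ ENNReal.ofReal (1 / F.l) * ∑' p, volume (A p) :=
        mul_le_mul_right ((measure_mono h1).trans (measure_iUnion_le _)) _
    _ = ∑' p, ENNReal.ofReal (1 / F.l) * volume (A p) := ENNReal.tsum_mul_left.symm
    _ ≤ ∑' p, C * ((1 / 2) ^ p.1 * μH[n] (F.goodCore f halt t p ∩ mBoundary (n + 1) E)) :=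
        ENNReal.tsum_le_tsum h2
    _ = C * ∑' p, ((1 / 2) ^ p.1 * μH[n] (F.goodCore f halt t p ∩ mBoundary (n + 1) E)) :=
        ENNReal.tsum_mul_left
    _ = _ := by
        congr 1
        unfold goodWeight
        rw [lintegral_tsum fun p => (measurable_const.indicator
          (F.measurableSet_goodCore f halt t p)).aemeasurable]
        refine tsum_congr fun p => ?_
        rw [lintegral_indicator_const (F.measurableSet_goodCore f halt t p),
          Measure.restrict_apply (F.measurableSet_goodCore f halt t p)]

/-- The average over `Q` exceeds the averages over all larger cubes of the family. -/
def IsRecord {d : ℕ} (𝒬 : Finset (Set (Euc d))) (f : Euc d → ℝ) (Q : Set (Euc d)) : Prop :=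
  ∀ P ∈ 𝒬, Q ⊂ P → avg d f P < avg d f Q

namespace CubeFrame

theorem not_subset_of_goodAt {d : ℕ} {𝒬 : Finset (Set (Euc d))} (hc : DyadicComplete d ↑𝒬)
    {f : Euc d → ℝ} {F : CubeFrame d} (hF : F.cube ∈ 𝒬) {t : ℝ} {m : ℕ} {k : Fin d → ℕ}
    (hg : F.goodAt f (F.stopAt 𝒬 f) t m k) {Q : Set (Euc d)} (hQ : Q ∈ 𝒬)
    (hr : IsRecord 𝒬 f Q) (ht : avg d f Q < t) : ¬ Q ⊆ (F.sub m k).cube := by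
  intro hsub
  obtain ⟨m', k', hk', hs, hsub'⟩ := F.exists_stop_of_ancStop hg.1 hg.2.1.1
  have h1 : Q ⊆ (F.sub m' k').cube := hsub.trans hsub'
  have h2 : (F.sub m' k').cube ∈ 𝒬 :=
    hc F.cube hF Q hQ (h1.trans (F.sub_cube_subset hk')) _ (F.isDyadicOf_sub hk') h1
  rcases hs with hs | hs
  · rcases h1.eq_or_ssubset with h | h
    · rw [h] at ht
      exact ht.not_ge hs
    · exact ((hr _ h2 h).trans ht).not_ge hs
  · exact hs h2

theorem sum_goodWeight_le (d : ℕ) :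
    ∃ C : ℝ≥0∞, C ≠ ⊤ ∧ ∀ (𝒬 : Finset (Set (Euc d))) (_ : DyadicComplete d ↑𝒬)
      (f : Euc d → ℝ) (F : Set (Euc d) → CubeFrame d) (_ : ∀ Q ∈ 𝒬, (F Q).cube = Q)
      (T : Finset (Set (Euc d))) (_ : T ⊆ 𝒬) (_ : ∀ Q ∈ T, IsRecord 𝒬 f Q)
      (_ : InjOn (fun Q => (F Q).key) T) (t : ℝ) (_ : ∀ Q ∈ T, avg d f Q < t) (y : Euc d),
      ∑ Q ∈ T, (F Q).goodWeight f ((F Q).stopAt 𝒬 f) t y ≤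
        (⋃₀ (𝒬 : Set (Set (Euc d)))).indicator (fun _ => C) y := by
  classical
  obtain ⟨C, hC, h⟩ := sum_half_pow_le d
  refine ⟨C, hC, fun 𝒬 hc f F hF T hT hr hinj t ht y => ?_⟩
  set T' := T.filter fun Q => ∃ p, y ∈ (F Q).goodCore f ((F Q).stopAt 𝒬 f) t p with hT'
  have hmem {Q : Set (Euc d)} (hQ : Q ∈ T') :
      Q ∈ T ∧ ∃ p, y ∈ (F Q).goodCore f ((F Q).stopAt 𝒬 f) t p := Finset.mem_filter.1 hQ
  have h1 : ∑ Q ∈ T, (F Q).goodWeight f ((F Q).stopAt 𝒬 f) t y =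
      ∑ Q ∈ T', (F Q).goodWeight f ((F Q).stopAt 𝒬 f) t y := by
    refine (Finset.sum_subset (Finset.filter_subset _ _) fun Q hQ hQ' => ?_).symm
    refine goodWeight_eq_zero _ fun p hp => hQ' (Finset.mem_filter.2 ⟨hQ, p, hp⟩)
  have h2 : ∀ Q ∈ T', ∃ p, y ∈ (F Q).goodCore f ((F Q).stopAt 𝒬 f) t p := fun Q hQ => (hmem hQ).2
  choose! p hp using h2
  have hyQ : ∀ Q ∈ T', y ∈ (F Q).cube := fun Q hQ =>
    (F Q).sub_cube_subset (hp Q hQ).1.1 (core_cube_subset _ (hp Q hQ).2)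
  rw [h1]
  by_cases hy : y ∈ ⋃₀ (𝒬 : Set (Set (Euc d)))
  · rw [indicator_of_mem hy]
    calc _ = ∑ Q ∈ T', (1 / 2 : ℝ≥0∞) ^ (p Q).1 :=
          Finset.sum_congr rfl fun Q hQ => goodWeight_eq _ (hp Q hQ)
      _ ≤ C := by
        refine h _ T' F (hinj.mono fun Q hQ => (hmem (Finset.mem_coe.1 hQ)).1) y (fun Q => (p Q).1)
          hyQ fun Q hQ Q' hQ' => ?_
        have hQ₀ := hF Q (hT (hmem hQ).1)
        have hQ'₀ := hF Q' (hT (hmem hQ').1)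
        refine margin_mul_le (R := (F Q).sub (p Q).1 (p Q).2) (hp Q hQ).2 (hyQ Q' hQ') ?_
        rw [hQ'₀]
        exact not_subset_of_goodAt hc (hQ₀.symm ▸ hT (hmem hQ).1) (hp Q hQ).1 (hT (hmem hQ').1)
          (hr _ (hmem hQ').1) (ht _ (hmem hQ').1)
  · have : T' = ∅ := Finset.eq_empty_of_forall_notMem fun Q hQ => hy
      ⟨Q, hT (hmem hQ).1, (hF Q (hT (hmem hQ).1)) ▸ hyQ Q hQ⟩
    rw [this, Finset.sum_empty]
    exact zero_le

theorem sum_volume_goodSet_le (n : ℕ) :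
    ∃ C : ℝ≥0∞, C ≠ ⊤ ∧ ∀ (𝒬 : Finset (Set (Euc (n + 1)))) (_ : DyadicComplete (n + 1) ↑𝒬)
      (f : Euc (n + 1) → ℝ) (_ : Measurable f) (F : Set (Euc (n + 1)) → CubeFrame (n + 1))
      (_ : ∀ Q ∈ 𝒬, (F Q).cube = Q)
      (T : Finset (Set (Euc (n + 1)))) (_ : T ⊆ 𝒬) (_ : ∀ Q ∈ T, IsRecord 𝒬 f Q)
      (_ : InjOn (fun Q => (F Q).key) T) (t : ℝ),
      ∑ Q ∈ T, (Ioi (avg (n + 1) f Q)).indicator (fun t => ENNReal.ofReal (1 / (F Q).l) *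
          volume ((F Q).goodSet f ((F Q).stopAt 𝒬 f) t)) t ≤
        C * μH[n] (mBoundary (n + 1) {x | t ≤ f x} ∩ ⋃₀ ↑𝒬) := by
  classical
  obtain ⟨C₁, hC₁, h₁⟩ := volume_goodSet_le n
  obtain ⟨C₂, hC₂, h₂⟩ := sum_goodWeight_le (n + 1)
  refine ⟨C₁ * C₂, by finiteness, fun 𝒬 hc f hf F hF T hT hr hinj t => ?_⟩
  set T' := T.filter fun Q => avg (n + 1) f Q < t with hT'
  set E := {x | t ≤ f x} with hE
  have hopen : IsOpen (⋃₀ (𝒬 : Set (Set (Euc (n + 1))))) :=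
    isOpen_sUnion fun Q hQ => hF Q hQ ▸ (F Q).isOpen_cube
  calc _ = ∑ Q ∈ T', ENNReal.ofReal (1 / (F Q).l) *
          volume ((F Q).goodSet f ((F Q).stopAt 𝒬 f) t) := by
        rw [hT', Finset.sum_filter]
        exact Finset.sum_congr rfl fun Q _ => by simp [indicator]
    _ ≤ ∑ Q ∈ T', C₁ * ∫⁻ y in mBoundary (n + 1) E,
          (F Q).goodWeight f ((F Q).stopAt 𝒬 f) t y ∂μH[n] :=
        Finset.sum_le_sum fun Q _ => h₁ (F Q) f hf _ t
    _ = C₁ * ∑ Q ∈ T', ∫⁻ y in mBoundary (n + 1) E,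
          (F Q).goodWeight f ((F Q).stopAt 𝒬 f) t y ∂μH[n] := by rw [Finset.mul_sum]
    _ ≤ C₁ * ∫⁻ y in mBoundary (n + 1) E, ∑ Q ∈ T',
          (F Q).goodWeight f ((F Q).stopAt 𝒬 f) t y ∂μH[n] :=
        mul_le_mul_right (sum_lintegral_le _ _ _) _
    _ ≤ C₁ * ∫⁻ y in mBoundary (n + 1) E,
          (⋃₀ (𝒬 : Set (Set (Euc (n + 1))))).indicator (fun _ => C₂) y ∂μH[n] := by
        refine mul_le_mul_right (lintegral_mono fun y => ?_) _
        exact h₂ 𝒬 hc f F hF T' ((Finset.filter_subset _ _).trans hT)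
          (fun Q hQ => hr Q (Finset.mem_filter.1 hQ).1)
          (hinj.mono fun Q hQ => (Finset.mem_filter.1 (Finset.mem_coe.1 hQ)).1) t
          (fun Q hQ => (Finset.mem_filter.1 hQ).2) y
    _ = _ := by
        rw [lintegral_indicator_const hopen.measurableSet,
          Measure.restrict_apply hopen.measurableSet, inter_comm, mul_assoc]

end CubeFrame

theorem frontier_biUnion_finset_subset {X ι : Type*} [TopologicalSpace X] (s : Finset ι)
    (V : ι → Set X) : frontier (⋃ i ∈ s, V i) ⊆ ⋃ i ∈ s, frontier (V i) := by
  classical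
  induction s using Finset.induction_on with
  | empty => simp
  | insert i s hi ih =>
    rw [Finset.set_biUnion_insert, Finset.set_biUnion_insert]
    refine (frontier_union_subset _ _).trans (union_subset_union inter_subset_left ?_)
    exact inter_subset_right.trans ih

theorem exists_isRecord_superset {d : ℕ} {𝒬 : Finset (Set (Euc d))} {f : Euc d → ℝ} {t : ℝ}
    {Q : Set (Euc d)} (hQ : Q ∈ 𝒬) (ht : t ≤ avg d f Q) :
    ∃ P ∈ 𝒬, IsRecord 𝒬 f P ∧ t ≤ avg d f P ∧ Q ⊆ P := by
  classical
  obtain ⟨P, hQP, hP⟩ := (𝒬.filter fun Q => t ≤ avg d f Q).exists_le_maximal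
    (Finset.mem_filter.2 ⟨hQ, ht⟩)
  have hP' := Finset.mem_filter.1 hP.prop
  refine ⟨P, hP'.1, fun P' hP'₀ hlt => ?_, hP'.2, hQP⟩
  by_contra! hle
  exact hP.not_gt (Finset.mem_filter.2 ⟨hP'₀, hP'.2.trans hle⟩) hlt

namespace CubeFrame

theorem mem_lowLevels {d : ℕ} {F G : CubeFrame d} (h : F.key = G.key) {f : Euc d → ℝ} {t : ℝ}
    (ht : t ≤ avg d f G.cube)
    (hlow : 2 ^ (2 * d + 3) * volume ({x | t ≤ f x} ∩ F.cube) ≤ volume F.cube) :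
    t ∈ G.lowLevels f := by
  refine ⟨ht, ?_⟩
  set E := {x | t ≤ f x}
  have h1 : volume (E ∩ G.cube) ≤ volume (E ∩ F.cube) + volume (G.cube \ G.core.cube) := by
    refine (measure_mono fun x hx => ?_).trans (measure_union_le _ _)
    by_cases hx' : x ∈ G.core.cube
    · exact Or.inl ⟨hx.1, core_cube_subset_of_key_eq h.symm hx'⟩
    · exact Or.inr ⟨hx.2, hx'⟩
  have h2 : 2 ^ (d + 3) * volume (E ∩ F.cube) ≤ volume G.cube := by
    have h3 := hlow.trans (volume_le_of_key_eq h)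
    rw [show 2 * d + 3 = d + (d + 3) by ring, pow_add, mul_assoc] at h3
    exact (ENNReal.mul_le_mul_iff_right (by positivity) (by finiteness)).1 h3
  have h4 : 2 * (2 ^ (d + 2) * volume (E ∩ G.cube)) ≤ 2 * volume G.cube := by
    calc _ = 2 ^ (d + 3) * volume (E ∩ G.cube) := by ring
      _ ≤ 2 ^ (d + 3) * (volume (E ∩ F.cube) + volume (G.cube \ G.core.cube)) := by gcongr
      _ ≤ volume G.cube + volume G.cube := by
        rw [mul_add]
        exact add_le_add h2 G.volume_diff_core_le
      _ = _ := (two_mul _).symm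
  exact (ENNReal.mul_le_mul_iff_right two_ne_zero ENNReal.ofNat_ne_top).1 h4

theorem hausdorff_frontier_superlevel_le (n : ℕ) :
    ∃ C : ℝ≥0∞, C ≠ ⊤ ∧ ∀ (𝒬 : Finset (Set (Euc (n + 1))))
      (F : Set (Euc (n + 1)) → CubeFrame (n + 1)) (_ : ∀ Q ∈ 𝒬, (F Q).cube = Q)
      (f : Euc (n + 1) → ℝ) (_ : Measurable f) (T : Finset (Set (Euc (n + 1)))) (_ : T ⊆ 𝒬)
      (_ : InjOn (fun Q => (F Q).key) T)
      (_ : ∀ Q ∈ 𝒬, IsRecord 𝒬 f Q →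
        ∃ S ∈ T, (F S).key = (F Q).key ∧ avg (n + 1) f Q ≤ avg (n + 1) f S) (t : ℝ),
      μH[n] (frontier (⋃₀ {Q | Q ∈ 𝒬 ∧ t ≤ avg (n + 1) f Q}) \ mClosure (n + 1) {x | t ≤ f x}) ≤
        C * μH[n] (mBoundary (n + 1) {x | t ≤ f x} ∩ ⋃₀ ↑𝒬) +
        ∑ S ∈ T, ((F S).lowLevels f).indicator (fun _ => C * ENNReal.ofReal ((F S).l ^ n)) t := by
  classical
  obtain ⟨C₁, hC₁, h₁⟩ := hausdorff_frontier_le n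
    (ε := (1 / 2) ^ (2 * (n + 1) + 3)) (by positivity)
  obtain ⟨C₂, hC₂, h₂⟩ := hausdorff_frontier_class_le n
  refine ⟨max C₁ C₂, by simp [hC₁, hC₂], fun 𝒬 F hF f hf T hT hinj hrep t => ?_⟩
  set E := {x | t ≤ f x} with hE
  have hEm : MeasurableSet E := measurableSet_le measurable_const hf
  have hε : ENNReal.ofReal ((1 / 2 : ℝ) ^ (2 * (n + 1) + 3)) = (2 ^ (2 * (n + 1) + 3))⁻¹ := by
    rw [one_div, inv_pow, ENNReal.ofReal_inv_of_pos (by positivity),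
      ENNReal.ofReal_pow zero_le_two]
    norm_num
  set L := 𝒬.filter fun Q => IsRecord 𝒬 f Q ∧ t ≤ avg (n + 1) f Q with hL
  set lo : Set (Euc (n + 1)) → Prop := fun Q =>
    2 ^ (2 * (n + 1) + 3) * volume (E ∩ Q) ≤ volume Q with hlo
  set A := L.filter fun Q => ¬ lo Q with hA
  set B : Set (Euc (n + 1)) → Finset (Set (Euc (n + 1))) := fun S =>
    L.filter fun Q => lo Q ∧ (F Q).key = (F S).key with hB
  set VA : Set (Euc (n + 1)) := ⋃ Q : A, (F Q).cube with hVA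
  set VB : Set (Euc (n + 1)) → Set (Euc (n + 1)) := fun S => ⋃ Q : B S, (F Q).cube with hVB
  have hLmem {Q : Set (Euc (n + 1))} (hQ : Q ∈ L) :
      Q ∈ 𝒬 ∧ IsRecord 𝒬 f Q ∧ t ≤ avg (n + 1) f Q := Finset.mem_filter.1 hQ
  have hcube {Q : Set (Euc (n + 1))} (hQ : Q ∈ L) : (F Q).cube = Q := hF Q (hLmem hQ).1
  have hU : ⋃₀ {Q | Q ∈ 𝒬 ∧ t ≤ avg (n + 1) f Q} = VA ∪ ⋃ S ∈ T, VB S := by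
    refine Subset.antisymm (sUnion_subset fun Q hQ => ?_) ?_
    · obtain ⟨P, hP, hPr, hPt, hQP⟩ := exists_isRecord_superset hQ.1 hQ.2
      have hPL : P ∈ L := Finset.mem_filter.2 ⟨hP, hPr, hPt⟩
      refine hQP.trans ?_
      by_cases hl : lo P
      · obtain ⟨S, hS, hk, -⟩ := hrep P hP hPr
        refine subset_union_of_subset_right ?_ _
        refine subset_trans ?_ (subset_biUnion_of_mem (u := VB) (Finset.mem_coe.2 hS))
        have hPB : P ∈ B S := Finset.mem_filter.2 ⟨hPL, hl, hk.symm⟩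
        conv_lhs => rw [← hcube hPL]
        exact subset_iUnion (fun Q : B S => (F Q).cube) ⟨P, hPB⟩
      · refine subset_union_of_subset_left ?_ _
        have hPA : P ∈ A := Finset.mem_filter.2 ⟨hPL, hl⟩
        conv_lhs => rw [← hcube hPL]
        exact subset_iUnion (fun Q : A => (F Q).cube) ⟨P, hPA⟩
    · have hsub {Q : Set (Euc (n + 1))} (hQ : Q ∈ L) :
          (F Q).cube ⊆ ⋃₀ {Q | Q ∈ 𝒬 ∧ t ≤ avg (n + 1) f Q} := by
        rw [hcube hQ]
        exact subset_sUnion_of_mem ⟨(hLmem hQ).1, (hLmem hQ).2.2⟩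
      refine union_subset (iUnion_subset fun Q => ?_) (iUnion₂_subset fun S _ =>
        iUnion_subset fun Q => ?_)
      · exact hsub (Finset.mem_filter.1 Q.2).1
      · exact hsub (Finset.mem_filter.1 Q.2).1
  have hVA𝒬 : VA ⊆ ⋃₀ (𝒬 : Set (Set (Euc (n + 1)))) := iUnion_subset fun Q => by
    have hQ := (Finset.mem_filter.1 Q.2).1
    rw [hcube hQ]
    exact subset_sUnion_of_mem (hLmem hQ).1
  have hfr : frontier (⋃₀ {Q | Q ∈ 𝒬 ∧ t ≤ avg (n + 1) f Q}) \ mClosure (n + 1) E ⊆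
      (frontier VA \ mClosure (n + 1) E) ∪ ⋃ S ∈ T, frontier (VB S) := by
    rw [hU]
    rintro x ⟨hx, hxE⟩
    rcases frontier_union_subset _ _ hx with h | h
    · exact Or.inl ⟨h.1, hxE⟩
    · exact Or.inr (frontier_biUnion_finset_subset T VB h.2)
  have hhigh : μH[n] (frontier VA \ mClosure (n + 1) E) ≤
      C₁ * μH[n] (mBoundary (n + 1) E ∩ VA) := by
    refine h₁ A (fun Q => F Q) E hEm fun Q => ?_
    have hQ := Finset.mem_filter.1 Q.2
    have h3 := hQ.2
    simp only [lo, not_le] at h3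
    rw [hcube hQ.1, hε, mul_comm, ← div_eq_mul_inv]
    exact ENNReal.div_le_of_le_mul' h3.le
  have hlow (S : Set (Euc (n + 1))) (hS : S ∈ T) : μH[n] (frontier (VB S)) ≤
      ((F S).lowLevels f).indicator (fun _ => max C₁ C₂ * ENNReal.ofReal ((F S).l ^ n)) t := by
    by_cases htS : t ∈ (F S).lowLevels f
    · rw [indicator_of_mem htS]
      refine (h₂ (B S) (fun Q => F Q) (F S) fun Q => (Finset.mem_filter.1 Q.2).2.2).trans ?_
      exact mul_le_mul_left (le_max_right _ _) _
    · have hempty : VB S = ∅ := by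
        refine iUnion_eq_empty.2 fun Q => (htS ?_).elim
        obtain ⟨hQL, hQlo, hQk⟩ := Finset.mem_filter.1 Q.2
        obtain ⟨S', hS', hk', hav⟩ := hrep _ (hLmem hQL).1 (hLmem hQL).2.1
        have : S' = S := hinj hS' hS (hk'.trans hQk)
        subst this
        refine mem_lowLevels hQk ?_ ?_
        · rw [hF S' (hT hS')]
          exact (hLmem hQL).2.2.trans hav
        · rw [hcube hQL]
          exact hQlo
      rw [hempty, frontier_empty, measure_empty]
      exact zero_le
  calc _ ≤ _ := measure_mono hfr
    _ ≤ _ := measure_union_le _ _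
    _ ≤ _ := by
      refine add_le_add (hhigh.trans ?_) ?_
      · gcongr
        exact le_max_left _ _
      · exact (measure_biUnion_finset_le _ _).trans (Finset.sum_le_sum hlow)

end CubeFrame

theorem CubeFrame.lintegral_lowLevels_le (n : ℕ) :
    ∃ C : ℝ≥0∞, C ≠ ⊤ ∧ ∀ (𝒬 : Finset (Set (Euc (n + 1)))) (_ : DyadicComplete (n + 1) ↑𝒬)
      (f : Euc (n + 1) → ℝ) (_ : Measurable f) (_ : Integrable f)
      (F : Set (Euc (n + 1)) → CubeFrame (n + 1)) (_ : ∀ Q ∈ 𝒬, (F Q).cube = Q)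
      (T : Finset (Set (Euc (n + 1)))) (_ : T ⊆ 𝒬) (_ : ∀ Q ∈ T, IsRecord 𝒬 f Q)
      (_ : InjOn (fun Q => (F Q).key) T),
      ∑ S ∈ T, ENNReal.ofReal ((F S).l ^ n) * volume ((F S).lowLevels f) ≤
        C * ∫⁻ t : ℝ, μH[n] (mBoundary (n + 1) {x | t ≤ f x} ∩ ⋃₀ ↑𝒬) := by
  obtain ⟨C, hC, h⟩ := sum_volume_goodSet_le n
  refine ⟨2 ^ (n + 1 + 2) * C, by finiteness, fun 𝒬 hc f hf hfi F hF T hT hr hinj => ?_⟩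
  set g : Set (Euc (n + 1)) → ℝ → ℝ≥0∞ := fun Q =>
    (Ioi (avg (n + 1) f Q)).indicator (fun t => ENNReal.ofReal (1 / (F Q).l) *
      volume ((F Q).goodSet f ((F Q).stopAt 𝒬 f) t)) with hg
  have h1 (S : Set (Euc (n + 1))) (hS : S ∈ T) :
      ENNReal.ofReal ((F S).l ^ n) * volume ((F S).lowLevels f) ≤
        2 ^ (n + 1 + 2) * ∫⁻ t, g S t := by
    have h2 := (F S).volume_lowLevels_mul_le n.succ_ne_zero 𝒬 hf hfi
    have hl := (F S).hl
    have e : ENNReal.ofReal ((F S).l ^ n) =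
        ENNReal.ofReal (1 / (F S).l) * volume (F S).cube := by
      rw [volume_cube, ← ENNReal.ofReal_mul (by positivity)]
      congr 1
      field_simp
      ring
    rw [e, mul_assoc, mul_comm (volume (F S).cube)]
    refine (mul_le_mul_right h2 _).trans ?_
    rw [mul_left_comm]
    refine mul_le_mul_right ?_ _
    simp only [g]
    rw [lintegral_indicator measurableSet_Ioi, ← lintegral_const_mul' _ _ ENNReal.ofReal_ne_top,
      hF S (hT hS)]
    gcongr
    exact inter_subset_left
  calc _ ≤ ∑ S ∈ T, 2 ^ (n + 1 + 2) * ∫⁻ t, g S t := Finset.sum_le_sum h1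
    _ = 2 ^ (n + 1 + 2) * ∑ S ∈ T, ∫⁻ t, g S t := by rw [Finset.mul_sum]
    _ ≤ 2 ^ (n + 1 + 2) * ∫⁻ t, ∑ S ∈ T, g S t := mul_le_mul_right (sum_lintegral_le _ _ _) _
    _ ≤ 2 ^ (n + 1 + 2) * ∫⁻ t, C * μH[n] (mBoundary (n + 1) {x | t ≤ f x} ∩ ⋃₀ ↑𝒬) :=
      mul_le_mul_right (lintegral_mono fun t => h 𝒬 hc f hf F hF T hT hr hinj t) _
    _ = _ := by rw [lintegral_const_mul' _ _ hC, mul_assoc]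

theorem lintegral_hausdorff_frontier_le_of_measurable (n : ℕ) :
    ∃ C : ℝ≥0∞, C ≠ ⊤ ∧ ∀ 𝒬 : Finset (Set (Euc (n + 1))), (∀ Q ∈ 𝒬, IsCube (n + 1) Q) →
      DyadicComplete (n + 1) ↑𝒬 → ∀ f : Euc (n + 1) → ℝ, Measurable f → Integrable f →
      ∫⁻ t : ℝ, μH[n] (frontier (⋃₀ {Q | Q ∈ 𝒬 ∧ t ≤ avg (n + 1) f Q}) \
          mClosure (n + 1) {x | t ≤ f x}) ≤
        C * ∫⁻ t : ℝ, μH[n] (mBoundary (n + 1) {x | t ≤ f x} ∩ ⋃₀ ↑𝒬) := by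
  classical
  obtain ⟨C₁, hC₁, h₁⟩ := CubeFrame.hausdorff_frontier_superlevel_le n
  obtain ⟨C₂, hC₂, h₂⟩ := CubeFrame.lintegral_lowLevels_le n
  refine ⟨C₁ + C₁ * C₂, by finiteness, fun 𝒬 hQ hc f hf hfi => ?_⟩
  have hframe (Q : Set (Euc (n + 1))) : ∃ F : CubeFrame (n + 1), Q ∈ 𝒬 → F.cube = Q := by
    by_cases h : Q ∈ 𝒬
    · obtain ⟨F, hF⟩ := isCube_iff_exists_frame.1 (hQ Q h)
      exact ⟨F, fun _ => hF.symm⟩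
    · exact ⟨⟨1, one_pos, .refl ℝ _, 0⟩, fun h' => (h h').elim⟩
  choose F hF using hframe
  obtain ⟨T, hT, hinj, hrep⟩ := exists_representatives (𝒬.filter fun Q => IsRecord 𝒬 f Q)
    (fun Q => (F Q).key) (avg (n + 1) f)
  have hT𝒬 : T ⊆ 𝒬 := hT.trans (Finset.filter_subset _ _)
  have hTr : ∀ Q ∈ T, IsRecord 𝒬 f Q := fun Q h => (Finset.mem_filter.1 (hT h)).2
  have h3 := h₁ 𝒬 F hF f hf T hT𝒬 hinj fun Q h h' => hrep Q (Finset.mem_filter.2 ⟨h, h'⟩)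
  have h4 := h₂ 𝒬 hc f hf hfi F hF T hT𝒬 hTr hinj
  have hmeas (S : Set (Euc (n + 1))) : Measurable (((F S).lowLevels f).indicator
      fun _ : ℝ => C₁ * ENNReal.ofReal ((F S).l ^ n)) :=
    measurable_const.indicator ((F S).measurableSet_lowLevels f)
  refine (lintegral_mono h3).trans ?_
  rw [lintegral_add_right _ (Finset.measurable_sum _ fun S _ => hmeas S),
    lintegral_const_mul' _ _ hC₁, lintegral_finsetSum _ fun S _ => hmeas S, add_mul, mul_assoc]
  refine add_le_add le_rfl (le_trans (le_of_eq ?_) (mul_le_mul_right h4 _))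
  rw [Finset.mul_sum]
  refine Finset.sum_congr rfl fun S _ => ?_
  rw [lintegral_indicator_const ((F S).measurableSet_lowLevels f), mul_assoc]

theorem avg_congr_ae {d : ℕ} {f g : Euc d → ℝ} (h : f =ᵐ[volume] g) (Q : Set (Euc d)) :
    avg d f Q = avg d g Q := by
  rw [avg, avg, integral_congr_ae (ae_restrict_of_ae h)]

theorem superlevel_congr_ae {d : ℕ} {f g : Euc d → ℝ} (h : f =ᵐ[volume] g) (t : ℝ) :
    ({x | t ≤ f x} : Set (Euc d)) =ᵐ[volume] {x | t ≤ g x} := by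
  filter_upwards [h] with x hx
  change (t ≤ f x) = (t ≤ g x)
  rw [hx]

/-- for a finite, dyadically complete set of cubes `𝒬` and `f ∈ L¹(ℝ^d)`
with `var_{⋃𝒬} f < ∞`, with `𝒬^λ = {Q ∈ 𝒬 : f_Q ≥ λ}`,
`∫ H^{d-1}(∂(⋃𝒬^λ) \ cl*{f ≥ λ}) dλ ≤ C_d ∫ H^{d-1}(∂*{f ≥ λ} ∩ ⋃𝒬) dλ`. -/
theorem stmt1 (d : ℕ) (hd : 1 ≤ d) :
    ∃ C : ℝ, 0 < C ∧ ∀ (𝒬 : Finset (Set (Euc d))),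
      (∀ Q ∈ 𝒬, IsCube d Q) → DyadicComplete d ↑𝒬 →
      ∀ f : Euc d → ℝ, Integrable f volume → variation d (⋃₀ ↑𝒬) f < ⊤ →
      ∫⁻ t : ℝ,
          μH[(d:ℝ)-1] (frontier (⋃₀ {Q | Q ∈ 𝒬 ∧ t ≤ avg d f Q}) \ mClosure d {x | t ≤ f x})
        ≤ ENNReal.ofReal C *
          ∫⁻ t : ℝ, μH[(d:ℝ)-1] (mBoundary d {x | t ≤ f x} ∩ ⋃₀ ↑𝒬) := by
  obtain ⟨n, rfl⟩ : ∃ n, d = n + 1 := ⟨d - 1, by omega⟩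
  obtain ⟨C, hC, h⟩ := lintegral_hausdorff_frontier_le_of_measurable n
  refine ⟨C.toReal + 1, by positivity, fun 𝒬 hQ hc f hf _ => ?_⟩
  have hae := hf.aestronglyMeasurable.aemeasurable.ae_eq_mk
  have hg := hf.aestronglyMeasurable.aemeasurable.measurable_mk
  have h1 := h 𝒬 hQ hc _ hg (hf.congr hae)
  have e : ((n + 1 : ℕ) : ℝ) - 1 = n := by
    push_cast
    ring
  simp only [e, avg_congr_ae hae, mClosure_congr_ae (superlevel_congr_ae hae _),
    mBoundary_congr_ae (superlevel_congr_ae hae _)]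
  refine h1.trans (mul_le_mul_left ?_ _)
  rw [← ENNReal.ofReal_toReal hC]
  exact ENNReal.ofReal_le_ofReal (by simp)
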